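/- Let G be a finite p-group admitting an automorphism φ of order p^n with exactly p^m fixed points such that φ^{p^{n−1}} has exactly p^k fixed points. Then there exist numbers f₁ bounded in terms of (p,n,m,k) and g bounded in terms of m such that γ_g(G^{p^{f₁}}) ⊆ γ_p(G). -/

import Mathlib

/-- The lower central series of a subgroup `H` inside the ambient group, indexed so that
`gammaIn H 0 = H` and `gammaIn H (c-1)` is the `c`-th term `γ_c(H)`. -/
def gammaIn {G : Type*} [Group G] (H : Subgroup G) : ℕ → Subgroup G
  | 0 => H
  | n + 1 => ⁅gammaIn H n, H⁆


section reg
open scoped commutatorElement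
variable {G : Type*} [Group G]

structure IsFilt (F : ℕ → Subgroup G) (N : ℕ) : Prop where
  top0 : F 0 = ⊤
  top1 : F 1 = ⊤
  anti : Antitone F
  comm : ∀ i j, ⁅F i, F j⁆ ≤ F (i + j)
  bot : F N = ⊥

inductive Pol (F : ℕ → Subgroup G) : ℕ → (ℕ → G) → Prop
  | base (i k : ℕ) (g : G) (hg : g ∈ F (i + k)) : Pol F i (fun n => g ^ (n.choose k))
  | mul {i u v} : Pol F i u → Pol F i v → Pol F i (fun n => u n * v n)
  | inv {i u} : Pol F i u → Pol F i (fun n => (u n)⁻¹)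
  | comm {i j u v} : Pol F i u → Pol F j v → Pol F (i + j) (fun n => ⁅u n, v n⁆)
  | mono {i j u} : j ≤ i → Pol F i u → Pol F j u

namespace Pol
variable {F : ℕ → Subgroup G} {N : ℕ}

theorem mem (hF : IsFilt F N) {i u} (h : Pol F i u) : ∀ n, u n ∈ F i := by
  induction h with
  | base i k g hg => exact fun n => Subgroup.pow_mem _ (hF.anti (Nat.le_add_right i k) hg) _
  | mul _ _ h1 h2 => exact fun n => Subgroup.mul_mem _ (h1 n) (h2 n)
  | inv _ h1 => exact fun n => Subgroup.inv_mem _ (h1 n)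
  | comm _ _ h1 h2 => exact fun n => hF.comm _ _ (Subgroup.commutator_mem_commutator (h1 n) (h2 n))
  | mono h _ h1 => exact fun n => hF.anti h (h1 n)

theorem conj {i u h} (hh : Pol F i h) (hu : Pol F 0 u) :
    Pol F i (fun n => u n * h n * (u n)⁻¹) := by
  have := (Pol.mono (j := i) (by omega) (hu.comm hh)).mul hh
  convert this using 2 with n
  simp [commutatorElement_def]

theorem conj' {i u h} (hh : Pol F i h) (hu : Pol F 0 u) :
    Pol F i (fun n => (u n)⁻¹ * h n * (u n)) := by
  have := hh.conj hu.inv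
  simpa using this

theorem to0 {i u} (h : Pol F i u) : Pol F 0 u := Pol.mono (Nat.zero_le _) h

theorem one (i : ℕ) : Pol F i (fun _ => (1 : G)) := by
  have := Pol.base (F := F) i 0 1 (Subgroup.one_mem _)
  simpa using this

theorem diff {i u} (h : Pol F i u) : Pol F (i + 1) (fun n => (u n)⁻¹ * u (n + 1)) := by
  induction h with
  | base i k g hg =>
    rcases k with _ | k
    · simpa using Pol.one (F := F) (i + 1)
    · have := Pol.base (F := F) (i + 1) k g (by rwa [show i + 1 + k = i + (k + 1) by ring])
      convert this using 2 with n
      dsimp only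
      rw [Nat.choose_succ_succ, add_comm (n.choose k), pow_add]; simp
  | @mul i u v hu hv du dv =>
    have := (du.conj' hv.to0).mul dv
    convert this using 2 with n
    group
  | @inv i u hu du =>
    have := (du.inv).conj hu.to0
    convert this using 2 with n
    group
  | @comm i j u v hu hv du dv =>
    have hv' : Pol F j (fun n => v (n + 1)) := by
      have := hv.mul (Pol.mono (Nat.le_succ j) dv)
      simpa using this
    have h1 : Pol F (i + j + 1) _ := Pol.mono (by omega) (du.comm hv')
    have h2 : Pol F (i + j + 1) _ := Pol.mono (by omega) (hu.comm dv)
    have := ((h1.conj hu.to0).conj' (hu.comm hv).to0).mul (h2.conj hv.to0)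
    convert this using 2 with n
    simp only [commutatorElement_def]
    group
  | mono h _ h1 => exact Pol.mono (by omega) h1

theorem eq_of_lt (k : ℕ) : ∀ {i u}, Pol F i u → IsFilt F N → (∀ j < k, u j = 1) → u k ∈ F (i + k) := by
  induction k with
  | zero => intro i u h hF _; exact h.mem hF 0
  | succ k ih =>
    intro i u h hF hu
    have := ih h.diff hF (by
      intro j hj
      simp [hu j (by omega), hu (j + 1) (by omega)])
    simp only [hu k (by omega), inv_one, one_mul] at this
    rwa [show i + (k + 1) = i + 1 + k by ring]

end Pol

/-- subgroup generated by `p^i`-th powers of `A` -/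
def pw (p : ℕ) (A : Subgroup G) (i : ℕ) : Subgroup G :=
  Subgroup.closure {x | ∃ a ∈ A, x = a ^ (p ^ i)}

theorem pow_mem_pw {p : ℕ} {A : Subgroup G} {a : G} (h : a ∈ A) (i : ℕ) : a ^ (p ^ i) ∈ pw p A i :=
  Subgroup.subset_closure ⟨a, h, rfl⟩

theorem pw_mono {p : ℕ} {A B : Subgroup G} (h : A ≤ B) (i : ℕ) : pw p A i ≤ pw p B i :=
  Subgroup.closure_mono (fun _ ⟨a, ha, e⟩ => ⟨a, h ha, e⟩)

theorem pw_le {p : ℕ} {A : Subgroup G} (i : ℕ) : pw p A i ≤ A :=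
  (Subgroup.closure_le _).2 (fun _ ⟨_, ha, e⟩ => e ▸ Subgroup.pow_mem _ ha _)

theorem pw_map {H : Type*} [Group H] {p : ℕ} {A : Subgroup G} (i : ℕ) (f : G →* H) :
    (pw p A i).map f = pw p (A.map f) i := by
  unfold pw
  rw [MonoidHom.map_closure]
  congr 1
  ext x
  constructor
  · rintro ⟨_, ⟨a, ha, rfl⟩, rfl⟩
    exact ⟨f a, ⟨a, ha, rfl⟩, by simp⟩
  · rintro ⟨_, ⟨a, ha, rfl⟩, rfl⟩
    exact ⟨a ^ (p ^ i), ⟨a, ha, rfl⟩, by simp⟩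

theorem normal_iff_map {A : Subgroup G} : A.Normal ↔ ∀ g : G, A.map (MulAut.conj g).toMonoidHom ≤ A := by
  constructor
  · rintro h g _ ⟨a, ha, rfl⟩
    exact h.conj_mem a ha g
  · intro h
    exact ⟨fun a ha g => h g ⟨a, ha, rfl⟩⟩

instance pw_normal {p : ℕ} {A : Subgroup G} [hA : A.Normal] (i : ℕ) : (pw p A i).Normal := by
  rw [normal_iff_map] at *
  intro g
  rw [pw_map]
  exact pw_mono (hA g) i

theorem dvd_choose_pp {p i k : ℕ} (hp : p.Prime) (h0 : 0 < k) (hk : k < p) :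
    p ^ i ∣ (p ^ i).choose k := by
  obtain ⟨k, rfl⟩ : ∃ j, k = j + 1 := ⟨k - 1, by omega⟩
  obtain ⟨q, hq⟩ : ∃ q, p ^ i = q + 1 := ⟨p ^ i - 1, by have := Nat.pow_pos (n := i) hp.pos; omega⟩
  have h := Nat.add_one_mul_choose_eq q k
  have hc : Nat.Coprime (p ^ i) (k + 1) := by
    apply Nat.Coprime.pow_left
    rw [Nat.Prime.coprime_iff_not_dvd hp]
    intro hd
    have := Nat.le_of_dvd (by omega) hd
    omega
  apply hc.dvd_of_dvd_mul_right
  rw [hq, ← h]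
  exact Dvd.intro _ rfl

theorem taylor {F : ℕ → Subgroup G} {p : ℕ} (hp : p.Prime) (hF : IsFilt F p) (K : Subgroup G) (i : ℕ)
    (r : ℕ) : ∀ (k : ℕ), p ≤ k + r → 0 < k → ∀ f, Pol F 0 f → (∀ j < k, f j = 1) → (∀ n, f n ∈ K) →
      f (p ^ i) ∈ pw p K i := by
  induction r with
  | zero =>
    intro k hk _ f hf h1 _
    have : ∀ n, f n = 1 := by
      intro n
      induction n using Nat.strong_induction_on with
      | _ n ih =>
        by_cases hn : n < k
        · exact h1 n hn
        · have := hf.eq_of_lt n hF ih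
          have h2 := hF.anti (show p ≤ 0 + n by omega) this
          rw [hF.bot] at h2
          simpa using h2
    rw [this]
    exact Subgroup.one_mem _
  | succ r ih =>
    intro k hk hk0 f hf h1 hK
    by_cases hkp : p ≤ k
    · exact ih k (by omega) hk0 f hf h1 hK
    have hs := hf.eq_of_lt k hF h1
    set s := f k
    have hb : Pol F 0 (fun n => s ^ (n.choose k)) := Pol.base 0 k s hs
    have h2 := ih (k + 1) (by omega) (by omega) _ (hb.inv.mul hf) (by
      intro j hj
      rcases Nat.lt_succ_iff_lt_or_eq.1 hj with h | h
      · simp [Nat.choose_eq_zero_of_lt h, h1 j h]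
      · subst h; simp [s]) (fun n => K.mul_mem (K.inv_mem (K.pow_mem (hK k) _)) (hK n))
    obtain ⟨c, hc⟩ := dvd_choose_pp (i := i) hp hk0 (by omega)
    have h3 : s ^ ((p ^ i).choose k) ∈ pw p K i := by
      rw [hc, mul_comm, pow_mul]
      exact pow_mem_pw (K.pow_mem (hK k) _) i
    have := Subgroup.mul_mem _ h3 h2
    simpa using this

variable {F : ℕ → Subgroup G} {p : ℕ}

theorem mul_pow_mem (hp : p.Prime) (hF : IsFilt F p) (A T : Subgroup G) [A.Normal] [T.Normal] (i : ℕ)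
    {x t : G} (hx : x ∈ A) (ht : t ∈ T) :
    (t ^ (p ^ i))⁻¹ * (x ^ (p ^ i))⁻¹ * (x * t) ^ (p ^ i) ∈ pw p ⁅A, T⁆ i := by
  have hb : ∀ g : G, Pol F 0 (fun n => g ^ n) := by
    intro g
    have := Pol.base (F := F) 0 1 g (by rw [hF.top1]; trivial)
    simpa using this
  refine taylor hp hF ⁅A, T⁆ i p 1 (by omega) (by omega) _
    (((hb t).inv.mul (hb x).inv).mul (hb (x * t))) ?_ ?_
  · intro j hj
    obtain rfl : j = 0 := by omega
    simp
  · intro n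
    have hc : (QuotientGroup.mk' ⁅A, T⁆ x) * (QuotientGroup.mk' ⁅A, T⁆ t)
        = (QuotientGroup.mk' ⁅A, T⁆ t) * (QuotientGroup.mk' ⁅A, T⁆ x) := by
      rw [← map_mul, ← map_mul]
      apply Eq.symm
      rw [QuotientGroup.mk'_eq_mk']
      refine ⟨⁅x⁻¹, t⁻¹⁆, Subgroup.commutator_mem_commutator (A.inv_mem hx) (T.inv_mem ht), ?_⟩
      simp [commutatorElement_def, mul_assoc]
    rw [← QuotientGroup.eq_one_iff]
    change QuotientGroup.mk' ⁅A, T⁆ _ = 1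
    simp only [map_mul, map_inv, map_pow]
    rw [Commute.mul_pow hc]
    group

/-- Elements of `pw p T i` are powers -/
theorem exists_pow_mul (hp : p.Prime) (hF : IsFilt F p) (i : ℕ) (r : ℕ) :
    ∀ (j : ℕ), p ≤ j + r → ∀ (T : Subgroup G), T.Normal → T ≤ F j → ∀ v ∈ pw p T i, ∀ x : G,
      ∃ t ∈ T, x ^ (p ^ i) * v = (x * t) ^ (p ^ i) := by
  induction r with
  | zero =>
    intro j hj T hT hTF v hv x
    have hTb : T = ⊥ := by
      rw [eq_bot_iff, ← hF.bot]; exact hTF.trans (hF.anti (by omega))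
    subst hTb
    have := pw_le i hv
    rw [Subgroup.mem_bot] at this
    exact ⟨1, Subgroup.one_mem _, by simp [this]⟩
  | succ r ih =>
    intro j hj T hT hTF v hv
    have hTT : ⁅(⊤ : Subgroup G), T⁆ ≤ T := Subgroup.commutator_le_right _ _
    have hTT2 : ⁅(⊤ : Subgroup G), T⁆ ≤ F (j + 1) := by
      have := Subgroup.commutator_mono (le_of_eq hF.top1.symm) hTF
      exact this.trans ((hF.comm 1 j).trans (by rw [add_comm]))
    have key : ∀ a ∈ T, ∀ x : G, ∃ t ∈ T, x ^ (p ^ i) * a ^ (p ^ i) = (x * t) ^ (p ^ i) := by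
      intro a ha x
      have h := mul_pow_mem hp hF ⊤ T i (Subgroup.mem_top x) ha
      obtain ⟨t, ht, e⟩ := ih (j + 1) (by omega) ⁅⊤, T⁆ inferInstance hTT2 _ (Subgroup.inv_mem _ h) (x * a)
      refine ⟨a * t, T.mul_mem ha (hTT ht), ?_⟩
      rw [← mul_assoc, ← e]
      group
    unfold pw at hv
    induction hv using Subgroup.closure_induction with
    | mem y hy =>
      intro x
      obtain ⟨a, ha, rfl⟩ := hy
      exact key a ha x
    | one => exact fun x => ⟨1, T.one_mem, by simp⟩
    | mul y z _ _ hy hz =>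
      intro x
      obtain ⟨t, ht, e⟩ := hy x
      obtain ⟨t', ht', e'⟩ := hz (x * t)
      exact ⟨t * t', T.mul_mem ht ht', by rw [← mul_assoc, e, e', mul_assoc x]⟩
    | inv y _ hy =>
      intro x
      obtain ⟨t, ht, e⟩ := hy 1
      obtain ⟨t', ht', e'⟩ := key t⁻¹ (T.inv_mem ht) x
      refine ⟨t', ht', ?_⟩
      rw [← e']
      simp at e
      simp [e]

theorem mem_pw (hp : p.Prime) (hF : IsFilt F p) {T : Subgroup G} [hT : T.Normal] {i : ℕ} {v : G} :
    v ∈ pw p T i ↔ ∃ t ∈ T, v = t ^ (p ^ i) := by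
  constructor
  · intro h
    obtain ⟨t, ht, e⟩ := exists_pow_mul hp hF i p 0 (by omega) T hT (by rw [hF.top0]; exact le_top) v h 1
    exact ⟨t, ht, by simpa using e⟩
  · rintro ⟨t, ht, rfl⟩; exact pow_mem_pw ht i

theorem pw_pw (hp : p.Prime) (hF : IsFilt F p) (T : Subgroup G) [T.Normal] (i j : ℕ) :
    pw p (pw p T i) j = pw p T (i + j) := by
  ext x
  rw [mem_pw hp hF, mem_pw hp hF]
  constructor
  · rintro ⟨y, hy, rfl⟩
    obtain ⟨z, hz, rfl⟩ := (mem_pw hp hF).1 hy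
    exact ⟨z, hz, by rw [← pow_mul, pow_add]⟩
  · rintro ⟨z, hz, rfl⟩
    exact ⟨_, pow_mem_pw hz i, by rw [← pow_mul, pow_add]⟩

/-- `(x t)^q ∈ x^q T^q`. -/
theorem mul_pow_mem' (hp : p.Prime) (hF : IsFilt F p) (T : Subgroup G) [T.Normal] (i : ℕ)
    (x : G) {t : G} (ht : t ∈ T) : (x ^ (p ^ i))⁻¹ * (x * t) ^ (p ^ i) ∈ pw p T i := by
  have h := mul_pow_mem hp hF ⊤ T i (Subgroup.mem_top x) ht
  have h2 := pw_mono (p := p) (Subgroup.commutator_le_right ⊤ T) i h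
  have := Subgroup.mul_mem _ (pow_mem_pw (p := p) ht i) h2
  convert this using 1
  group

theorem R1 (hp : p.Prime) (hF : IsFilt F p) (A B : Subgroup G) [A.Normal] [B.Normal] (i : ℕ) :
    ⁅pw p A i, B⁆ ≤ pw p ⁅A, B⁆ i := by
  rw [Subgroup.commutator_le]
  intro x hx b hb
  obtain ⟨a, ha, rfl⟩ := (mem_pw hp hF).1 hx
  have hc : ⁅a⁻¹, b⁆ ∈ ⁅A, B⁆ := Subgroup.commutator_mem_commutator (A.inv_mem ha) hb
  have h := mul_pow_mem' hp hF ⁅A, B⁆ i a hc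
  have e : a * ⁅a⁻¹, b⁆ = b * a * b⁻¹ := by simp [commutatorElement_def, mul_assoc]
  rw [e, conj_pow] at h
  have h2 := (inferInstance : (pw p ⁅A, B⁆ i).Normal).conj_mem _ (Subgroup.inv_mem _ h) (a ^ p ^ i)
  convert h2 using 1
  simp only [commutatorElement_def]
  group

theorem R2 (hp : p.Prime) (hF : IsFilt F p) (i : ℕ) (A : Subgroup G) [A.Normal] (r : ℕ) :
    ∀ (j : ℕ), p ≤ j + r → ∀ B : Subgroup G, B.Normal → B ≤ F j → pw p ⁅A, B⁆ i ≤ ⁅pw p A i, B⁆ := by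
  induction r with
  | zero =>
    intro j hj B hB hBF
    have hTb : B = ⊥ := by
      rw [eq_bot_iff, ← hF.bot]; exact hBF.trans (hF.anti (by omega))
    subst hTb
    rw [Subgroup.commutator_bot_right]
    exact (pw_le i).trans bot_le
  | succ r ih =>
    intro j hj B hB hBF
    have hY : ⁅A, B⁆ ≤ F (j + 1) := by
      have := Subgroup.commutator_mono (le_top.trans (le_of_eq hF.top1.symm) : A ≤ F 1) hBF
      exact this.trans ((hF.comm 1 j).trans (by rw [add_comm]))
    have h1 : pw p ⁅A, ⁅A, B⁆⁆ i ≤ ⁅pw p A i, B⁆ :=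
      (ih (j + 1) (by omega) ⁅A, B⁆ inferInstance hY).trans
        (Subgroup.commutator_mono le_rfl (Subgroup.commutator_le_right A B))
    have h2 : ∀ z ∈ A, ∀ z' ∈ ⁅A, B⁆,
        (z' ^ (p ^ i))⁻¹ * (z ^ (p ^ i))⁻¹ * (z * z') ^ (p ^ i) ∈ ⁅pw p A i, B⁆ := fun z hz z' hz' =>
      h1 (mul_pow_mem hp hF A ⁅A, B⁆ i hz hz')
    have h3 : ∀ z ∈ ⁅A, B⁆, z ∈ ⁅A, B⁆ ∧ z ^ (p ^ i) ∈ ⁅pw p A i, B⁆ := by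
      intro z hz
      rw [Subgroup.commutator_def] at hz
      induction hz using Subgroup.closure_induction with
      | mem y hy =>
        obtain ⟨a, ha, b, hb, rfl⟩ := hy
        refine ⟨Subgroup.commutator_mem_commutator ha hb, ?_⟩
        have hc : ⁅a, b⁆ ∈ ⁅A, B⁆ := Subgroup.commutator_mem_commutator ha hb
        have h := h2 a⁻¹ (A.inv_mem ha) ⁅a, b⁆ hc
        have e : a⁻¹ * ⁅a, b⁆ = b * a⁻¹ * b⁻¹ := by simp [commutatorElement_def, mul_assoc]
        rw [e, conj_pow] at h
        have h4 : ⁅a ^ (p ^ i), b⁆ ∈ ⁅pw p A i, B⁆ :=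
          Subgroup.commutator_mem_commutator (pow_mem_pw ha i) hb
        have h5 := Subgroup.mul_mem _ h4 (Subgroup.inv_mem _ h)
        convert h5 using 1
        simp only [commutatorElement_def]
        group
      | one => exact ⟨Subgroup.one_mem _, by simp⟩
      | mul y z _ _ hy hz =>
        refine ⟨Subgroup.mul_mem _ hy.1 hz.1, ?_⟩
        have h := h2 y (Subgroup.commutator_le_left A B hy.1) z hz.1
        have := Subgroup.mul_mem _ (Subgroup.mul_mem _ hy.2 hz.2) h
        convert this using 1
        group
      | inv y _ hy =>
        refine ⟨Subgroup.inv_mem _ hy.1, ?_⟩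
        rw [inv_pow]; exact Subgroup.inv_mem _ hy.2
    intro x hx
    obtain ⟨z, hz, rfl⟩ := (mem_pw hp hF).1 hx
    exact (h3 z hz).2

theorem R (hp : p.Prime) (hF : IsFilt F p) (A B : Subgroup G) [A.Normal] [hB : B.Normal] (i : ℕ) :
    ⁅pw p A i, B⁆ = pw p ⁅A, B⁆ i :=
  le_antisymm (R1 hp hF A B i)
    (R2 hp hF i A p 0 (by omega) B hB (by rw [hF.top0]; exact le_top))

instance gammaIn_normal (A : Subgroup G) [hA : A.Normal] (n : ℕ) : (gammaIn A n).Normal := by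
  induction n with
  | zero => exact hA
  | succ n ih => unfold gammaIn; infer_instance

theorem three_sub (A B C N : Subgroup G) [N.Normal] (h1 : ⁅⁅B, C⁆, A⁆ ≤ N) (h2 : ⁅⁅C, A⁆, B⁆ ≤ N) :
    ⁅⁅A, B⁆, C⁆ ≤ N := by
  have key : ∀ X : Subgroup G, X ≤ N ↔ X.map (QuotientGroup.mk' N) = ⊥ := by
    intro X
    rw [Subgroup.map_eq_bot_iff, QuotientGroup.ker_mk']
  rw [key, Subgroup.map_commutator, Subgroup.map_commutator] at *
  exact Subgroup.commutator_commutator_eq_bot_of_rotate h1 h2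

theorem gamma_comm (A : Subgroup G) [A.Normal] (i : ℕ) : ∀ j,
    ⁅gammaIn A i, gammaIn A j⁆ ≤ gammaIn A (i + j + 1) := by
  intro j
  induction j generalizing i with
  | zero => exact le_rfl
  | succ j ih =>
    change ⁅gammaIn A i, ⁅gammaIn A j, A⁆⁆ ≤ _
    rw [Subgroup.commutator_comm]
    apply three_sub
    · rw [Subgroup.commutator_comm A]
      exact (ih (i + 1)).trans (le_of_eq (by congr 1; ring))
    · calc ⁅⁅gammaIn A i, gammaIn A j⁆, A⁆ ≤ ⁅gammaIn A (i + j + 1), A⁆ :=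
          Subgroup.commutator_mono (ih i) le_rfl
        _ = _ := rfl

theorem gamma_anti (A : Subgroup G) [A.Normal] : Antitone (gammaIn A) :=
  antitone_nat_of_succ_le (fun n => Subgroup.commutator_le_left _ _)

theorem gamma_mono {A B : Subgroup G} (h : A ≤ B) (n : ℕ) : gammaIn A n ≤ gammaIn B n := by
  induction n with
  | zero => exact h
  | succ n ih => exact Subgroup.commutator_mono ih h

theorem isFilt_of_class (hp : p.Prime) (h : gammaIn (⊤ : Subgroup G) (p - 1) = ⊥) :
    IsFilt (fun i => gammaIn (⊤ : Subgroup G) (i - 1)) p where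
  top0 := rfl
  top1 := rfl
  anti := fun i j hij => gamma_anti ⊤ (by omega)
  bot := h
  comm := fun i j => by
    rcases i with _ | i
    · exact (Subgroup.commutator_le_right _ _).trans (gamma_anti ⊤ (by omega))
    · rcases j with _ | j
      · exact (Subgroup.commutator_le_left _ _).trans (gamma_anti ⊤ (by omega))
      · exact (gamma_comm ⊤ i j).trans (gamma_anti ⊤ (by omega))

theorem gammaIn_pw (hp : p.Prime) (hF : IsFilt F p) (A : Subgroup G) [A.Normal] (i n : ℕ) :
    gammaIn (pw p A i) n = pw p (gammaIn A n) ((n + 1) * i) := by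
  induction n with
  | zero => simp [gammaIn]
  | succ n ih =>
    change ⁅gammaIn (pw p A i) n, pw p A i⁆ = _
    rw [ih, R hp hF, Subgroup.commutator_comm, R hp hF, Subgroup.commutator_comm, pw_pw hp hF]
    change pw p ⁅gammaIn A n, A⁆ _ = pw p ⁅gammaIn A n, A⁆ _
    congr 1; ring

end reg


section krek
variable {L : Type*} [LieRing L] {p : ℕ}

theorem jac (a b c : L) : ⁅⁅a, b⁆, c⁆ = ⁅⁅a, c⁆, b⁆ + ⁅a, ⁅b, c⁆⁆ := by
  have h := leibniz_lie c a b
  rw [← lie_skew ⁅a, b⁆ c, h, ← lie_skew c a, ← lie_skew c b]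
  simp only [neg_lie, lie_neg]
  abel

theorem jac' (a b c : L) : ⁅a, ⁅b, c⁆⁆ = ⁅⁅a, b⁆, c⁆ - ⁅⁅a, c⁆, b⁆ := by
  rw [jac a b c]; abel

abbrev Fam (p : ℕ) (L : Type*) [LieRing L] := ZMod p → AddSubgroup L

def star (A B : Fam p L) : Fam p L :=
  fun i => AddSubgroup.closure {w | ∃ a b x y, a + b = i ∧ x ∈ A a ∧ y ∈ B b ∧ w = ⁅x, y⁆}

theorem mem_star {A B : Fam p L} {a b : ZMod p} {x y : L} (hx : x ∈ A a) (hy : y ∈ B b) :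
    ⁅x, y⁆ ∈ star A B (a + b) := AddSubgroup.subset_closure ⟨a, b, x, y, rfl, hx, hy, rfl⟩

theorem star_le {A B C : Fam p L} :
    star A B ≤ C ↔ ∀ a b x y, x ∈ A a → y ∈ B b → ⁅x, y⁆ ∈ C (a + b) := by
  constructor
  · intro h a b x y hx hy
    exact h _ (mem_star hx hy)
  · intro h i
    refine (AddSubgroup.closure_le _).2 ?_
    rintro _ ⟨a, b, x, y, rfl, hx, hy, rfl⟩
    exact h a b x y hx hy

theorem star_mono {A B A' B' : Fam p L} (h : A ≤ A') (h' : B ≤ B') : star A B ≤ star A' B' :=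
  star_le.2 fun a b _ _ hx hy => mem_star (h a hx) (h' b hy)

theorem star_star_le {A B C D : Fam p L}
    (h : ∀ a b c x y z, x ∈ A a → y ∈ B b → z ∈ C c → ⁅⁅x, y⁆, z⁆ ∈ D (a + b + c)) :
    star (star A B) C ≤ D := by
  rw [star_le]
  intro i c w z hw hz
  induction hw using AddSubgroup.closure_induction with
  | mem w hw =>
    obtain ⟨a, b, x, y, rfl, hx, hy, rfl⟩ := hw
    exact h a b c x y z hx hy hz
  | zero => rw [zero_lie]; exact AddSubgroup.zero_mem _
  | add x y _ _ h1 h2 => rw [add_lie]; exact AddSubgroup.add_mem _ h1 h2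
  | neg x _ h1 => rw [neg_lie]; exact AddSubgroup.neg_mem _ h1

theorem star_jac (A B C : Fam p L) : star (star A B) C ≤ star (star A C) B ⊔ star A (star B C) := by
  apply star_star_le
  intro a b c x y z hx hy hz
  rw [jac]
  refine AddSubgroup.add_mem_sup ?_ ?_
  · rw [show a + b + c = a + c + b by ring]; exact mem_star (mem_star hx hz) hy
  · rw [add_assoc]; exact mem_star hx (mem_star hy hz)

theorem star_comm_le (A B : Fam p L) : star A B ≤ star B A := by
  rw [star_le]
  intro a b x y hx hy
  rw [← lie_skew, add_comm]
  exact AddSubgroup.neg_mem _ (mem_star hy hx)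

theorem star_sup_le (A B C : Fam p L) : star (A ⊔ B) C ≤ star A C ⊔ star B C := by
  rw [star_le]
  intro a b x y hx hy
  obtain ⟨u, hu, v, hv, rfl⟩ := AddSubgroup.mem_sup.1 hx
  rw [add_lie]
  exact AddSubgroup.add_mem_sup (mem_star hu hy) (mem_star hv hy)

def der (E : Fam p L) : ℕ → Fam p L
  | 0 => E
  | n + 1 => star (der E n) (der E n)

theorem der_add (E : Fam p L) (a b : ℕ) : der E (a + b) = der (der E a) b := by
  induction b with
  | zero => rfl
  | succ b ih => rw [← add_assoc]; simp only [der]; rw [ih]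

theorem der_ideal {E : Fam p L} (hE : star E E ≤ E) (n : ℕ) :
    star (der E n) E ≤ der E n ∧ der E n ≤ E := by
  induction n with
  | zero => exact ⟨hE, le_rfl⟩
  | succ n ih =>
    refine ⟨(star_jac _ _ _).trans (sup_le ?_ ?_), (star_mono ih.2 ih.2).trans hE⟩
    · exact star_mono ih.1 le_rfl
    · exact star_mono le_rfl ih.1

theorem der_graded {E : Fam p L} (hE : star E E ≤ E) (n : ℕ) : star (der E n) (der E n) ≤ der E n :=
  (star_mono le_rfl (der_ideal hE n).2).trans (der_ideal hE n).1

/-- graded subring generated by `E i`, `i.val ≥ k`. -/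
inductive SP (E : Fam p L) (k : ℕ) : ZMod p → L → Prop
  | gen {i x} : k ≤ i.val → x ∈ E i → SP E k i x
  | zero {i} : SP E k i 0
  | add {i x y} : SP E k i x → SP E k i y → SP E k i (x + y)
  | neg {i x} : SP E k i x → SP E k i (-x)
  | brk {i j x y} : SP E k i x → SP E k j y → SP E k (i + j) ⁅x, y⁆

def SS (E : Fam p L) (k : ℕ) : Fam p L := fun i =>
  { carrier := {x | SP E k i x}
    add_mem' := fun h1 h2 => SP.add h1 h2
    zero_mem' := SP.zero
    neg_mem' := fun h => SP.neg h }

inductive WD (E : Fam p L) (k : ℕ) : ℕ → ZMod p → ZMod p → L → Prop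
  | nil {a y} : y ∈ E a → WD E k 0 a a y
  | snoc {n a c i Y x} : WD E k n a c Y → k ≤ i.val → x ∈ E i → WD E k (n + 1) a (c + i) ⁅Y, x⁆

def Sp (E : Fam p L) (k : ℕ) (n : ℕ) : Fam p L := fun c =>
  AddSubgroup.closure {Y | ∃ n' ≤ n, ∃ a, a ≠ (k : ZMod p) ∧ WD E k n' a c Y}

variable {E : Fam p L} {k : ℕ}

theorem WD.mem_Sp {n a c Y} (h : WD E k n a c Y) (ha : a ≠ (k : ZMod p)) : Y ∈ Sp E k n c :=
  AddSubgroup.subset_closure ⟨n, le_rfl, a, ha, h⟩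

theorem Sp_mono {n n' : ℕ} (h : n ≤ n') : Sp E k n ≤ Sp E k n' := fun _ =>
  AddSubgroup.closure_mono (fun _ ⟨m, hm, r⟩ => ⟨m, hm.trans h, r⟩)

theorem Sp_lie {n c i Y x} (hY : Y ∈ Sp E k n c) (hi : k ≤ i.val) (hx : x ∈ E i) :
    ⁅Y, x⁆ ∈ Sp E k (n + 1) (c + i) := by
  induction hY using AddSubgroup.closure_induction with
  | mem w hw =>
    obtain ⟨m, hm, a, ha, hw⟩ := hw
    exact Sp_mono (by omega) _ ((WD.snoc hw hi hx).mem_Sp ha)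
  | zero => rw [zero_lie]; exact AddSubgroup.zero_mem _
  | add x y _ _ h1 h2 => rw [add_lie]; exact AddSubgroup.add_mem _ h1 h2
  | neg x _ h1 => rw [neg_lie]; exact AddSubgroup.neg_mem _ h1

theorem Sp_lie_WD {n a c Y} (h : WD E k n a c Y) (ha : k ≤ a.val) :
    ∀ {m d w}, w ∈ Sp E k m d → ⁅w, Y⁆ ∈ Sp E k (m + n + 1) (d + c) := by
  induction h with
  | nil hy => intro m d w hw; exact Sp_lie hw ha hy
  | @snoc n a c i Y x hY hi hx ih =>
    intro m d w hw
    rw [jac']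
    refine AddSubgroup.sub_mem _ ?_ ?_
    · have := Sp_lie (ih ha hw) hi hx
      rwa [add_assoc d] at this
    · have := ih ha (Sp_lie hw hi hx)
      rw [show d + (c + i) = d + i + c by ring]
      exact Sp_mono (by omega) _ this

theorem WD.mono {k' n a c Y} (h : WD E k n a c Y) (hk : k' ≤ k) : WD E k' n a c Y := by
  induction h with
  | nil hy => exact WD.nil hy
  | snoc _ hi hx ih => exact WD.snoc ih (hk.trans hi) hx

theorem WD.mem_SS {n a c Y} (h : WD E k n a c Y) (ha : k ≤ a.val) : SP E k c Y := by
  induction h with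
  | nil hy => exact SP.gen ha hy
  | snoc _ hi hx ih => exact SP.brk (ih ha) (SP.gen hi hx)

theorem WD.absorb (hE : star E E ≤ E) {n a c Y} (h : WD E k n a c Y) (hn : 0 < n) :
    ∃ i : ZMod p, k ≤ i.val ∧ WD E k (n - 1) (a + i) c Y := by
  induction h with
  | nil hy => exact absurd hn (lt_irrefl _)
  | @snoc n a c i Y x hY hi hx ih =>
    rcases Nat.eq_zero_or_pos n with rfl | hn
    · cases hY with
      | nil hy => exact ⟨i, hi, WD.nil (hE _ (mem_star hy hx))⟩
    · obtain ⟨j, hj, h⟩ := ih hn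
      refine ⟨j, hj, ?_⟩
      have := WD.snoc h hi hx
      rwa [show n - 1 + 1 = n + 1 - 1 by omega] at this

theorem claimB (hE : star E E ≤ E) (hk : k < p) {n a c Y x} (h : WD E (k + 1) n a c Y)
    (ha : k + 1 ≤ a.val) (hx : x ∈ E (k : ZMod p)) : ⁅Y, x⁆ ∈ Sp E k n (c + k) := by
  have hkv : ((k : ℕ) : ZMod p).val = k := ZMod.val_cast_of_lt hk
  induction h with
  | @nil a y hy =>
    refine WD.mem_Sp (WD.nil (hE _ (mem_star hy hx))) ?_
    intro h
    rw [add_eq_right] at h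
    subst h
    simp at ha
  | @snoc n a c i Y z hY hi hz ih =>
    have hane : a ≠ (k : ZMod p) := by
      rintro rfl; omega
    rw [jac]
    refine AddSubgroup.add_mem _ ?_ ?_
    · rw [show c + i + k = c + k + i by ring]
      exact Sp_lie (ih ha) (by omega) hz
    · have hw : ⁅z, x⁆ ∈ E (i + k) := hE _ (mem_star hz hx)
      by_cases hc : k ≤ (i + k).val
      · rw [add_assoc]
        exact Sp_lie ((hY.mono (Nat.le_succ k)).mem_Sp hane) hc hw
      · rw [← lie_skew]
        have h1 : ⁅z, x⁆ ∈ Sp E k 0 (i + k) := (WD.nil hw).mem_Sp (by intro h; rw [h, hkv] at hc; omega)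
        have := Sp_lie_WD (hY.mono (Nat.le_succ k)) (by omega) h1
        rw [show c + i + k = i + k + c by ring]
        exact AddSubgroup.neg_mem _ (Sp_mono (by omega) _ this)

theorem WD_cases [NeZero p] (hE : star E E ≤ E) (hk : k < p) {n a c Y} (h : WD E k n a c Y)
    (ha : k + 1 ≤ a.val) : WD E (k + 1) n a c Y ∨ (0 < n ∧ Y ∈ Sp E k (n - 1) c) := by
  induction h with
  | nil hy => exact Or.inl (WD.nil hy)
  | @snoc n a c i Y z hY hi hz ih =>
    rcases ih ha with h | ⟨hn, h⟩
    · rcases Nat.lt_or_ge k i.val with h1 | h1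
      · exact Or.inl (WD.snoc h h1 hz)
      · right
        have : i = (k : ZMod p) := by
          rw [← ZMod.natCast_zmod_val i]; congr 1; omega
        subst this
        exact ⟨by omega, claimB hE hk h ha hz⟩
    · right
      have := Sp_lie h hi hz
      refine ⟨by omega, ?_⟩
      rwa [show n - 1 + 1 = n + 1 - 1 by omega] at this

theorem WD_zero (h0 : E 0 = ⊥) {n c Y} (h : WD E k n 0 c Y) : Y = 0 := by
  generalize ha : (0 : ZMod p) = a at h
  induction h with
  | nil hy => subst ha; rw [h0] at hy; simpa using hy
  | snoc _ _ _ ih => rw [ih ha, zero_lie]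

variable [NeZero p]

theorem word_main (hE : star E E ≤ E) (h0 : E 0 = ⊥) (hk : k < p) (n : ℕ) :
    ∀ Y ∈ Sp E k n (k : ZMod p), SP E (k + 1) (k : ZMod p) Y := by
  have hkv : ((k : ℕ) : ZMod p).val = k := ZMod.val_cast_of_lt hk
  induction n using Nat.strong_induction_on with
  | _ n ih =>
    intro Y hY
    change Y ∈ SS E (k + 1) (k : ZMod p)
    refine (AddSubgroup.closure_le (SS E (k + 1) (k : ZMod p))).2 ?_ hY
    rintro Y ⟨m, hm, a, ha, hw⟩
    rcases Nat.lt_or_ge k a.val with h1 | h1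
    · rcases WD_cases hE hk hw h1 with h | ⟨hm0, h⟩
      · exact h.mem_SS h1
      · exact ih (m - 1) (by omega) Y h
    · have h2 : a.val ≠ k := by
        intro h; apply ha; rw [← ZMod.natCast_zmod_val a, h]
      by_cases ha0 : a = 0
      · subst ha0
        rw [WD_zero h0 hw]; exact SP.zero
      have ha0' : a.val ≠ 0 := by rwa [Ne, ZMod.val_eq_zero]
      rcases Nat.eq_zero_or_pos m with rfl | hm0
      · generalize hc : (k : ZMod p) = c at hw
        cases hw with
        | nil hy => exact absurd hc.symm ha
      · obtain ⟨i, hi, hw'⟩ := hw.absorb hE hm0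
        refine ih (m - 1) (by omega) Y (hw'.mem_Sp ?_)
        intro h
        have h3 : (a + i).val = k := by rw [h, hkv]
        rw [ZMod.val_add] at h3
        have := ZMod.val_lt i
        rcases Nat.lt_or_ge (a.val + i.val) p with h4 | h4
        · rw [Nat.mod_eq_of_lt h4] at h3; omega
        · rw [Nat.mod_eq_sub_mod h4, Nat.mod_eq_of_lt (by omega)] at h3; omega

theorem Sp_lie_SP {d y} (h : SP E k d y) : ∀ {m c w}, w ∈ Sp E k m c → ∃ m', ⁅w, y⁆ ∈ Sp E k m' (c + d) := by
  induction h with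
  | gen hi hx => intro m c w hw; exact ⟨_, Sp_lie hw hi hx⟩
  | zero => intro m c w _; exact ⟨0, by rw [lie_zero]; exact AddSubgroup.zero_mem _⟩
  | add _ _ h1 h2 =>
    intro m c w hw
    obtain ⟨a, ha⟩ := h1 hw
    obtain ⟨b, hb⟩ := h2 hw
    refine ⟨max a b, ?_⟩
    rw [lie_add]
    exact AddSubgroup.add_mem _ (Sp_mono (le_max_left _ _) _ ha) (Sp_mono (le_max_right _ _) _ hb)
  | neg _ h1 =>
    intro m c w hw
    obtain ⟨a, ha⟩ := h1 hw
    exact ⟨a, by rw [lie_neg]; exact AddSubgroup.neg_mem _ ha⟩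
  | @brk i j x y _ _ h1 h2 =>
    intro m c w hw
    obtain ⟨a, ha⟩ := h1 hw
    obtain ⟨a', ha'⟩ := h2 ha
    obtain ⟨b, hb⟩ := h2 hw
    obtain ⟨b', hb'⟩ := h1 hb
    refine ⟨max a' b', ?_⟩
    rw [jac']
    refine AddSubgroup.sub_mem _ (Sp_mono (le_max_left _ _) _ ?_) (Sp_mono (le_max_right _ _) _ ?_)
    · rwa [← add_assoc]
    · rwa [show c + (i + j) = c + j + i by ring]

theorem kreknin_step (k : ℕ) : k < p → ∀ E : Fam p L, star E E ≤ E → E 0 = ⊥ →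
    der E (2 ^ k - 1) ≤ SS E (k + 1) := by
  induction k with
  | zero =>
    intro _ E hE h0 i x hx
    by_cases hi : i = 0
    · subst hi
      simp only [pow_zero, Nat.sub_self, der] at hx
      rw [h0] at hx
      rw [AddSubgroup.mem_bot.1 hx]; exact SP.zero
    · refine SP.gen ?_ hx
      have : i.val ≠ 0 := by rwa [Ne, ZMod.val_eq_zero]
      omega
  | succ k ih =>
    intro hk E hE h0
    have hkv : ((k + 1 : ℕ) : ZMod p).val = k + 1 := ZMod.val_cast_of_lt hk
    have h1 := ih (by omega) E hE h0
    set M := der E (2 ^ k - 1) with hM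
    have hME : M ≤ E := (der_ideal hE _).2
    have h2 : ∀ y ∈ star M M ((k + 1 : ℕ) : ZMod p), SP E (k + 2) ((k + 1 : ℕ) : ZMod p) y := by
      intro y hy
      change y ∈ SS E (k + 2) ((k + 1 : ℕ) : ZMod p)
      refine (AddSubgroup.closure_le (SS E (k + 2) ((k + 1 : ℕ) : ZMod p))).2 ?_ hy
      rintro _ ⟨a, b, x, y, hab, hx, hy, rfl⟩
      by_cases ha : a = ((k + 1 : ℕ) : ZMod p)
      · have : b = 0 := by rw [ha] at hab; simpa using hab
        subst this
        have := hME _ hy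
        rw [h0] at this
        rw [AddSubgroup.mem_bot.1 this, lie_zero]; exact SP.zero
      · obtain ⟨m, hm⟩ := Sp_lie_SP (h1 _ hy) ((WD.nil (hME _ hx)).mem_Sp ha)
        rw [hab] at hm
        exact word_main hE h0 hk m _ hm
    have hE' : der E (2 ^ k) = star M M := by
      rw [hM]
      have : 2 ^ k = (2 ^ k - 1) + 1 := by have := Nat.one_le_two_pow (n := k); omega
      conv_lhs => rw [this]
      rfl
    have h3 := ih (by omega) (der E (2 ^ k)) (der_graded hE _) (by
      rw [eq_bot_iff, ← h0]; exact (der_ideal hE _).2 0)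
    rw [← der_add, show 2 ^ k + (2 ^ k - 1) = 2 ^ (k + 1) - 1 by
      have := Nat.one_le_two_pow (n := k); rw [pow_succ]; omega] at h3
    refine h3.trans ?_
    intro i x hx
    change SP E (k + 1 + 1) i x
    change SP _ _ _ _ at hx
    induction hx with
    | @gen i x hi hx =>
      rcases Nat.lt_or_ge (k + 1) i.val with h | h
      · exact SP.gen h ((der_ideal hE _).2 _ hx)
      · have : i = ((k + 1 : ℕ) : ZMod p) := by
          rw [← ZMod.natCast_zmod_val i]; congr 1; omega
        subst this
        rw [hE'] at hx
        exact h2 _ hx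
    | zero => exact SP.zero
    | add _ _ a b => exact SP.add a b
    | neg _ a => exact SP.neg a
    | brk _ _ a b => exact SP.brk a b

theorem kreknin (E : Fam p L) (hE : star E E ≤ E) (h0 : E 0 = ⊥) : der E (2 ^ (p - 1) - 1) = ⊥ := by
  have hp := NeZero.pos p
  rw [eq_bot_iff]
  intro i x hx
  have h : SP E (p - 1 + 1) i x := kreknin_step (p - 1) (by omega) E hE h0 i hx
  change x = 0
  clear hx
  induction h with
  | @gen i x hi _ => have := ZMod.val_lt i; omega
  | zero => rfl
  | add _ _ a b => rw [a, b, add_zero]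
  | neg _ a => rw [a, neg_zero]
  | brk _ _ a b => rw [a, zero_lie]

end krek


section hig
variable {L : Type*} [LieRing L] {p : ℕ}

/-- `M ⋆ E ⋆ ⋯ ⋆ E` -/
def its (E M : Fam p L) : ℕ → Fam p L
  | 0 => M
  | n + 1 => star (its E M n) E

theorem its_mono {E M M' : Fam p L} (h : M ≤ M') (n : ℕ) : its E M n ≤ its E M' n := by
  induction n with
  | zero => exact h
  | succ n ih => exact star_mono ih le_rfl

theorem its_add (E M : Fam p L) (a b : ℕ) : its E M (a + b) = its E (its E M a) b := by
  induction b with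
  | zero => rfl
  | succ b ih => rw [← add_assoc]; simp only [its]; rw [ih]

theorem its_chain {E : Fam p L} (M : ℕ → Fam p L) (r : ℕ) (h : ∀ j, its E (M j) r ≤ M (j + 1)) (n : ℕ) :
    its E (M 0) (n * r) ≤ M n := by
  induction n with
  | zero => simp [its]
  | succ n ih =>
    rw [add_mul, one_mul, its_add]
    exact (its_mono ih r).trans (h n)

open Classical in
/-- restriction of family to residues satisfying a predicate -/
noncomputable def restr (E : Fam p L) (P : ZMod p → Prop) : Fam p L := fun i => if P i then E i else ⊥

theorem mem_restr {E : Fam p L} {P : ZMod p → Prop} {i x} (h : x ∈ restr E P i) : x = 0 ∨ (P i ∧ x ∈ E i) := by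
  unfold restr at h
  split_ifs at h with h1
  · exact Or.inr ⟨h1, h⟩
  · exact Or.inl h

theorem restr_of {E : Fam p L} {P : ZMod p → Prop} {i x} (h1 : P i) (h : x ∈ E i) : x ∈ restr E P i := by
  unfold restr
  rw [if_pos h1]; exact h

def chainM (Z M I : Fam p L) : ℕ → Fam p L
  | 0 => M
  | j + 1 => star (chainM Z M I j) Z ⊔ I

theorem chainM_prop {E Z M I : Fam p L} (hE : star E E ≤ E) (hM : star M E ≤ M) (hI : star I E ≤ I) (hIM : I ≤ M)
    (hZE : Z ≤ E) (hZ : star M (star Z E) ≤ I) (j : ℕ) :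
    I ≤ chainM Z M I j ∧ chainM Z M I j ≤ M ∧ star (chainM Z M I j) E ≤ chainM Z M I j := by
  induction j with
  | zero => exact ⟨hIM, le_rfl, hM⟩
  | succ j ih =>
    obtain ⟨h1, h2, h3⟩ := ih
    refine ⟨le_sup_right, sup_le ((star_mono h2 hZE).trans hM) hIM, ?_⟩
    refine (star_sup_le _ _ _).trans (sup_le ?_ (hI.trans le_sup_right))
    refine (star_jac _ _ _).trans (sup_le ?_ ?_)
    · exact (star_mono h3 le_rfl).trans le_sup_left
    · exact ((star_mono h2 le_rfl).trans hZ).trans le_sup_right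

theorem restr_star_le {C E : Fam p L} (P : ZMod p → Prop) : star (restr C P) E ≤ star C E := by
  refine star_mono ?_ le_rfl
  intro i x hx
  rcases mem_restr hx with rfl | ⟨_, h⟩
  · exact AddSubgroup.zero_mem _
  · exact h

theorem chain_kill [Fact p.Prime] {E C M I : Fam p L} (h0 : E 0 = ⊥)
    (hI : star I E ≤ I) (hME : M ≤ E) (hCE : C ≤ E) (hIM : I ≤ M) (hM : star M E ≤ M) (a : ZMod p) :
    chainM (restr C (· = a)) M I p ≤ I := by
  set Z := restr C (· = a)
  have hp : p.Prime := Fact.out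
  have hZE : Z ≤ E := by
    intro i x hx
    rcases mem_restr hx with rfl | ⟨_, h⟩
    · exact AddSubgroup.zero_mem _
    · exact hCE _ h
  have hle : ∀ j, chainM Z M I j ≤ M := by
    intro j
    induction j with
    | zero => exact le_rfl
    | succ j ih => exact sup_le ((star_mono ih hZE).trans hM) hIM
  by_cases ha : a = 0
  · have : chainM Z M I (p - 1 + 1) ≤ I := by
      refine sup_le ?_ le_rfl
      rw [star_le]
      intro i b x y hx hy
      have : y = 0 := by
        rcases mem_restr hy with rfl | ⟨h, h'⟩
        · rfl
        · rw [h, ha] at h'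
          have := hCE _ h'
          rw [h0] at this
          exact this
      rw [this, lie_zero]; exact AddSubgroup.zero_mem _
    rwa [Nat.sub_add_cancel hp.one_lt.le] at this
  have key : ∀ j j', j' ≤ j → ∀ x ∈ chainM Z M I j ((j' : ZMod p) * a), x ∈ I ((j' : ZMod p) * a) := by
    intro j
    induction j with
    | zero =>
      intro j' hj' x hx
      obtain rfl : j' = 0 := by omega
      have := hME _ hx
      simp only [Nat.cast_zero, zero_mul, h0] at this
      rw [AddSubgroup.mem_bot.1 this]; exact AddSubgroup.zero_mem _
    | succ j ih =>
      intro j' hj' x hx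
      rcases Nat.eq_zero_or_pos j' with rfl | hpos
      · have := hME _ (hle _ _ hx)
        simp only [Nat.cast_zero, zero_mul, h0] at this
        rw [AddSubgroup.mem_bot.1 this]; exact AddSubgroup.zero_mem _
      obtain ⟨i, rfl⟩ : ∃ i, j' = i + 1 := ⟨j' - 1, by omega⟩
      obtain ⟨u, hu, v, hv, rfl⟩ := AddSubgroup.mem_sup.1 hx
      refine AddSubgroup.add_mem _ ?_ hv
      refine (AddSubgroup.closure_le _).2 ?_ hu
      rintro _ ⟨b, b', y, z, hb, hy, hz, rfl⟩
      rcases mem_restr hz with rfl | ⟨rfl, hz'⟩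
      · rw [lie_zero]; exact AddSubgroup.zero_mem _
      have hb2 : b = (i : ZMod p) * b' := by
        push_cast at hb
        linear_combination hb
      subst hb2
      rw [← hb]
      exact hI _ (mem_star (ih i (by omega) y hy) (hCE _ hz'))
  intro i x hx
  have := key p (i / a).val (ZMod.val_lt _).le x
  rw [ZMod.natCast_zmod_val, div_mul_cancel₀ _ ha] at this
  exact this hx

def actB (p : ℕ) : ℕ → ℕ
  | 0 => 1
  | c + 1 => p ^ p * actB p c

theorem act [Fact p.Prime] {E : Fam p L} (hE : star E E ≤ E) (h0 : E 0 = ⊥) (c : ℕ) :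
    ∀ M I : Fam p L, M ≤ E → I ≤ M → star M E ≤ M → star I E ≤ I → star M (its E E c) ≤ I →
      its E M (actB p c) ≤ I := by
  have hC : ∀ c, its E E c ≤ E := by
    intro c
    induction c with
    | zero => exact le_rfl
    | succ c ih => exact (star_mono ih le_rfl).trans hE
  induction c with
  | zero =>
    intro M I _ _ _ _ h
    exact h
  | succ c ih =>
    have inner : ∀ r s, s + r = p → ∀ M I : Fam p L, M ≤ E → I ≤ M → star M E ≤ M → star I E ≤ I →
        star M (its E E (c + 1)) ≤ I → star M (restr (its E E c) (fun i => i.val < s)) ≤ I →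
        its E M (p ^ r * actB p c) ≤ I := by
      intro r
      induction r with
      | zero =>
        intro s hs M I hME hIM hM hI _ h2
        rw [pow_zero, one_mul]
        refine ih M I hME hIM hM hI (le_trans (star_mono le_rfl ?_) h2)
        intro i x hx
        exact restr_of (by have := ZMod.val_lt i; omega) hx
      | succ r ihr =>
        intro s hs M I hME hIM hM hI h1 h2
        set Z := restr (its E E c) (fun i => i = (s : ZMod p)) with hZ
        have hZE : Z ≤ E := by
          intro i x hx
          rcases mem_restr hx with rfl | ⟨_, h⟩
          · exact AddSubgroup.zero_mem _
          · exact hC c _ h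
        have hch := chainM_prop hE hM hI hIM hZE
          ((star_mono le_rfl (restr_star_le _)).trans h1)
        have h3 := its_chain (E := E) (chainM Z M I) (p ^ r * actB p c) (by
          intro j
          obtain ⟨a1, a2, a3⟩ := hch j
          obtain ⟨b1, b2, b3⟩ := hch (j + 1)
          refine ihr (s + 1) (by omega) _ _ (a2.trans hME) ?_ a3 b3
            (((star_mono a2 le_rfl).trans h1).trans b1) ?_
          · exact sup_le ((star_mono le_rfl hZE).trans a3) a1
          · rw [star_le]
            intro a b x y hx hy
            rcases mem_restr hy with rfl | ⟨hb, hy⟩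
            · rw [lie_zero]; exact AddSubgroup.zero_mem _
            rcases Nat.lt_succ_iff_lt_or_eq.1 hb with h | h
            · exact b1 _ (h2 _ (mem_star (a2 _ hx) (restr_of h hy)))
            · have hb' : b = (s : ZMod p) := by rw [← ZMod.natCast_zmod_val b, h]
              exact (le_sup_left : _ ≤ chainM Z M I (j + 1)) _ (mem_star hx (restr_of hb' hy))) p
        rw [pow_succ, mul_assoc, mul_comm (p ^ r), mul_assoc, mul_comm _ (p ^ r)]
        exact h3.trans (chain_kill h0 hI hME (hC c) hIM hM _)
    intro M I hME hIM hM hI h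
    refine inner p 0 (by omega) M I hME hIM hM hI h ?_
    rw [star_le]
    intro a b x y hx hy
    rcases mem_restr hy with rfl | ⟨hb, hy⟩
    · rw [lie_zero]; exact AddSubgroup.zero_mem _
    · exact absurd hb (Nat.not_lt_zero _)

def solB (p : ℕ) : ℕ → ℕ
  | 0 => 0
  | t + 1 => solB p t + actB p (solB p t)

theorem sol_nil [Fact p.Prime] {E : Fam p L} (hE : star E E ≤ E) (h0 : E 0 = ⊥) (t : ℕ) :
    its E E (solB p t) ≤ der E t := by
  induction t with
  | zero => exact le_rfl
  | succ t ih =>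
    rw [solB, its_add]
    refine (its_mono ih _).trans ?_
    have h1 := der_ideal hE t
    have h2 := der_ideal hE (t + 1)
    exact act hE h0 _ _ _ h1.2 (der_graded hE t) h1.1 h2.1 (star_mono le_rfl ih)

def higB (p : ℕ) : ℕ := solB p (2 ^ (p - 1) - 1)

theorem higman [Fact p.Prime] {E : Fam p L} (hE : star E E ≤ E) (h0 : E 0 = ⊥) :
    its E E (higB p) = ⊥ := by
  rw [eq_bot_iff, ← kreknin E hE h0]
  exact sol_nil hE h0 _

/-- lower central series of a Lie ring -/
def lc (L : Type*) [LieRing L] : ℕ → AddSubgroup L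
  | 0 => ⊤
  | n + 1 => AddSubgroup.closure {w | ∃ x ∈ lc L n, ∃ y, w = ⁅x, y⁆}

open TensorProduct

abbrev CpA (p : ℕ) := AddMonoidAlgebra ℤ (ZMod p)

def TK (p : ℕ) (Q : Type*) [LieRing Q] : Type _ := CpA p ⊗[ℤ] Q

section TK
variable {Q : Type*} [LieRing Q]
noncomputable instance : LieRing (TK p Q) := inferInstanceAs (LieRing (CpA p ⊗[ℤ] Q))
noncomputable instance : LieAlgebra (CpA p) (TK p Q) :=
  inferInstanceAs (LieAlgebra (CpA p) (CpA p ⊗[ℤ] Q))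

noncomputable def tm : CpA p →+ Q →+ TK p Q :=
  { toFun := fun a =>
      { toFun := fun x => (a ⊗ₜ[ℤ] x : CpA p ⊗[ℤ] Q)
        map_zero' := TensorProduct.tmul_zero _ _
        map_add' := TensorProduct.tmul_add _ }
    map_zero' := by ext x; exact TensorProduct.zero_tmul _ _
    map_add' := fun a b => by ext x; exact TensorProduct.add_tmul _ _ _ }

theorem tm_lie (a b : CpA p) (x y : Q) : ⁅tm a x, tm b y⁆ = tm (a * b) ⁅x, y⁆ :=
  LieAlgebra.ExtendScalars.bracket_tmul ℤ (CpA p) Q Q a b x y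

theorem tm_smul (a b : CpA p) (x : Q) : a • tm b x = tm (a * b) x :=
  TensorProduct.smul_tmul' a b x

theorem tm_ind {P : TK p Q → Prop} (h0 : P 0) (hadd : ∀ u v, P u → P v → P (u + v))
    (ht : ∀ a x, P (tm a x)) (u : TK p Q) : P u :=
  TensorProduct.induction_on (motive := P) u h0 ht hadd

noncomputable def tT (ψ : Q →+ Q) : TK p Q →+ TK p Q :=
  (LinearMap.lTensor (CpA p) ψ.toIntLinearMap).toAddMonoidHom

theorem tT_tm (ψ : Q →+ Q) (a : CpA p) (x : Q) : tT ψ (tm a x) = tm a (ψ x) :=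
  LinearMap.lTensor_tmul _ _ _ _

noncomputable def tco : TK p Q →+ Q :=
  (TensorProduct.lift ((LinearMap.lsmul ℤ Q).comp (Finsupp.lapply (1 : ZMod p) ∘ₗ
      (AddMonoidAlgebra.coeffLinearEquiv ℤ).toLinearMap))).toAddMonoidHom

theorem tco_tm (a : CpA p) (x : Q) : tco (tm a x) = a.coeff 1 • x :=
  TensorProduct.lift.tmul (f' := (LinearMap.lsmul ℤ Q).comp (Finsupp.lapply (1 : ZMod p) ∘ₗ
      (AddMonoidAlgebra.coeffLinearEquiv ℤ).toLinearMap)) a x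
end TK

theorem higman_lie (hp : p.Prime) (Q : Type*) [LieRing Q] (ψ : Q →+ Q)
    (hψ : ∀ x y, ψ ⁅x, y⁆ = ⁅ψ x, ψ y⁆) (hψp : ∀ x, ψ^[p] x = x)
    (hN : ∀ x, ∑ i ∈ Finset.range p, ψ^[i] x = 0) :
    ∀ x ∈ lc Q (higB p), (p ^ (2 * higB p + 1)) • x = 0 := by
  have : Fact p.Prime := ⟨hp⟩
  let ω : ZMod p → CpA p := fun i => AddMonoidAlgebra.single i 1
  have hω : ∀ i j, ω i * ω j = ω (i + j) := fun i j => by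
    simp [ω, AddMonoidAlgebra.single_mul_single]
  have hω0 : ω 0 = 1 := rfl
  let T : TK p Q →+ TK p Q := tT ψ
  have hT : ∀ (a : CpA p) (x : Q), T (tm a x) = tm a (ψ x) := tT_tm ψ
  have hTl : ∀ u v, T ⁅u, v⁆ = ⁅T u, T v⁆ := by
    intro u v
    induction u using tm_ind with
    | h0 => simp
    | hadd x y h1 h2 => rw [add_lie, map_add, map_add, add_lie, h1, h2]
    | ht a x =>
      induction v using tm_ind with
      | h0 => simp
      | hadd x y h1 h2 => rw [lie_add, map_add, map_add, lie_add, h1, h2]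
      | ht b y => simp [tm_lie, hT, hψ]
  have hTs : ∀ (a : CpA p) u, T (a • u) = a • T u := by
    intro a u
    induction u using tm_ind with
    | h0 => simp
    | hadd x y h1 h2 => rw [smul_add, map_add, map_add, smul_add, h1, h2]
    | ht b y => simp [tm_smul, hT]
  have hTN : ∀ u, ∑ i ∈ Finset.range p, T^[i] u = 0 := by
    intro u
    induction u using tm_ind with
    | h0 => exact Finset.sum_eq_zero (fun i _ => by rw [iterate_map_zero])
    | hadd x y h1 h2 => simp only [iterate_map_add, Finset.sum_add_distrib, h1, h2, add_zero]
    | ht b y =>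
      have : ∀ i, T^[i] (tm b y) = tm b (ψ^[i] y) := by
        intro i
        induction i with
        | zero => rfl
        | succ i ih => rw [Function.iterate_succ_apply', ih, hT, Function.iterate_succ_apply']
      simp only [this]
      rw [← map_sum, hN, map_zero]
  let E : Fam p (TK p Q) := fun i =>
    { carrier := {w | ∃ z, T z = ω i • z ∧ w = p • z}
      zero_mem' := ⟨0, by simp, by simp⟩
      add_mem' := by
        rintro _ _ ⟨z, hz, rfl⟩ ⟨z', hz', rfl⟩
        exact ⟨z + z', by rw [map_add, hz, hz', smul_add], by rw [smul_add]⟩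
      neg_mem' := by
        rintro _ ⟨z, hz, rfl⟩
        exact ⟨-z, by rw [map_neg, hz, smul_neg], by rw [smul_neg]⟩ }
  have hE : star E E ≤ E := by
    rw [star_le]
    rintro a b _ _ ⟨x, hx, rfl⟩ ⟨y, hy, rfl⟩
    refine ⟨p • ⁅x, y⁆, ?_, ?_⟩
    · rw [map_nsmul, hTl, hx, hy, smul_lie, lie_smul, ← mul_smul, hω, smul_comm]
    · rw [nsmul_lie, lie_nsmul]
  have hE0 : E 0 = ⊥ := by
    rw [eq_bot_iff]
    rintro _ ⟨z, hz, rfl⟩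
    rw [hω0, one_smul] at hz
    have := hTN z
    have h2 : ∀ i, T^[i] z = z := fun i => Function.iterate_fixed hz i
    simp only [h2, Finset.sum_const, Finset.card_range] at this
    exact this
  let ν : CpA p := ∑ i : ZMod p, ω i
  have hνω : ∀ i, ω i * ν = ν := by
    intro i
    simp only [ν, Finset.mul_sum, hω]
    exact Equiv.sum_comp (Equiv.addLeft i) ω
  have hν : ν * ν = p • ν := by
    conv_lhs => rw [show ν * ν = ∑ i, ω i * ν from Finset.sum_mul _ _ _]
    simp [hνω]
  let θ : CpA p := (p : CpA p) - ν
  have hθ : θ * θ = p • θ := by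
    simp only [θ]
    have h1 : ν * ν = (p : CpA p) * ν := by rw [hν, nsmul_eq_mul]
    rw [nsmul_eq_mul]
    linear_combination h1
  have hθn : ∀ n, θ ^ (n + 1) = (p ^ n) • θ := by
    intro n
    induction n with
    | zero => simp
    | succ n ih => rw [pow_succ, ih, smul_mul_assoc, hθ, ← mul_smul, pow_succ]
  have hgen : ∀ x : Q, tm (p • θ) x ∈ (⨆ i, E i : AddSubgroup (TK p Q)) := by
    intro x
    let z : ZMod p → TK p Q := fun i => ∑ j : ZMod p, tm (ω (-(i * j))) (ψ^[j.val] x)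
    have hz : ∀ i, T (z i) = ω i • z i := by
      intro i
      simp only [z, map_sum, hT, Finset.smul_sum, tm_smul, hω]
      refine Fintype.sum_equiv (Equiv.addRight 1) _ _ ?_
      intro j
      simp only [Equiv.coe_addRight]
      have e1 : i + -(i * (j + 1)) = -(i * j) := by ring
      rw [e1, ← Function.iterate_succ_apply' ψ]
      congr 1
      rw [ZMod.val_add, ZMod.val_one]
      have := ZMod.val_lt j
      rcases Nat.lt_or_ge (j.val + 1) p with h | h
      · rw [Nat.mod_eq_of_lt h]
      · have h' : j.val.succ = p := by omega
        rw [h', show j.val + 1 = p from h', Nat.mod_self]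
        exact hψp x
    have hsum : ∑ i, z i = tm θ x := by
      simp only [z]
      rw [Finset.sum_comm]
      simp only [← map_sum, ← AddMonoidHom.finsetSum_apply]
      have e : ∀ j : ZMod p, ∑ i, ω (-(i * j)) = if j = 0 then (p : CpA p) else ν := by
        intro j
        split_ifs with h
        · subst h; simp [hω0]
        · refine Fintype.sum_bijective (fun i => -(i * j)) ?_ _ _ (fun i => rfl)
          rw [Fintype.bijective_iff_injective_and_card]
          refine ⟨fun a b hab => ?_, rfl⟩
          simpa [h] using hab
      simp only [e]
      have hN' : ∑ j : ZMod p, ψ^[j.val] x = 0 := by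
        rw [← hN x]
        refine (Finset.sum_bij (fun (j : ZMod p) _ => j.val) ?_ ?_ ?_ ?_)
        · intro j _; exact Finset.mem_range.2 (ZMod.val_lt j)
        · intro a _ b _ h; exact ZMod.val_injective p h
        · intro b hb; exact ⟨(b : ZMod p), Finset.mem_univ _, ZMod.val_cast_of_lt (Finset.mem_range.1 hb)⟩
        · intro a _; rfl
      have h3 : ∀ j : ZMod p, tm (if j = 0 then (p : CpA p) else ν) (ψ^[j.val] x)
          = (if j = 0 then tm θ x else 0) + tm ν (ψ^[j.val] x) := by
        intro j
        split_ifs with h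
        · subst h
          simp [θ]
        · simp
      simp only [h3, Finset.sum_add_distrib, ← map_sum, hN']
      simp
    rw [show tm (p • θ) x = ∑ i, p • z i by rw [← Finset.smul_sum, hsum, map_nsmul]; rfl]
    refine AddSubgroup.sum_mem _ (fun i _ => ?_)
    exact AddSubgroup.mem_iSup_of_mem i ⟨z i, hz i, rfl⟩
  have hind : ∀ n, ∀ x ∈ lc Q n, tm ((p • θ) ^ (n + 1)) x ∈
      (⨆ i, its E E n i : AddSubgroup (TK p Q)) := by
    intro n
    induction n with
    | zero => intro x _; rw [zero_add, pow_one]; exact hgen x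
    | succ n ih =>
      intro x hx
      induction hx using AddSubgroup.closure_induction with
      | mem w hw =>
        obtain ⟨x, hx, y, rfl⟩ := hw
        rw [pow_succ, ← tm_lie]
        have h1 := ih x hx
        have h2 := hgen y
        generalize tm ((p • θ) ^ (n + 1)) x = u at h1
        generalize tm (p • θ) y = v at h2
        refine AddSubgroup.iSup_induction _ (C := fun u => ⁅u, v⁆ ∈ _) h1 ?_ ?_ ?_
        · intro i a ha
          refine AddSubgroup.iSup_induction _ (C := fun v => ⁅a, v⁆ ∈ _) h2 ?_ ?_ ?_
          · exact fun j b hb => AddSubgroup.mem_iSup_of_mem (i + j) (mem_star ha hb)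
          · rw [lie_zero]; exact AddSubgroup.zero_mem _
          · intro a b h1 h2; rw [lie_add]; exact AddSubgroup.add_mem _ h1 h2
        · rw [zero_lie]; exact AddSubgroup.zero_mem _
        · intro a b h1 h2; rw [add_lie]; exact AddSubgroup.add_mem _ h1 h2
      | zero => rw [map_zero]; exact AddSubgroup.zero_mem _
      | add x y _ _ h1 h2 => rw [map_add]; exact AddSubgroup.add_mem _ h1 h2
      | neg x _ h1 => rw [map_neg]; exact AddSubgroup.neg_mem _ h1
  intro x hx
  have h := hind _ x hx
  rw [higman hE hE0] at h
  simp only [Pi.bot_apply, iSup_bot, AddSubgroup.mem_bot] at h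
  have h4 : (p • θ) ^ (higB p + 1) = (p ^ (2 * higB p + 1)) • θ := by
    rw [smul_pow, hθn, ← mul_smul, ← pow_add]; congr 2; ring
  rw [h4] at h
  have h5 := congrArg tco h
  rw [tco_tm, map_zero] at h5
  have h6 : ((p ^ (2 * higB p + 1)) • θ).coeff 1 = -(p ^ (2 * higB p + 1) : ℕ) := by
    have h7 : (1 : ZMod p) ≠ 0 := one_ne_zero
    have h8 : (θ.coeff 1 : ℤ) = -1 := by
      have : (p : CpA p) = AddMonoidAlgebra.single 0 (p : ℤ) := by
        rw [← AddMonoidAlgebra.natCast_def]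
      simp only [θ, ν, ω, this]
      simp [AddMonoidAlgebra.coeff_sum, Finsupp.single_apply, h7.symm]
    rw [AddMonoidAlgebra.coeff_smul_apply, h8]
    simp
  rw [h6, neg_smul, neg_eq_zero, natCast_zsmul] at h5
  exact h5

end hig


section flag
open Polynomial

variable {A : Type*} [AddCommGroup A]

def pm (A : Type*) [AddCommGroup A] (p a : ℕ) : AddSubgroup A := (nsmulAddMonoidHom (p ^ a) : A →+ A).range

theorem mem_pm {p a : ℕ} {x : A} : x ∈ pm A p a ↔ ∃ y, p ^ a • y = x := Iff.rfl

theorem pm_anti {p a b : ℕ} (h : a ≤ b) : pm A p b ≤ pm A p a := by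
  rintro _ ⟨y, rfl⟩
  exact ⟨p ^ (b - a) • y, by
    simp only [nsmulAddMonoidHom_apply]
    rw [← mul_smul, ← pow_add, Nat.add_sub_cancel' h]⟩

def PInv (φ : AddMonoid.End A) (Z : AddSubgroup A) : Prop := ∀ x ∈ Z, φ x ∈ Z

theorem PInv.aeval {φ : AddMonoid.End A} {Z : AddSubgroup A} (h : PInv φ Z) (f : ℤ[X]) :
    ∀ x ∈ Z, aeval φ f x ∈ Z := by
  induction f using Polynomial.induction_on' with
  | add f g hf hg =>
    intro x hx
    rw [map_add]; exact Z.add_mem (hf x hx) (hg x hx)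
  | monomial n a =>
    intro x hx
    rw [aeval_monomial]
    have : ∀ n, (φ ^ n) x ∈ Z := by
      intro n
      induction n with
      | zero => simpa using hx
      | succ n ih => rw [pow_succ']; exact h _ ih
    have e : (algebraMap ℤ (AddMonoid.End A) a * φ ^ n) x = a • (φ ^ n) x := by simp
    rw [e]
    exact Z.zsmul_mem (this n) a

theorem PInv.sup {φ : AddMonoid.End A} {Z W : AddSubgroup A} (h : PInv φ Z) (h' : PInv φ W) : PInv φ (Z ⊔ W) := by
  intro x hx
  obtain ⟨u, hu, v, hv, rfl⟩ := AddSubgroup.mem_sup.1 hx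
  rw [map_add]; exact AddSubgroup.add_mem_sup (h u hu) (h' v hv)

theorem PInv.pm (φ : AddMonoid.End A) (p a : ℕ) : PInv φ (pm A p a) := by
  rintro _ ⟨y, rfl⟩
  exact ⟨φ y, by simp⟩

/-- basic facts about `φ`. -/
structure Cyc (p κ : ℕ) (φ : AddMonoid.End A) : Prop where
  h1 : ∃ r : ℤ[X], (p : AddMonoid.End A) = (φ - 1) * aeval φ r
  h2 : ∃ s : ℤ[X], (φ - 1) ^ κ = (p : AddMonoid.End A) * aeval φ s

theorem aeval_comm (φ : AddMonoid.End A) (f g : ℤ[X]) : aeval φ f * aeval φ g = aeval φ g * aeval φ f := by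
  rw [← map_mul, ← map_mul, mul_comm]

theorem pi_eq (φ : AddMonoid.End A) : φ - 1 = aeval φ (X - 1 : ℤ[X]) := by simp

theorem E_mul (f g : AddMonoid.End A) (x : A) : (f * g) x = f (g x) := rfl
theorem E_add (f g : AddMonoid.End A) (x : A) : (f + g) x = f x + g x := rfl
theorem E_sub (f g : AddMonoid.End A) (x : A) : (f - g) x = f x - g x := rfl
theorem E_neg (f : AddMonoid.End A) (x : A) : (- f) x = - f x := rfl
theorem E_nat (n : ℕ) (x : A) : (n : AddMonoid.End A) x = n • x := rfl
theorem E_one (x : A) : (1 : AddMonoid.End A) x = x := rfl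
theorem E_zero (x : A) : (0 : AddMonoid.End A) x = 0 := rfl
theorem E_int (n : ℤ) (x : A) : (n : AddMonoid.End A) x = n • x := rfl

theorem End_natCast_pow_apply (p a : ℕ) (x : A) : ((p : AddMonoid.End A) ^ a) x = p ^ a • x := by
  rw [← Nat.cast_pow]; rfl

variable {p κ : ℕ} {φ : AddMonoid.End A}

theorem Cyc.D1 (h : Cyc p κ φ) (a : ℕ) : ∃ s : ℤ[X], ∀ x, ((φ - 1) ^ (κ * a)) x = p ^ a • (aeval φ s x) := by
  obtain ⟨s, hs⟩ := h.h2
  refine ⟨s ^ a, fun x => ?_⟩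
  rw [pow_mul, hs, (Nat.cast_commute p _).mul_pow, map_pow, E_mul, End_natCast_pow_apply]

theorem Cyc.D2 (h : Cyc p κ φ) (a : ℕ) : ∃ r : ℤ[X], ∀ x, p ^ a • x = aeval φ r (((φ - 1) ^ a) x) := by
  obtain ⟨r, hr⟩ := h.h1
  refine ⟨r ^ a, fun x => ?_⟩
  have hc : Commute (φ - 1) (aeval φ r) := by rw [pi_eq]; exact aeval_comm φ _ _
  rw [map_pow, ← E_mul, ← hc.symm.mul_pow, hc.symm.eq, ← hr, End_natCast_pow_apply]

def Pur (p B : ℕ) (φ : AddMonoid.End A) (Z : AddSubgroup A) : Prop :=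
  ∀ a, 1 ≤ a → a ≤ B → ∀ v, (φ - 1) v ∈ Z ⊔ pm A p a → v ∈ Z ⊔ pm A p (a - 1)

theorem D3 {B : ℕ} {Z : AddSubgroup A} (hZ : Pur p B φ Z) (b : ℕ) : ∀ a v, b ≤ a → a ≤ B →
    ((φ - 1) ^ b) v ∈ Z ⊔ pm A p a → v ∈ Z ⊔ pm A p (a - b) := by
  induction b with
  | zero => intro a v _ _ h; simpa using h
  | succ b ih =>
    intro a v h1 h2 h3
    rw [pow_succ', E_mul] at h3
    have := ih (a - 1) v (by omega) (by omega) (hZ a (by omega) h2 _ h3)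
    rwa [show a - 1 - b = a - (b + 1) by omega] at this

theorem D4 (hφ : Cyc p κ φ) {B : ℕ} {Z : AddSubgroup A} (hZ : Pur p B φ Z) (hI : PInv φ Z) (b a : ℕ) (v : A)
    (h1 : κ * b ≤ a) (h2 : a ≤ B) (h3 : p ^ b • v ∈ Z ⊔ pm A p a) : v ∈ Z ⊔ pm A p (a - κ * b) := by
  obtain ⟨s, hs⟩ := hφ.D1 b
  apply D3 hZ _ _ _ h1 h2
  rw [hs, ← map_nsmul]
  exact (hI.sup (PInv.pm φ p a)).aeval s _ h3

theorem nat_ivt (P : ℕ → Prop) (n : ℕ) (h0 : ¬ P 0) (hn : P n) : ∃ i < n, ¬ P i ∧ P (i + 1) := by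
  induction n with
  | zero => exact absurd hn h0
  | succ n ih =>
    by_cases h : P n
    · obtain ⟨i, hi, r⟩ := ih h
      exact ⟨i, by omega, r⟩
    · exact ⟨n, by omega, h, hn⟩

def beta (κ T' : ℕ) : ℕ → ℕ
  | 0 => 1
  | i + 1 => κ ^ 2 * beta κ T' i + T'

theorem beta_mono {κ T' : ℕ} (hκ : 0 < κ) : Monotone (beta κ T') := monotone_nat_of_le_succ (fun n => by
  rw [beta]
  have : 0 < κ ^ 2 := by positivity
  nlinarith [Nat.zero_le (beta κ T' n), Nat.zero_le T'])

theorem flag_step (hp : p.Prime) (hκ : 0 < κ) (hφ : Cyc p κ φ) (hsurj : Function.Surjective φ)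
    (br : A →+ A →+ A) (hbr : ∀ x y, φ (br x y) = br (φ x) (φ y))
    {B : ℕ} {Z : AddSubgroup A} (hZ : Pur p B φ Z) (hI : PInv φ Z)
    (hne : Z ⊔ (φ - 1 : AddMonoid.End A).range ≠ ⊤)
    (H : ℕ → AddSubgroup A) (hH0 : H 0 = ⊤) (hHI : ∀ i, PInv φ (H i))
    (hH : ∀ i, ∀ x ∈ H i, ∀ y, br x y ∈ H (i + 1)) (h T' T0 : ℕ) (hHh : H h ≤ pm A p T0)
    (hT0 : κ ^ 2 * beta κ T' h + T' ≤ T0) (hT0B : T0 ≤ B)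
    (hZA : ∀ x ∈ Z, ∀ y, br x y ∈ Z ⊔ pm A p T0) :
    ∃ Z', Z ≤ Z' ∧ PInv φ Z' ∧ Pur p B φ Z' ∧ Z ⊔ (φ - 1 : AddMonoid.End A).range < Z' ⊔ (φ - 1 : AddMonoid.End A).range ∧
      ∀ x ∈ Z', ∀ y, br x y ∈ Z ⊔ pm A p T' := by
  have hκ2 : 0 < κ ^ 2 := by positivity
  have hpr : pm A p 1 ≤ (φ - 1 : AddMonoid.End A).range := by
    rintro _ ⟨y, rfl⟩
    obtain ⟨r, hr⟩ := hφ.h1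
    refine ⟨aeval φ r y, ?_⟩
    have := congrArg (fun f : AddMonoid.End A => f y) hr
    rw [nsmulAddMonoidHom_apply, pow_one]
    exact this.symm
  obtain ⟨i, hih, hi1, hi2⟩ := nat_ivt (fun i => H i ≤ Z ⊔ pm A p (beta κ T' i)) h
    (by
      intro h0
      rw [hH0, beta] at h0
      apply hne
      rw [eq_top_iff]
      exact h0.trans (sup_le_sup_left hpr _))
    (hHh.trans ((pm_anti (by nlinarith)).trans le_sup_right))
  obtain ⟨x, hxH, hx⟩ := SetLike.not_le_iff_exists.1 hi1
  obtain ⟨a, ha, ha1, ha2⟩ := nat_ivt (fun a => x ∉ Z ⊔ ((φ - 1 : AddMonoid.End A) ^ a).range) (κ * beta κ T' i)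
    (by
      simp only [pow_zero, not_not]
      refine AddSubgroup.mem_sup_right ⟨x, rfl⟩)
    (by
      intro h1
      apply hx
      refine sup_le_sup_left ?_ Z h1
      rintro _ ⟨y, rfl⟩
      obtain ⟨s, hs⟩ := hφ.D1 (beta κ T' i)
      exact ⟨_, (hs y).symm⟩)
  rw [not_not] at ha1
  obtain ⟨z, hz, w, ⟨y, rfl⟩, hxe⟩ := AddSubgroup.mem_sup.1 ha1
  change z + ((φ - 1) ^ a) y = x at hxe
  have hZpi : ∀ n, ∀ z ∈ Z, ((φ - 1 : AddMonoid.End A) ^ n) z ∈ Z := by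
    intro n z hz
    rw [pi_eq, ← map_pow]
    exact hI.aeval _ z hz
  have hy : y ∉ Z ⊔ (φ - 1 : AddMonoid.End A).range := by
    intro hy
    obtain ⟨z', hz', _, ⟨w, rfl⟩, rfl⟩ := AddSubgroup.mem_sup.1 hy
    apply ha2
    rw [← hxe, map_add, ← add_assoc]
    refine AddSubgroup.add_mem_sup (Z.add_mem hz (hZpi a z' hz')) ⟨w, ?_⟩
    rw [pow_succ]; rfl
  let O : AddSubgroup A :=
    { carrier := {u | ∃ f : ℤ[X], u = aeval φ f y}
      zero_mem' := ⟨0, by rw [map_zero]; rfl⟩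
      add_mem' := by
        rintro _ _ ⟨f, rfl⟩ ⟨g, rfl⟩
        exact ⟨f + g, by rw [map_add]; rfl⟩
      neg_mem' := by
        rintro _ ⟨f, rfl⟩
        exact ⟨-f, by rw [map_neg]; rfl⟩ }
  have hyO : y ∈ O := ⟨1, by simp⟩
  have hOI : PInv φ O := by
    rintro _ ⟨f, rfl⟩
    exact ⟨X * f, by rw [map_mul, aeval_X]; rfl⟩
  have hWI : PInv φ (Z ⊔ pm A p T') := hI.sup (PInv.pm φ p T')
  have hyv : ∀ v, br y v ∈ Z ⊔ pm A p T' := by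
    intro v
    obtain ⟨r, hr⟩ := hφ.D2 a
    have h1 : p ^ a • br y v ∈ Z ⊔ pm A p (κ ^ 2 * beta κ T' i + T') := by
      have e : p ^ a • br y v = br (aeval φ r x) v - br (aeval φ r z) v := by
        rw [← AddMonoidHom.sub_apply, ← map_sub, ← map_sub, ← hxe, add_sub_cancel_left, ← hr]
        simp
      rw [e]
      refine AddSubgroup.sub_mem _ ?_ ?_
      · exact hi2 (hH i _ ((hHI i).aeval r x hxH) v)
      · refine sup_le_sup_left (pm_anti ?_) Z (hZA _ (hI.aeval r z hz) v)
        have := beta_mono (T' := T') hκ hih.le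
        nlinarith
    have hle : κ * a ≤ κ ^ 2 * beta κ T' i := by rw [pow_two, mul_assoc]; exact Nat.mul_le_mul_left _ ha.le
    have h2 := D4 hφ hZ hI a _ _ (by omega) (by
      have := beta_mono (T' := T') hκ hih.le
      have := Nat.mul_le_mul_left (κ ^ 2) this
      omega) h1
    exact sup_le_sup_left (pm_anti (by omega)) Z h2
  have hOv : ∀ f : ℤ[X], ∀ v, br (aeval φ f y) v ∈ Z ⊔ pm A p T' := by
    intro f
    induction f using Polynomial.induction_on' with
    | add f g hf hg =>
      intro v
      have : br (aeval φ (f + g) y) v = br (aeval φ f y) v + br (aeval φ g y) v := by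
        rw [map_add, E_add, map_add]; rfl
      rw [this]; exact AddSubgroup.add_mem _ (hf v) (hg v)
    | monomial n c =>
      intro v
      have e : aeval φ (monomial n c : ℤ[X]) y = c • (φ ^ n) y := by simp [aeval_monomial]
      rw [e, map_zsmul]
      refine AddSubgroup.zsmul_mem _ ?_ c
      clear e
      induction n generalizing v with
      | zero => simpa using hyv v
      | succ n ih =>
        obtain ⟨v', rfl⟩ := hsurj v
        rw [pow_succ', E_mul, ← hbr]
        exact hWI _ (ih v')
  refine ⟨Z ⊔ O, le_sup_left, hI.sup hOI, ?_, ?_, ?_⟩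
  · intro c hc1 hcB v hv
    obtain ⟨zo, hzo, _, ⟨u, rfl⟩, e⟩ := AddSubgroup.mem_sup.1 hv
    obtain ⟨z1, hz1, _, ⟨f, rfl⟩, rfl⟩ := AddSubgroup.mem_sup.1 hzo
    obtain ⟨g, hg⟩ := X_sub_C_dvd_sub_C_eval (a := (1 : ℤ)) (p := f)
    obtain ⟨r, hr⟩ := hφ.h1
    have hr' : ∀ u, p • u = (φ - 1) (aeval φ r u) := by
      intro u
      have := congrArg (fun f : AddMonoid.End A => f u) hr
      simpa using this
    have hfy : aeval φ f y = f.eval 1 • y + (φ - 1) (aeval φ g y) := by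
      have h1 : f = C (f.eval 1) + (X - C 1) * g := by rw [← hg]; ring
      have h2 := congrArg (fun f => aeval φ f y) h1
      simp only [map_add, map_mul, map_sub, aeval_X, aeval_C, map_one] at h2
      exact h2
    have hpf : (p : ℤ) ∣ f.eval 1 := by
      by_contra hnd
      have hcop : IsCoprime (f.eval 1) (p : ℤ) := by
        rw [isCoprime_comm]
        exact (Nat.prime_iff_prime_int.1 hp).coprime_iff_not_dvd.2 hnd
      obtain ⟨α, β, hαβ⟩ := hcop
      apply hy
      have h3 : f.eval 1 • y ∈ Z ⊔ (φ - 1 : AddMonoid.End A).range := by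
        have : f.eval 1 • y = -z1 + ((φ - 1) v - (φ - 1) (aeval φ g y) - p ^ c • u) := by
          have e' : z1 + aeval φ f y + p ^ c • u = (φ - 1) v := e
          rw [← e', hfy]; abel
        rw [this]
        refine AddSubgroup.add_mem_sup (Z.neg_mem hz1) ?_
        refine AddSubgroup.sub_mem _ (AddSubgroup.sub_mem _ ⟨v, rfl⟩ ⟨_, rfl⟩) ?_
        exact hpr (pm_anti hc1 ⟨u, rfl⟩)
      have h4 : (p : ℤ) • y ∈ Z ⊔ (φ - 1 : AddMonoid.End A).range := by
        refine AddSubgroup.mem_sup_right ⟨aeval φ r y, ?_⟩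
        rw [natCast_zsmul]; exact (hr' y).symm
      have : y = α • (f.eval 1 • y) + β • ((p : ℤ) • y) := by
        rw [← mul_smul, ← mul_smul, ← add_smul, hαβ, one_smul]
      rw [this]
      exact AddSubgroup.add_mem _ (AddSubgroup.zsmul_mem _ h3 _) (AddSubgroup.zsmul_mem _ h4 _)
    obtain ⟨d, hd⟩ := hpf
    have hfy2 : aeval φ f y = (φ - 1) (aeval φ (C d * r + g) y) := by
      rw [hfy, hd, mul_comm, mul_smul, natCast_zsmul, hr']
      rw [map_add, map_mul, aeval_C, E_add, map_add]
      congr 1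
      rw [E_mul, ← map_zsmul]
      rfl
    have h5 : v - aeval φ (C d * r + g) y ∈ Z ⊔ pm A p (c - 1) := by
      apply hZ c hc1 hcB
      have e' : z1 + aeval φ f y + p ^ c • u = (φ - 1) v := e
      have : (φ - 1) (v - aeval φ (C d * r + g) y) = z1 + p ^ c • u := by
        rw [map_sub, ← hfy2, ← e']; abel
      rw [this]
      exact AddSubgroup.add_mem_sup hz1 ⟨u, rfl⟩
    have h6 : v = (v - aeval φ (C d * r + g) y) + aeval φ (C d * r + g) y := by abel
    rw [h6]
    have h7 : Z ⊔ pm A p (c - 1) ≤ Z ⊔ O ⊔ pm A p (c - 1) := sup_le_sup_right le_sup_left _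
    refine AddSubgroup.add_mem _ (h7 h5) ?_
    exact AddSubgroup.mem_sup_left (AddSubgroup.mem_sup_right ⟨_, rfl⟩)
  · refine lt_of_le_of_ne (sup_le_sup_right le_sup_left _) ?_
    intro h1
    apply hy
    rw [h1]
    exact AddSubgroup.mem_sup_left (AddSubgroup.mem_sup_right hyO)
  · intro u hu v
    obtain ⟨z1, hz1, _, ⟨f, rfl⟩, rfl⟩ := AddSubgroup.mem_sup.1 hu
    rw [map_add, AddMonoidHom.add_apply]
    refine AddSubgroup.add_mem _ ?_ (hOv f v)
    refine sup_le_sup_left (pm_anti ?_) Z (hZA z1 hz1 v)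
    omega

def bF (κ h T : ℕ) : ℕ → ℕ
  | 0 => T
  | d + 1 => κ ^ 2 * beta κ (bF κ h T d) h + bF κ h T d

theorem bF_mono (κ h T : ℕ) : Monotone (bF κ h T) := monotone_nat_of_le_succ fun n => by
  rw [bF]; omega

theorem sup_pi_top (hφ : Cyc p κ φ) {Z : AddSubgroup A} (hI : PInv φ Z)
    (h : Z ⊔ (φ - 1 : AddMonoid.End A).range = ⊤) (T : ℕ) : Z ⊔ pm A p T = ⊤ := by
  have key : ∀ n, Z ⊔ ((φ - 1 : AddMonoid.End A) ^ n).range = ⊤ := by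
    intro n
    induction n with
    | zero => rw [eq_top_iff]; exact fun x _ => AddSubgroup.mem_sup_right ⟨x, rfl⟩
    | succ n ih =>
      rw [eq_top_iff]
      intro x _
      have hx : x ∈ Z ⊔ ((φ - 1 : AddMonoid.End A) ^ n).range := by rw [ih]; trivial
      obtain ⟨z, hz, _, ⟨w, rfl⟩, rfl⟩ := AddSubgroup.mem_sup.1 hx
      have hw : w ∈ Z ⊔ (φ - 1 : AddMonoid.End A).range := by rw [h]; trivial
      obtain ⟨z', hz', _, ⟨w', rfl⟩, rfl⟩ := AddSubgroup.mem_sup.1 hw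
      change z + ((φ - 1 : AddMonoid.End A) ^ n) (z' + (φ - 1 : AddMonoid.End A) w') ∈ _
      rw [map_add, ← add_assoc]
      refine AddSubgroup.add_mem_sup (Z.add_mem hz ?_) ⟨w', by rw [pow_succ]; rfl⟩
      have := hI.aeval ((X - 1) ^ n) z' hz'
      rwa [map_pow, ← pi_eq] at this
  rw [eq_top_iff, ← key (κ * T)]
  refine sup_le_sup_left ?_ Z
  rintro _ ⟨y, rfl⟩
  obtain ⟨s, hs⟩ := hφ.D1 T
  exact ⟨_, (hs y).symm⟩

theorem flag_main (hp : p.Prime) (hκ : 0 < κ) (hφ : Cyc p κ φ) (hsurj : Function.Surjective φ) {e : ℕ}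
    (hcard : Nat.card A = p ^ e)
    (br : A →+ A →+ A) (hbr : ∀ x y, φ (br x y) = br (φ x) (φ y))
    (H : ℕ → AddSubgroup A) (hH0 : H 0 = ⊤) (hHI : ∀ i, PInv φ (H i))
    (hH : ∀ i, ∀ x ∈ H i, ∀ y, br x y ∈ H (i + 1)) (h T B : ℕ) (d : ℕ) :
    bF κ h T d ≤ B → H h ≤ pm A p (bF κ h T d) → ∀ Z : AddSubgroup A, Pur p B φ Z → PInv φ Z →
    (∀ x ∈ Z, ∀ y, br x y ∈ Z ⊔ pm A p (bF κ h T d)) →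
    (Z ⊔ (φ - 1 : AddMonoid.End A).range).index ≤ p ^ d →
    ∃ Y : ℕ → AddSubgroup A, Y 0 = Z ∧ Monotone Y ∧ (∀ j, PInv φ (Y j)) ∧
      (∀ j, ∀ x ∈ Y (j + 1), ∀ y, br x y ∈ Y j ⊔ pm A p T) ∧ Y d ⊔ pm A p T = ⊤ := by
  have hfin : Finite A := Nat.finite_of_card_ne_zero (by rw [hcard]; exact (pow_pos hp.pos e).ne')
  have triv : ∀ d, ∀ Z : AddSubgroup A, PInv φ Z → (∀ x ∈ Z, ∀ y, br x y ∈ Z ⊔ pm A p (bF κ h T d)) →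
      Z ⊔ (φ - 1 : AddMonoid.End A).range = ⊤ → ∃ Y : ℕ → AddSubgroup A, Y 0 = Z ∧ Monotone Y ∧ (∀ j, PInv φ (Y j)) ∧
      (∀ j, ∀ x ∈ Y (j + 1), ∀ y, br x y ∈ Y j ⊔ pm A p T) ∧ Y d ⊔ pm A p T = ⊤ := by
    intro d Z hI hZ ht
    exact ⟨fun _ => Z, rfl, monotone_const, fun _ => hI, fun _ x hx y =>
      sup_le_sup_left (pm_anti (bF_mono κ h T (Nat.zero_le d))) Z (hZ x hx y), sup_pi_top hφ hI ht T⟩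
  induction d with
  | zero =>
    intro hB hHh Z hP hI hZ hidx
    apply triv 0 Z hI hZ
    rw [pow_zero] at hidx
    rw [← AddSubgroup.index_eq_one]
    have : (Z ⊔ (φ - 1 : AddMonoid.End A).range).index ≠ 0 := AddSubgroup.FiniteIndex.index_ne_zero
    omega
  | succ d ih =>
    intro hB hHh Z hP hI hZ hidx
    by_cases ht : Z ⊔ (φ - 1 : AddMonoid.End A).range = ⊤
    · exact triv (d + 1) Z hI hZ ht
    obtain ⟨Z', hZZ', hI', hP', hlt, hZ'⟩ := flag_step hp hκ hφ hsurj br hbr hP hI ht H hH0 hHI hH h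
      (bF κ h T d) (bF κ h T (d + 1)) hHh le_rfl hB hZ
    have hidx' : (Z' ⊔ (φ - 1 : AddMonoid.End A).range).index ≤ p ^ d := by
      have h1 := AddSubgroup.relIndex_mul_index hlt.le
      set K := Z ⊔ (φ - 1 : AddMonoid.End A).range
      set K' := Z' ⊔ (φ - 1 : AddMonoid.End A).range
      have h2 : K.relIndex K' ∣ p ^ e := by
        rw [← hcard]
        exact (Dvd.intro _ h1).trans K.index_dvd_card
      obtain ⟨j, _, hj⟩ := (Nat.dvd_prime_pow hp).1 h2
      have h3 : j ≠ 0 := by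
        rintro rfl
        rw [pow_zero, AddSubgroup.relIndex_eq_one] at hj
        exact absurd hj (not_le_of_gt hlt)
      have h4 : p ≤ K.relIndex K' := by rw [hj]; exact Nat.le_self_pow h3 p
      have h5 : p * K'.index ≤ p * p ^ d := by
        calc p * K'.index ≤ K.relIndex K' * K'.index := Nat.mul_le_mul_right _ h4
          _ = K.index := h1
          _ ≤ p ^ (d + 1) := hidx
          _ = p * p ^ d := by ring
      exact Nat.le_of_mul_le_mul_left h5 hp.pos
    have hmono := bF_mono κ h T (Nat.le_succ d)
    obtain ⟨Y, hY0, hYm, hYI, hYb, hYt⟩ := ih (hmono.trans hB) (hHh.trans (pm_anti hmono)) Z' hP' hI'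
      (fun x hx y => (sup_le_sup_right hZZ' (pm A p (bF κ h T d)) : Z ⊔ _ ≤ Z' ⊔ _) (hZ' x hx y)) hidx'
    have e0 : ∃ Y' : ℕ → AddSubgroup A, Y' 0 = Z ∧ ∀ j, Y' (j + 1) = Y j :=
      ⟨fun j => match j with
        | 0 => Z
        | j + 1 => Y j, rfl, fun _ => rfl⟩
    obtain ⟨Y', h0, h1⟩ := e0
    refine ⟨Y', h0, ?_, ?_, ?_, ?_⟩
    · refine monotone_nat_of_le_succ fun n => ?_
      rcases n with _ | n
      · rw [h0, h1, hY0]; exact hZZ'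
      · rw [h1, h1]; exact hYm (Nat.le_succ n)
    · intro j
      rcases j with _ | j
      · rw [h0]; exact hI
      · rw [h1]; exact hYI j
    · intro j x hx y
      rcases j with _ | j
      · rw [h1, hY0] at hx
        rw [h0]
        exact sup_le_sup_left (pm_anti (bF_mono κ h T (Nat.zero_le d))) Z (hZ' x hx y)
      · rw [h1] at hx ⊢
        exact hYb j x hx y
    · rw [h1]; exact hYt

end flag


section lat
open Polynomial

theorem mkBr {A A' : Type*} [AddCommGroup A] [AddCommGroup A'] (R : A → A → A' → Prop)
    (ex : ∀ x y, ∃ z, R x y z) (un : ∀ x y z z', R x y z → R x y z' → z = z')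
    (al : ∀ x x' y z z', R x y z → R x' y z' → R (x + x') y (z + z'))
    (ar : ∀ x y y' z z', R x y z → R x y' z' → R x (y + y') (z + z')) :
    ∃ br : A →+ A →+ A', ∀ x y, R x y (br x y) := by
  choose b hb using ex
  refine ⟨AddMonoidHom.mk' (fun x => AddMonoidHom.mk' (fun y => b x y) ?_) ?_, ?_⟩
  · intro y y'
    exact un _ _ _ _ (hb _ _) (ar _ _ _ _ _ (hb _ _) (hb _ _))
  · intro x x'
    ext y
    exact un _ _ _ _ (hb _ _) (al _ _ _ _ _ (hb _ _) (hb _ _))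
  · intro x y
    exact hb x y

theorem liftBr {A A' : Type*} [AddCommGroup A] [AddCommGroup A'] (K : AddSubgroup A) (f : A →+ A →+ A')
    (hl : ∀ x ∈ K, ∀ y, f x y = 0) (hr : ∀ x, ∀ y ∈ K, f x y = 0) :
    ∃ br : A ⧸ K →+ A ⧸ K →+ A', ∀ x y : A, br (x : A ⧸ K) (y : A ⧸ K) = f x y := by
  obtain ⟨br, h⟩ := mkBr (A := A ⧸ K) (A' := A') (fun X Y Z => ∃ x y : A, X = x ∧ Y = y ∧ Z = f x y)
    (by
      intro X Y
      obtain ⟨x, rfl⟩ := QuotientAddGroup.mk_surjective X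
      obtain ⟨y, rfl⟩ := QuotientAddGroup.mk_surjective Y
      exact ⟨_, x, y, rfl, rfl, rfl⟩)
    (by
      rintro _ _ _ _ ⟨x, y, rfl, rfl, rfl⟩ ⟨x', y', hx, hy, rfl⟩
      have h1 := hl _ (QuotientAddGroup.eq.1 hx) y
      have h2 := hr x' _ (QuotientAddGroup.eq.1 hy)
      rw [map_add, map_neg, AddMonoidHom.add_apply, AddMonoidHom.neg_apply, neg_add_eq_zero] at h1
      rw [map_add, map_neg, neg_add_eq_zero] at h2
      rw [h1, h2])
    (by
      rintro _ _ _ _ _ ⟨x, y, rfl, rfl, rfl⟩ ⟨x', y', rfl, hy, rfl⟩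
      refine ⟨x + x', y, rfl, rfl, ?_⟩
      have h2 := hr x' _ (QuotientAddGroup.eq.1 hy)
      rw [map_add, map_neg, neg_add_eq_zero] at h2
      rw [map_add, AddMonoidHom.add_apply, h2])
    (by
      rintro _ _ _ _ _ ⟨x, y, rfl, rfl, rfl⟩ ⟨x', y', hx, rfl, rfl⟩
      refine ⟨x, y + y', rfl, rfl, ?_⟩
      have h1 := hl _ (QuotientAddGroup.eq.1 hx) y'
      rw [map_add, map_neg, AddMonoidHom.add_apply, AddMonoidHom.neg_apply, neg_add_eq_zero] at h1
      rw [map_add, h1])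
  refine ⟨br, fun x y => ?_⟩
  obtain ⟨x', y', hx, hy, e⟩ := h x y
  rw [e]
  have h1 := hl _ (QuotientAddGroup.eq.1 hx) y
  have h2 := hr x' _ (QuotientAddGroup.eq.1 hy)
  rw [map_add, map_neg, AddMonoidHom.add_apply, AddMonoidHom.neg_apply, neg_add_eq_zero] at h1
  rw [map_add, map_neg, neg_add_eq_zero] at h2
  rw [h1, h2]

structure Dat (p q m M : ℕ) {A : Type*} [AddCommGroup A] (br : A →+ A →+ A) (φ : AddMonoid.End A) : Prop where
  alt : ∀ x, br x x = 0
  jac : ∀ a b c, br (br a b) c = br (br a c) b + br a (br b c)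
  comp : ∀ x y, φ (br x y) = br (φ x) (φ y)
  N : ∀ x, ∑ i ∈ Finset.range p, (φ ^ (q * i)) x = 0
  exp : ∀ x : A, p ^ M • x = 0
  homo : ∀ a ≤ M, ∀ x : A, p ^ a • x = 0 → ∃ y, x = p ^ (M - a) • y
  fix : Nat.card {x : A // φ x = x} ≤ p ^ m

variable {p q m M : ℕ} {A : Type*} [AddCommGroup A] {br : A →+ A →+ A} {φ : AddMonoid.End A}

theorem Dat.anti (h : Dat p q m M br φ) (x y : A) : br x y = - br y x := by
  have := h.alt (x + y)
  simp only [map_add, AddMonoidHom.add_apply, h.alt] at this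
  rw [eq_neg_iff_add_eq_zero]
  simpa [add_comm] using this

theorem N_pow (hN : ∀ x : A, ∑ i ∈ Finset.range p, (φ ^ (q * i)) x = 0) : φ ^ (p * q) = 1 := by
  have h0 : ∑ i ∈ Finset.range p, (φ ^ q) ^ i = 0 := by
    ext x
    rw [← Finset.sum_congr rfl (fun i _ => pow_mul φ q i)]
    have := hN x
    rw [E_zero, ← this]
    exact AddMonoidHom.finsetSum_apply _ _ _
  have := (Commute.one_right (φ ^ q)).geom_sum₂_mul p
  simp only [one_pow, mul_one, h0, zero_mul] at this
  rw [mul_comm, pow_mul]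
  exact (sub_eq_zero.1 this.symm)

theorem N_poly (hN : ∀ x : A, ∑ i ∈ Finset.range p, (φ ^ (q * i)) x = 0) :
    aeval φ (∑ i ∈ Finset.range p, X ^ (q * i) : ℤ[X]) = 0 := by
  ext x
  rw [map_sum]
  simp only [map_pow, aeval_X]
  rw [E_zero, ← hN x]
  exact AddMonoidHom.finsetSum_apply _ _ _

theorem N_cyc (hp : p.Prime) (j : ℕ) (hN : ∀ x : A, ∑ i ∈ Finset.range p, (φ ^ (p ^ j * i)) x = 0) :
    Cyc p (p * p ^ j) φ := by
  constructor
  · obtain ⟨g, hg⟩ := X_sub_C_dvd_sub_C_eval (a := (1 : ℤ)) (p := (∑ i ∈ Finset.range p, X ^ (p ^ j * i) : ℤ[X]))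
    have h1 := congrArg (aeval φ) hg
    rw [map_sub, N_poly hN] at h1
    simp only [eval_finset_sum, eval_pow, eval_X, one_pow, Finset.sum_const, Finset.card_range, nsmul_eq_mul,
      mul_one, map_mul, map_sub, aeval_X, aeval_C, map_one, zero_sub, map_natCast] at h1
    refine ⟨-g, ?_⟩
    rw [map_neg, mul_neg, ← h1, neg_neg]
  · have := exists_add_pow_prime_pow_eq hp (X - 1 : ℤ[X]) 1 (j + 1)
    obtain ⟨r, hr⟩ := this
    have h1 := congrArg (aeval φ) hr
    simp only [sub_add_cancel, map_add, map_sub, map_pow, aeval_X, map_one, one_pow, map_mul, map_natCast] at h1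
    rw [pow_succ', N_pow hN] at h1
    refine ⟨-((X - 1) * r), ?_⟩
    rw [map_neg, mul_neg, map_mul, ← pi_eq]
    rw [mul_one, mul_assoc] at h1
    rw [add_right_comm, right_eq_add] at h1
    exact eq_neg_of_add_eq_zero_left h1

theorem higman_br (hp : p.Prime) (alt : ∀ x, br x x = 0)
    (jac : ∀ a b c, br (br a b) c = br (br a c) b + br a (br b c))
    (comp : ∀ x y, φ (br x y) = br (φ x) (φ y))
    (hN : ∀ x : A, ∑ i ∈ Finset.range p, (φ ^ (q * i)) x = 0) :
    ∃ H : ℕ → AddSubgroup A, H 0 = ⊤ ∧ (∀ i, ∀ x ∈ H i, ∀ y, br x y ∈ H (i + 1)) ∧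
      (∀ i, PInv φ (H i)) ∧ ∀ x ∈ H (higB p), p ^ (2 * higB p + 1) • x = 0 := by
  have anti : ∀ x y, br x y = - br y x := by
    intro x y
    have := alt (x + y)
    simp only [map_add, AddMonoidHom.add_apply, alt] at this
    rw [eq_neg_iff_add_eq_zero]
    simpa [add_comm] using this
  let inst : LieRing A :=
    { bracket := fun x y => br x y
      add_lie := fun x y z => by change br (x + y) z = br x z + br y z; simp
      lie_add := fun x y z => by change br x (y + z) = br x y + br x z; simp
      lie_self := alt
      leibniz_lie := fun x y z => by
        change br x (br y z) = br (br x y) z + br y (br x z)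
        rw [jac x y z, anti y (br x z)]; abel }
  have hbr : ∀ x y : A, ⁅x, y⁆ = br x y := fun _ _ => rfl
  have hcp : ∀ n, ∀ x y, (φ ^ n) (br x y) = br ((φ ^ n) x) ((φ ^ n) y) := by
    intro n
    induction n with
    | zero => intro x y; rfl
    | succ n ih => intro x y; rw [pow_succ, E_mul, E_mul, E_mul, comp, ih]
  have hit : ∀ i x, ((φ ^ q : AddMonoid.End A) : A → A)^[i] x = (φ ^ (q * i)) x := by
    intro i x
    rw [pow_mul]
    exact (congrFun (AddMonoid.End.coe_pow A (φ ^ q) i) x).symm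
  refine ⟨lc A, rfl, ?_, ?_, ?_⟩
  · intro i x hx y
    exact AddSubgroup.subset_closure ⟨x, hx, y, rfl⟩
  · intro i
    induction i with
    | zero => intro x _; trivial
    | succ i ih =>
      intro x hx
      have : lc A (i + 1) ≤ (lc A (i + 1)).comap φ := by
        rw [lc, AddSubgroup.closure_le]
        rintro _ ⟨x, hx, y, rfl⟩
        change φ (br x y) ∈ AddSubgroup.closure _
        exact AddSubgroup.subset_closure ⟨φ x, ih x hx, φ y, comp x y⟩
      exact this hx
  · refine higman_lie hp A (φ ^ q) (hcp q) ?_ ?_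
    · intro x
      refine (hit p x).trans ?_
      rw [mul_comm, N_pow hN]; rfl
    · intro x
      rw [← hN x]
      exact Finset.sum_congr rfl fun i _ => hit i x

theorem card_of_exp (hp : p.Prime) [Finite A] {M : ℕ} (h : ∀ x : A, p ^ M • x = 0) : ∃ e, Nat.card A = p ^ e := by
  haveI := Fact.mk hp
  have : IsPGroup p (Multiplicative A) := fun x => ⟨M, by
    have := h x.toAdd
    exact congrArg Multiplicative.ofAdd this⟩
  obtain ⟨n, hn⟩ := IsPGroup.iff_card.1 this
  exact ⟨n, by rw [← hn]; rfl⟩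

theorem index_range_eq (f : A →+ A) [Finite A] : f.range.index = Nat.card f.ker := by
  have h1 : Nat.card f.ker * Nat.card f.range = Nat.card A := by
    rw [← AddSubgroup.index_ker]; exact f.ker.card_mul_index
  have h2 := f.range.card_mul_index
  have : 0 < Nat.card f.range := Nat.card_pos
  rw [← h1, mul_comm] at h2
  exact Nat.eq_of_mul_eq_mul_right this h2

theorem card_fix (φ : AddMonoid.End A) : Nat.card (AddMonoidHom.ker (φ - 1)) = Nat.card {x : A // φ x = x} := by
  apply Nat.card_congr
  exact Equiv.subtypeEquivRight fun x => by
    rw [AddMonoidHom.mem_ker]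
    change φ x - x = 0 ↔ _
    rw [sub_eq_zero]

theorem card_fix_quot [Finite A] {A' : Type*} [AddCommGroup A'] (φ : AddMonoid.End A) (φ' : AddMonoid.End A')
    (f : A →+ A') (hf : Function.Surjective f) (h : ∀ x, φ' (f x) = f (φ x)) :
    Nat.card {x : A' // φ' x = x} ≤ Nat.card {x : A // φ x = x} := by
  haveI : Finite A' := Finite.of_surjective f hf
  rw [← card_fix, ← card_fix, ← index_range_eq, ← index_range_eq]
  have e : AddMonoidHom.range (φ' - 1) = (AddMonoidHom.range (φ - 1)).map f := by
    ext y
    constructor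
    · rintro ⟨x, rfl⟩
      obtain ⟨x, rfl⟩ := hf x
      refine ⟨(φ - 1) x, ⟨x, rfl⟩, ?_⟩
      change f (φ x - x) = φ' (f x) - f x
      rw [h, map_sub]
    · rintro ⟨_, ⟨x, rfl⟩, rfl⟩
      refine ⟨f x, ?_⟩
      change φ' (f x) - f x = f (φ x - x)
      rw [h, map_sub]
  rw [e]
  exact Nat.le_of_dvd (Nat.pos_of_ne_zero AddSubgroup.FiniteIndex.index_ne_zero) (AddSubgroup.index_map_dvd _ hf)

def latB (p q m : ℕ) : ℕ := bF (p * q) (higB p) (2 * 2 ^ m + 1) m + (2 * higB p + 1)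

theorem le_latB : 2 * 2 ^ m + 1 ≤ latB p q m := by
  have := bF_mono (p * q) (higB p) (2 * 2 ^ m + 1) (Nat.zero_le m)
  rw [bF] at this
  rw [latB]; omega

theorem Dat.flag [Finite A] (hp : p.Prime) {j : ℕ} (h : Dat p (p ^ j) m (latB p (p ^ j) m) br φ) :
    ∃ F : ℕ → AddSubgroup A, F 0 = ⊤ ∧ F m = pm A p (2 * 2 ^ m + 1) ∧ Antitone F ∧ (∀ i, PInv φ (F i)) ∧
      ∀ i < m, ∀ x ∈ F i, ∀ y, br x y ∈ F (i + 1) := by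
  obtain ⟨H, hH0, hH, hHI, hHh⟩ := higman_br hp h.alt h.jac h.comp h.N
  obtain ⟨e, he⟩ := card_of_exp hp h.exp
  set κ := p * p ^ j with hκ
  set T := 2 * 2 ^ m + 1 with hT
  have hcyc : Cyc p κ φ := N_cyc hp j h.N
  have hsurj : Function.Surjective φ := by
    intro x
    have hκ0 : κ = κ - 1 + 1 := by
      have : 0 < κ := Nat.mul_pos hp.pos (pow_pos hp.pos j)
      omega
    refine ⟨(φ ^ (κ - 1)) x, ?_⟩
    rw [← E_mul, ← pow_succ', ← hκ0, N_pow h.N]; rfl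
  have hB : latB p (p ^ j) m = bF κ (higB p) T m + (2 * higB p + 1) := rfl
  have hB1 : bF κ (higB p) T m ≤ latB p (p ^ j) m := by rw [hB]; exact Nat.le_add_right _ _
  have hB2 : 2 * higB p + 1 ≤ latB p (p ^ j) m := by rw [hB]; exact Nat.le_add_left _ _
  have hB3 : bF κ (higB p) T m ≤ latB p (p ^ j) m - (2 * higB p + 1) := by rw [hB, Nat.add_sub_cancel]
  obtain ⟨Y, hY0, hYm, hYI, hYb, hYt⟩ := flag_main hp (Nat.mul_pos hp.pos (pow_pos hp.pos j)) hcyc hsurj he br h.comp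
    H hH0 hHI hH (higB p) T (latB p (p ^ j) m) m hB1
    (by
      intro x hx
      obtain ⟨y, hy⟩ := h.homo _ hB2 x (hHh x hx)
      rw [hy]
      exact pm_anti hB3 ⟨y, rfl⟩)
    ⊥
    (by
      intro a ha1 haB v hv
      rw [bot_sup_eq] at hv ⊢
      obtain ⟨r, hr⟩ := hcyc.h1
      have h1 : p • v ∈ pm A p a := by
        have : p • v = aeval φ r ((φ - 1) v) := by
          rw [← E_mul, pi_eq, aeval_comm, ← pi_eq, ← hr]; rfl
        rw [this]
        exact (PInv.pm φ p a).aeval r _ hv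
      obtain ⟨w, hw⟩ := h1
      have h2 : p ^ 1 • (v - p ^ (a - 1) • w) = 0 := by
        rw [pow_one, smul_sub, ← mul_smul, ← pow_succ', Nat.sub_add_cancel ha1]
        exact sub_eq_zero.2 hw.symm
      obtain ⟨y, hy⟩ := h.homo 1 (by omega) _ h2
      have h3 : v = p ^ (latB p (p ^ j) m - 1) • y + p ^ (a - 1) • w := by rw [← hy]; abel
      rw [h3]
      exact AddSubgroup.add_mem _ (pm_anti (by omega) ⟨y, rfl⟩) ⟨w, rfl⟩)
    (by
      intro x hx
      rw [AddSubgroup.mem_bot] at hx ⊢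
      rw [hx, map_zero])
    (by
      intro x hx y
      rw [AddSubgroup.mem_bot] at hx
      rw [hx, map_zero]; exact AddSubgroup.zero_mem _)
    (by
      have := index_range_eq (A := A) (φ - 1 : AddMonoid.End A)
      rw [bot_sup_eq]
      exact this.le.trans ((card_fix φ).le.trans h.fix))
  refine ⟨fun i => Y (m - i) ⊔ pm A p T, ?_, ?_, ?_, ?_, ?_⟩
  · simpa using hYt
  · simp [hY0]
  · intro a b hab
    exact sup_le_sup_right (hYm (by omega)) _
  · intro i
    exact (hYI _).sup (PInv.pm φ p T)
  · intro i hi x hx y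
    obtain ⟨u, hu, _, ⟨v, rfl⟩, rfl⟩ := AddSubgroup.mem_sup.1 hx
    rw [show m - i = m - (i + 1) + 1 by omega] at hu
    rw [map_add, AddMonoidHom.add_apply]
    refine AddSubgroup.add_mem _ (hYb _ u hu y) (AddSubgroup.mem_sup_right ⟨br v y, ?_⟩)
    simp

end lat


section lat2
open Polynomial

universe uu
variable {p q m M : ℕ} {A : Type uu} [AddCommGroup A] {br : A →+ A →+ A} {φ : AddMonoid.End A}

structure Good (p s t : ℕ) (br : A →+ A →+ A) (φ : AddMonoid.End A) (U : AddSubgroup A) : Prop where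
  inv : PInv φ U
  ge : pm A p t ≤ U
  br : ∀ x ∈ U, ∀ y ∈ U, ∃ z ∈ U, br x y = p ^ (s + t) • z

theorem Dat.tors (h : Dat p q m M br φ) {U : AddSubgroup A} {t B a : ℕ} (hU : pm A p t ≤ U) (hM : a + t + B ≤ M)
    {z : A} (hz : p ^ a • z = 0) : ∃ w ∈ U, z = p ^ B • w := by
  obtain ⟨y, hy⟩ := h.homo a (by omega) z hz
  refine ⟨p ^ (M - a - B) • y, hU (pm_anti (by omega) ⟨y, rfl⟩), ?_⟩
  rw [← mul_smul, ← pow_add, hy]; congr 2; omega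

theorem Dat.toQ [Finite A] (h : Dat p q m M br φ) {U : AddSubgroup A} {s t B : ℕ} (hU : Good p s t br φ U)
    (hM : 2 * s + 3 * t + B ≤ M) :
    ∃ (Q : Type uu) (_ : AddCommGroup Q) (_ : Finite Q) (brQ : Q →+ Q →+ Q) (φQ : AddMonoid.End Q) (π : U →+ Q),
      Dat p q m B brQ φQ ∧ Function.Surjective π ∧ (∀ u, π u = 0 ↔ ∃ w ∈ U, (u : A) = p ^ B • w) ∧
      (∀ u : U, φQ (π u) = π ⟨φ u, hU.inv u u.2⟩) ∧
      (∀ x y z : U, br x y = p ^ (s + t) • (z : A) → brQ (π x) (π y) = π z) := by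
  set K : AddSubgroup U := pm U p B with hK
  have hKm : ∀ u : U, u ∈ K ↔ ∃ w ∈ U, (u : A) = p ^ B • w := by
    intro u
    constructor
    · rintro ⟨w, rfl⟩
      exact ⟨w, w.2, by simp⟩
    · rintro ⟨w, hw, e⟩
      exact ⟨⟨w, hw⟩, by ext; simpa using e.symm⟩
  let π : U →+ U ⧸ K := QuotientAddGroup.mk' K
  have hπ : Function.Surjective π := QuotientAddGroup.mk'_surjective K
  have hπ0 : ∀ u, π u = 0 ↔ ∃ w ∈ U, (u : A) = p ^ B • w := by
    intro u
    rw [← hKm]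
    exact QuotientAddGroup.eq_zero_iff u
  have hπe : ∀ u v, π u = π v ↔ ∃ w ∈ U, (u : A) - v = p ^ B • w := by
    intro u v
    rw [← sub_eq_zero, ← map_sub, hπ0]; rfl
  have tors : ∀ a (u : U), a + t + B ≤ M → p ^ a • (u : A) = 0 → π u = 0 := by
    intro a u h1 h2
    rw [hπ0]
    exact h.tors hU.ge h1 h2
  obtain ⟨b0, hb0⟩ := mkBr (A := U) (A' := U ⧸ K) (fun x y Z => ∃ z : U, Z = π z ∧ br x y = p ^ (s + t) • (z : A))
    (by
      intro x y
      obtain ⟨z, hz, e⟩ := hU.br x x.2 y y.2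
      exact ⟨_, ⟨z, hz⟩, rfl, e⟩)
    (by
      rintro x y _ _ ⟨z, rfl, e⟩ ⟨z', rfl, e'⟩
      rw [← sub_eq_zero, ← map_sub]
      apply tors (s + t) _ (by omega)
      rw [AddSubgroup.coe_sub, smul_sub, ← e, ← e', sub_self])
    (by
      rintro x x' y _ _ ⟨z, rfl, e⟩ ⟨z', rfl, e'⟩
      exact ⟨z + z', (map_add π z z').symm, by simp [e, e']⟩)
    (by
      rintro x y y' _ _ ⟨z, rfl, e⟩ ⟨z', rfl, e'⟩
      exact ⟨z + z', (map_add π z z').symm, by simp [e, e']⟩)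
  have hb1 : ∀ x y z : U, br x y = p ^ (s + t) • (z : A) → b0 x y = π z := by
    intro x y z e
    obtain ⟨z', e1, e2⟩ := hb0 x y
    rw [e1, ← sub_eq_zero, ← map_sub]
    apply tors (s + t) _ (by omega)
    rw [AddSubgroup.coe_sub, smul_sub, ← e, ← e2, sub_self]
  have hQexp : ∀ X : U ⧸ K, p ^ B • X = 0 := by
    intro X
    obtain ⟨x, rfl⟩ := hπ X
    rw [← map_nsmul, hπ0]
    exact ⟨x, x.2, by simp⟩
  obtain ⟨bQ, hbQ⟩ := liftBr K b0
    (by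
      rintro _ ⟨x, rfl⟩ y
      rw [nsmulAddMonoidHom_apply, map_nsmul]
      exact hQexp _)
    (by
      rintro x _ ⟨y, rfl⟩
      rw [nsmulAddMonoidHom_apply, map_nsmul]
      exact hQexp _)
  have hb : ∀ x y z : U, br x y = p ^ (s + t) • (z : A) → bQ (π x) (π y) = π z := by
    intro x y z e
    exact (hbQ x y).trans (hb1 x y z e)
  let φU : U →+ U := (AddMonoidHom.comp (show A →+ A from φ) U.subtype).codRestrict U (fun u => hU.inv u u.2)
  have hφU : ∀ u : U, ((φU u : U) : A) = φ u := fun u => rfl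
  let φQ : U ⧸ K →+ U ⧸ K := QuotientAddGroup.map K K φU (by
    intro u hu
    rw [AddSubgroup.mem_comap]
    obtain ⟨w, rfl⟩ := hu
    exact ⟨φU w, by simp⟩)
  have hφQ : ∀ u : U, φQ (π u) = π (φU u) := fun u => rfl
  let φQ' : AddMonoid.End (U ⧸ K) := φQ
  have hφQ' : ∀ u : U, φQ' (π u) = π (φU u) := fun u => rfl
  have hpowU : ∀ n (u : U), (φ ^ n) (u : A) ∈ U := by
    intro n u
    induction n with
    | zero => exact u.2
    | succ n ih => rw [pow_succ', E_mul]; exact hU.inv _ ih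
  have hpow : ∀ n (u : U), (φQ' ^ n) (π u) = π ⟨(φ ^ n) (u : A), hpowU n u⟩ := by
    intro n
    induction n with
    | zero => intro u; rfl
    | succ n ih =>
      intro u
      have e : (φ ^ (n + 1)) (u : A) = φ ((φ ^ n) (u : A)) := by rw [pow_succ']; rfl
      rw [pow_succ', E_mul, ih, hφQ']
      congr 1
      ext
      exact e.symm
  have rep : ∀ x y : U, ∃ z : U, br x y = p ^ (s + t) • (z : A) := by
    intro x y
    obtain ⟨z, hz, e⟩ := hU.br x x.2 y y.2
    exact ⟨⟨z, hz⟩, e⟩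
  refine ⟨U ⧸ K, inferInstance, inferInstance, bQ, φQ', π, ⟨?_, ?_, ?_, ?_, hQexp, ?_, ?_⟩, hπ, hπ0, hφQ', hb⟩
  · intro X
    obtain ⟨x, rfl⟩ := hπ X
    rw [hb x x 0 (by simp [h.alt]), map_zero]
  · intro X Y Z
    obtain ⟨x, rfl⟩ := hπ X
    obtain ⟨y, rfl⟩ := hπ Y
    obtain ⟨z, rfl⟩ := hπ Z
    obtain ⟨a, ha⟩ := rep x y
    obtain ⟨a', ha'⟩ := rep a z
    obtain ⟨b, hb'⟩ := rep x z
    obtain ⟨b', hb''⟩ := rep b y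
    obtain ⟨c, hc⟩ := rep y z
    obtain ⟨c', hc'⟩ := rep x c
    rw [hb _ _ _ ha, hb _ _ _ ha', hb _ _ _ hb', hb _ _ _ hb'', hb _ _ _ hc, hb _ _ _ hc', ← map_add,
      ← sub_eq_zero, ← map_sub]
    apply tors (s + t + (s + t)) _ (by omega)
    have hl : ∀ (n : ℕ) (u v : A), n • br u v = br (n • u) v := fun n u v => by
      rw [map_nsmul, AddMonoidHom.nsmul_apply]
    have hr : ∀ (n : ℕ) (u v : A), n • br u v = br u (n • v) := fun n u v => by
      rw [map_nsmul]
    rw [AddSubgroup.coe_sub, AddSubgroup.coe_add, pow_add, mul_smul, smul_sub, smul_add, ← ha', ← hb'', ← hc',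
      smul_sub, smul_add, hr _ (x : A), ← hc, hl, hl, ← ha, ← hb', sub_eq_zero]
    exact h.jac x y z
  · intro X Y
    obtain ⟨x, rfl⟩ := hπ X
    obtain ⟨y, rfl⟩ := hπ Y
    obtain ⟨a, ha⟩ := rep x y
    rw [hb _ _ _ ha, hφQ', hφQ', hφQ', hb _ _ (φU a)]
    rw [hφU, hφU, hφU, ← h.comp, ha, map_nsmul]
  · intro X
    obtain ⟨x, rfl⟩ := hπ X
    simp only [hpow]
    rw [← map_sum]
    convert map_zero π
    ext
    rw [AddSubgroup.val_finsetSum]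
    exact h.N x
  · intro a ha X hX
    obtain ⟨x, rfl⟩ := hπ X
    rw [← map_nsmul, hπ0] at hX
    obtain ⟨w, hw, e⟩ := hX
    have e1 : p ^ a • ((x : A) - p ^ (B - a) • w) = 0 := by
      rw [smul_sub, ← mul_smul, ← pow_add, Nat.add_sub_cancel' ha, ← e]; simp
    obtain ⟨w', hw', e2⟩ := h.tors hU.ge (B := B - a) (by omega) e1
    refine ⟨π (⟨w', hw'⟩ + ⟨w, hw⟩), ?_⟩
    rw [← map_nsmul]
    congr 1
    ext
    simp only [AddSubgroup.coe_nsmul, AddSubgroup.coe_add, smul_add, ← e2]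
    abel
  · refine (card_fix_quot (A := U) φU φQ' π hπ hφQ').trans (le_trans ?_ h.fix)
    refine Nat.card_le_card_of_injective (fun u => ⟨(u.1 : A), ?_⟩) ?_
    · have := congrArg (Subtype.val) u.2
      exact this
    · intro u v huv
      apply Subtype.ext
      apply Subtype.ext
      have huv2 := congrArg Subtype.val huv
      exact huv2

theorem Dat.flagU [Finite A] (hp : p.Prime) {j : ℕ} (h : Dat p (p ^ j) m M br φ) {U : AddSubgroup A} {s t : ℕ}
    (hU : Good p s t br φ U) (hM : 2 * s + 3 * t + latB p (p ^ j) m ≤ M) :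
    ∃ F : ℕ → AddSubgroup A, F 0 = U ∧ (∀ x ∈ F m, ∃ u ∈ U, x = p ^ (2 * 2 ^ m + 1) • u) ∧ Antitone F ∧
      (∀ i, PInv φ (F i)) ∧ ∀ i < m, ∀ x ∈ F i, ∀ y ∈ U, ∃ z ∈ F (i + 1), br x y = p ^ (s + t) • z := by
  obtain ⟨Q, _, _, bQ, φQ, π, hD, hπ, hπ0, hφ, hb⟩ := h.toQ hU hM
  obtain ⟨F, hF0, hFm, hFa, hFI, hFb⟩ := hD.flag hp
  have hmem : ∀ i x, x ∈ ((F i).comap π).map U.subtype ↔ ∃ u : U, π u ∈ F i ∧ x = u := by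
    intro i x
    constructor
    · rintro ⟨u, hu, rfl⟩; exact ⟨u, hu, rfl⟩
    · rintro ⟨u, hu, rfl⟩; exact ⟨u, hu, rfl⟩
  refine ⟨fun i => ((F i).comap π).map U.subtype, ?_, ?_, ?_, ?_, ?_⟩
  · ext x
    rw [hmem, hF0]
    constructor
    · rintro ⟨u, _, rfl⟩; exact u.2
    · intro hx; exact ⟨⟨x, hx⟩, trivial, rfl⟩
  · intro x hx
    obtain ⟨u, hu, rfl⟩ := (hmem m x).1 hx
    rw [hFm] at hu
    obtain ⟨v, hv⟩ := hu
    obtain ⟨v, rfl⟩ := hπ v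
    have h1 : π (u - p ^ (2 * 2 ^ m + 1) • v) = 0 := by
      rw [map_sub, map_nsmul, ← hv]; exact sub_self _
    obtain ⟨w, hw, e⟩ := (hπ0 _).1 h1
    refine ⟨v + p ^ (latB p (p ^ j) m - (2 * 2 ^ m + 1)) • w, U.add_mem v.2 (U.nsmul_mem hw _), ?_⟩
    rw [smul_add, ← mul_smul, ← pow_add, Nat.add_sub_cancel' le_latB, ← e]
    simp
  · intro a b hab
    exact AddSubgroup.map_mono (AddSubgroup.comap_mono (hFa hab))
  · intro i x hx
    obtain ⟨u, hu, rfl⟩ := (hmem i x).1 hx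
    refine (hmem i _).2 ⟨⟨φ u, hU.inv u u.2⟩, ?_, rfl⟩
    rw [← hφ]; exact hFI i _ hu
  · intro i hi x hx y hy
    obtain ⟨u, hu, rfl⟩ := (hmem i x).1 hx
    obtain ⟨z, hz, e⟩ := hU.br u u.2 y hy
    refine ⟨z, (hmem _ _).2 ⟨⟨z, hz⟩, ?_, rfl⟩, e⟩
    rw [← hb u ⟨y, hy⟩ ⟨z, hz⟩ e]
    exact hFb i hi _ hu _

end lat2


section lat3
open Polynomial

universe uu
variable {p q m M : ℕ} {A : Type uu} [AddCommGroup A] {br : A →+ A →+ A} {φ : AddMonoid.End A}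

theorem Dat.step [Finite A] (hp : p.Prime) {j : ℕ} (h : Dat p (p ^ j) m M br φ) {U : AddSubgroup A} {s t : ℕ}
    (hU : Good p s t br φ U) (hM : 2 * s + 3 * t + latB p (p ^ j) m ≤ M) :
    ∃ U', Good p (s + 1) (t + 2 ^ m) br φ U' := by
  obtain ⟨F, hF0, hFm, hFa, hFI, hFb⟩ := h.flagU hp hU hM
  set c := 2 ^ m with hc
  have hFU : ∀ i, F i ≤ U := fun i => hF0 ▸ hFa (Nat.zero_le i)
  let U' : AddSubgroup A := AddSubgroup.closure {a | ∃ i ≤ m, ∃ x ∈ F i, a = p ^ (c + 1 - 2 ^ i) • x}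
  have hin : ∀ i ≤ m, ∀ x ∈ F i, ∀ N, c + 1 - 2 ^ i ≤ N → p ^ N • x ∈ U' := by
    intro i hi x hx N hN
    have e : p ^ N • x = p ^ (N - (c + 1 - 2 ^ i)) • (p ^ (c + 1 - 2 ^ i) • x) := by
      rw [← mul_smul, ← pow_add, Nat.sub_add_cancel hN]
    rw [e]
    exact U'.nsmul_mem (AddSubgroup.subset_closure ⟨i, hi, x, hx, rfl⟩) _
  have hpow : ∀ i ≤ m, 2 ^ i ≤ c := fun i hi => Nat.pow_le_pow_right (by norm_num) hi
  let S : AddSubgroup A := U'.map (nsmulAddMonoidHom (p ^ (s + 1 + (t + c))))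
  have key : ∀ i j, i ≤ j → j ≤ m → ∀ x ∈ F i, ∀ y ∈ F j,
      br (p ^ (c + 1 - 2 ^ j) • y) (p ^ (c + 1 - 2 ^ i) • x) ∈ S := by
    intro i j hij hjm x hx y hy
    have e0 : br (p ^ (c + 1 - 2 ^ j) • y) (p ^ (c + 1 - 2 ^ i) • x) =
        p ^ (c + 1 - 2 ^ j + (c + 1 - 2 ^ i)) • br y x := by
      rw [map_nsmul, map_nsmul, AddMonoidHom.nsmul_apply, ← mul_smul, ← pow_add, add_comm]
    have h1 := hpow j hjm
    have h2 := hpow i (hij.trans hjm)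
    have h3 : 2 ^ i ≤ 2 ^ j := Nat.pow_le_pow_right (by norm_num) hij
    have h4 : 1 ≤ 2 ^ i := Nat.one_le_two_pow
    rw [e0]
    rcases hjm.lt_or_eq with hlt | rfl
    · obtain ⟨z, hz, e⟩ := hFb j hlt y hy x (hFU i hx)
      have h5 := hpow (j + 1) hlt
      rw [pow_succ] at h5
      refine ⟨p ^ (c + 1 - 2 ^ j + (c + 1 - 2 ^ i) + (s + t) - (s + 1 + (t + c))) • z, hin (j + 1) hlt z hz _ ?_, ?_⟩
      · rw [pow_succ]; omega
      · rw [nsmulAddMonoidHom_apply, e, ← mul_smul, ← mul_smul, ← pow_add, ← pow_add]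
        congr 2; omega
    · obtain ⟨u, hu, rfl⟩ := hFm y hy
      obtain ⟨z, hz, e⟩ := hU.br u hu x (hFU i hx)
      refine ⟨p ^ (c + 1 - 2 ^ j + (c + 1 - 2 ^ i) + (2 * c + 1) + (s + t) - (s + 1 + (t + c))) • z,
        hin 0 (Nat.zero_le _) z (hF0 ▸ hz) _ ?_, ?_⟩
      · rw [pow_zero]; omega
      · rw [nsmulAddMonoidHom_apply, map_nsmul, AddMonoidHom.nsmul_apply, e, ← mul_smul, ← mul_smul, ← mul_smul,
          ← pow_add, ← pow_add, ← pow_add]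
        congr 2; omega
  have key2 : ∀ x ∈ U', ∀ y ∈ U', br x y ∈ S := by
    intro x hx y hy
    induction hx, hy using AddSubgroup.closure_induction₂ with
    | mem x y hx hy =>
      obtain ⟨i, hi, x, hx, rfl⟩ := hx
      obtain ⟨j, hj, y, hy, rfl⟩ := hy
      rcases le_total i j with hij | hij
      · rw [h.anti]; exact S.neg_mem (key i j hij hj x hx y hy)
      · exact key j i hij hi y hy x hx
    | zero_left x _ => simp
    | zero_right x _ => simp
    | add_left x y z _ _ _ h1 h2 => rw [map_add]; exact S.add_mem h1 h2
    | add_right y z x _ _ _ h1 h2 => rw [map_add]; exact S.add_mem h1 h2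
    | neg_left x y _ _ h1 => rw [map_neg]; exact S.neg_mem h1
    | neg_right x y _ _ h1 => rw [map_neg]; exact S.neg_mem h1
  refine ⟨U', ?_, ?_, ?_⟩
  · intro x hx
    have : U' ≤ U'.comap (show A →+ A from φ) := by
      rw [AddSubgroup.closure_le]
      rintro _ ⟨i, hi, x, hx, rfl⟩
      change φ (p ^ (c + 1 - 2 ^ i) • x) ∈ U'
      rw [map_nsmul]
      exact hin i hi _ (hFI i x hx) _ le_rfl
    exact this hx
  · rintro _ ⟨y, rfl⟩
    rw [nsmulAddMonoidHom_apply, add_comm, pow_add, mul_smul]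
    refine hin 0 (Nat.zero_le _) _ ?_ _ (by rw [pow_zero, Nat.add_sub_cancel])
    rw [hF0]
    exact hU.ge ⟨y, rfl⟩
  · intro x hx y hy
    obtain ⟨z, hz, e⟩ := key2 x hx y hy
    exact ⟨z, hz, e.symm⟩

def nbr (br : A →+ A →+ A) (x : ℕ → A) : ℕ → A
  | 0 => x 0
  | n + 1 => br (nbr br x n) (x (n + 1))

theorem Dat.main [Finite A] (hp : p.Prime) {j : ℕ} (h : Dat p (p ^ j) m M br φ) (s : ℕ)
    (hM : (3 * 2 ^ m + 2) * s + latB p (p ^ j) m ≤ M) (x : ℕ → A) :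
    nbr br x (2 ^ m + 1) ∈ pm A p s := by
  set c := 2 ^ m with hc
  have hG : ∀ s', s' ≤ s → ∃ U, Good p s' (c * s') br φ U := by
    intro s'
    induction s' with
    | zero =>
      intro _
      exact ⟨⊤, fun _ _ => trivial, le_top, fun x _ y _ => ⟨br x y, trivial, by simp⟩⟩
    | succ s' ih =>
      intro hs
      obtain ⟨U, hU⟩ := ih (by omega)
      have : c * s' ≤ c * s := Nat.mul_le_mul_left _ (by omega)
      obtain ⟨U', hU'⟩ := h.step hp hU (by
        have e : (3 * c + 2) * s = 3 * (c * s) + 2 * s := by ring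
        omega)
      refine ⟨U', ?_⟩
      rw [show c * (s' + 1) = c * s' + 2 ^ m by rw [← hc]; ring]
      exact hU'
  obtain ⟨U, hU⟩ := hG s le_rfl
  set t := c * s with ht
  have hM' : 3 * t + 2 * s ≤ M := by
    have e : (3 * c + 2) * s = 3 * (c * s) + 2 * s := by ring
    omega
  have h1 : ∀ u ∈ U, ∀ x, ∃ w ∈ U, br u x = p ^ s • w := by
    intro u hu x
    obtain ⟨z, hz, e⟩ := hU.br u hu (p ^ t • x) (hU.ge ⟨x, rfl⟩)
    have e2 : p ^ t • (br u x - p ^ s • z) = 0 := by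
      rw [smul_sub, ← map_nsmul, e, ← mul_smul, ← pow_add, add_comm, sub_self]
    obtain ⟨w, hw, e3⟩ := h.tors hU.ge (B := s) (by omega) e2
    exact ⟨w + z, U.add_mem hw hz, by rw [smul_add, ← e3]; abel⟩
  have h2 : ∀ n, ∃ w ∈ U, p ^ t • nbr br x n = p ^ (n * s) • w := by
    intro n
    induction n with
    | zero => exact ⟨p ^ t • x 0, hU.ge ⟨_, rfl⟩, by simp [nbr]⟩
    | succ n ih =>
      obtain ⟨w, hw, e⟩ := ih
      obtain ⟨w', hw', e'⟩ := h1 w hw (x (n + 1))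
      refine ⟨w', hw', ?_⟩
      rw [nbr, ← AddMonoidHom.nsmul_apply, ← map_nsmul, e, map_nsmul, AddMonoidHom.nsmul_apply, e', ← mul_smul, ← pow_add]
      congr 2; ring
  obtain ⟨w, hw, e⟩ := h2 (c + 1)
  have e2 : p ^ t • (nbr br x (c + 1) - p ^ s • w) = 0 := by
    rw [smul_sub, e, ← mul_smul, ← pow_add, sub_eq_zero]
    congr 2; rw [ht]; ring
  obtain ⟨y, hy⟩ := h.homo t (by omega) _ e2
  have e3 : nbr br x (c + 1) = p ^ (M - t) • y + p ^ s • w := by rw [← hy]; abel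
  rw [e3]
  exact AddSubgroup.add_mem _ (pm_anti (by omega) ⟨y, rfl⟩) ⟨w, rfl⟩

theorem poly_e (hp : p.Prime) (j : ℕ) : ∃ u : ℤ[X], u.eval 1 = 1 ∧
    (∑ i ∈ Finset.range p, X ^ (p ^ j * i) : ℤ[X]) = (X - 1) ^ ((p - 1) * p ^ j) + (p : ℤ[X]) * u := by
  haveI := Fact.mk hp
  have h1 : ((∑ i ∈ Finset.range p, X ^ (p ^ j * i) : ℤ[X]) - (X - 1) ^ ((p - 1) * p ^ j)).map
      (Int.castRingHom (ZMod p)) = 0 := by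
    simp only [Polynomial.map_sub, Polynomial.map_sum, Polynomial.map_pow, Polynomial.map_X, Polynomial.map_one]
    have e1 : (X - 1 : (ZMod p)[X]) ^ (p ^ j) = X ^ (p ^ j) - 1 := by
      rw [sub_pow_char_pow, one_pow]
    have e2 : (X ^ (p ^ j) - 1 : (ZMod p)[X]) ≠ 0 := by
      rw [← e1]
      have := X_sub_C_ne_zero (1 : ZMod p)
      rw [map_one] at this
      exact pow_ne_zero _ this
    rw [sub_eq_zero]
    apply mul_right_cancel₀ e2
    rw [mul_comm (p - 1), pow_mul, e1, ← pow_succ, Nat.sub_add_cancel hp.one_le]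
    simp only [pow_mul]
    rw [geom_sum_mul, sub_pow_char, one_pow]
  have h2 : C (p : ℤ) ∣ ((∑ i ∈ Finset.range p, X ^ (p ^ j * i) : ℤ[X]) - (X - 1) ^ ((p - 1) * p ^ j)) := by
    rw [C_dvd_iff_dvd_coeff]
    intro i
    have := congrArg (fun f => coeff f i) h1
    simp only [coeff_map, coeff_zero] at this
    exact (ZMod.intCast_zmod_eq_zero_iff_dvd _ _).1 this
  obtain ⟨u, hu⟩ := h2
  have h3 : (∑ i ∈ Finset.range p, X ^ (p ^ j * i) : ℤ[X]) = (X - 1) ^ ((p - 1) * p ^ j) + (p : ℤ[X]) * u := by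
    rw [← sub_eq_iff_eq_add', hu]; simp
  refine ⟨u, ?_, h3⟩
  have h4 := congrArg (eval 1) h3
  have h5 : (p - 1) * p ^ j ≠ 0 := (Nat.mul_pos (by have := hp.two_le; omega) (pow_pos hp.pos j)).ne'
  simp [eval_finset_sum, h5] at h4
  have h6 : (p : ℤ) ≠ 0 := by exact_mod_cast hp.ne_zero
  apply mul_left_cancel₀ h6
  rw [mul_one]; exact h4.symm

theorem Dat.e_dvd [Finite A] (hp : p.Prime) {j : ℕ} (h : Dat p (p ^ j) m M br φ) (hM : 2 ≤ M) :
    ∃ d, (pm A p 1).index = p ^ ((p - 1) * p ^ j * d) := by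
  obtain ⟨u, hu1, hu⟩ := poly_e hp j
  have hcyc := N_cyc hp j h.N
  set e := (p - 1) * p ^ j with he
  have he0 : e ≠ 0 := (Nat.mul_pos (by have := hp.two_le; omega) (pow_pos hp.pos j)).ne'
  set π : AddMonoid.End A := φ - 1 with hπ
  have h0 : π ^ e = - ((p : AddMonoid.End A) * aeval φ u) := by
    have := N_poly h.N
    rw [hu] at this
    simp only [map_add, map_pow, map_sub, aeval_X, map_one, map_mul, map_natCast] at this
    exact eq_neg_of_add_eq_zero_left this
  obtain ⟨v, hv⟩ := X_sub_C_dvd_sub_C_eval (a := (1 : ℤ)) (p := u)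
  have hnil : IsNilpotent (aeval φ (X - C 1 : ℤ[X])) := by
    refine ⟨p * p ^ j * M, ?_⟩
    obtain ⟨s, hs⟩ := hcyc.D1 M
    ext x
    have e1 : aeval φ (X - C 1 : ℤ[X]) = π := by simp [hπ]
    rw [e1, hs, h.exp]; rfl
  have hunit : IsUnit (aeval φ u) := by
    have e1 : u = 1 + (X - C 1) * v := by rw [← hv, hu1]; simp
    rw [e1, map_add, map_one, map_mul]
    exact (Commute.isNilpotent_mul_right (aeval_comm φ _ _) hnil).isUnit_one_add
  obtain ⟨w, hw⟩ := hunit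
  have hinv : ∀ x, aeval φ u ((↑w⁻¹ : AddMonoid.End A) x) = x := by
    intro x
    rw [← hw, ← E_mul, w.mul_inv]; rfl
  have h0' : ∀ x, (π ^ e) x = - (p • aeval φ u x) := fun x => by rw [h0]; rfl
  have hpe : pm A p 1 = AddMonoidHom.range (π ^ e) := by
    ext x
    constructor
    · rintro ⟨y, rfl⟩
      refine ⟨- ((↑w⁻¹ : AddMonoid.End A) y), ?_⟩
      have := h0' (- ((↑w⁻¹ : AddMonoid.End A) y))
      rw [map_neg, map_neg, smul_neg, neg_neg, hinv] at this
      rw [nsmulAddMonoidHom_apply, pow_one, ← this]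
      exact map_neg (π ^ e) _
    · rintro ⟨y, rfl⟩
      refine ⟨- aeval φ u y, ?_⟩
      rw [nsmulAddMonoidHom_apply, pow_one, smul_neg]
      exact (h0' y).symm
  have hkp : ∀ x, (π ^ e) x = 0 → p • x = 0 := by
    intro x hx
    rw [h0', neg_eq_zero, ← map_nsmul] at hx
    have hc : ((↑w⁻¹ : AddMonoid.End A) * aeval φ u) (p • x) = p • x := by
      rw [← hw, w.inv_mul]; rfl
    rw [← hc, E_mul, hx, map_zero]
  have hker : ∀ i ≤ e, Nat.card (AddMonoidHom.ker (π ^ i)) = Nat.card (AddMonoidHom.ker π) ^ i := by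
    intro i
    induction i with
    | zero =>
      intro _
      rw [pow_zero, pow_zero, Nat.card_eq_one_iff_unique]
      refine ⟨⟨fun a b => ?_⟩, ⟨0⟩⟩
      have h1 : ∀ a : AddMonoidHom.ker (1 : AddMonoid.End A), (a : A) = 0 := fun a => a.2
      exact Subtype.ext ((h1 a).trans (h1 b).symm)
    | succ i ih =>
      intro hi
      let K : AddSubgroup A := AddMonoidHom.ker (π ^ (i + 1))
      have hK : ∀ x, x ∈ K ↔ (π ^ (i + 1)) x = 0 := fun x => Iff.rfl
      let f : K →+ A := (AddMonoidHom.comp (show A →+ A from π) K.subtype)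
      have hf : ∀ x : K, f x = π x := fun x => rfl
      have h1 : Nat.card f.ker * Nat.card f.range = Nat.card K := by
        rw [← AddSubgroup.index_ker]; exact f.ker.card_mul_index
      have h2 : f.range = AddMonoidHom.ker (π ^ i) := by
        ext x
        constructor
        · rintro ⟨y, rfl⟩
          change (π ^ i) (π y) = 0
          rw [← E_mul, ← pow_succ]; exact y.2
        · intro hx
          change (π ^ i) x = 0 at hx
          have hx2 : p ^ 1 • x = 0 := by
            rw [pow_one]
            apply hkp
            rw [← Nat.sub_add_cancel (show i ≤ e by omega), pow_add, E_mul, hx, map_zero]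
          obtain ⟨y, hy⟩ := h.homo 1 (by omega) x hx2
          have hx3 : x ∈ pm A p 1 := by
            rw [hy]; exact pm_anti (by omega) ⟨y, rfl⟩
          rw [hpe] at hx3
          obtain ⟨z, hz⟩ := hx3
          change (π ^ e) z = x at hz
          have e1 : π ((π ^ (e - 1)) z) = x := by
            rw [← E_mul, ← pow_succ', Nat.sub_add_cancel (by omega), hz]
          refine ⟨⟨(π ^ (e - 1)) z, ?_⟩, e1⟩
          rw [hK, pow_succ, E_mul, e1, hx]
      have h3 : Nat.card f.ker = Nat.card (AddMonoidHom.ker π) := by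
        refine Nat.card_congr ⟨fun x => ⟨x.1.1, x.2⟩, fun x => ⟨⟨x.1, ?_⟩, x.2⟩, fun x => rfl, fun x => rfl⟩
        rw [hK, pow_succ, E_mul]
        have : π x.1 = 0 := x.2
        rw [this, map_zero]
      rw [h2, h3, ih (by omega)] at h1
      exact h1.symm.trans (pow_succ' _ i).symm
  obtain ⟨E, hE⟩ := card_of_exp hp h.exp
  have hdv : Nat.card (AddMonoidHom.ker π) ∣ p ^ E := by
    rw [← hE]; exact AddSubgroup.card_addSubgroup_dvd_card _
  obtain ⟨d, _, hd⟩ := (Nat.dvd_prime_pow hp).1 hdv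
  refine ⟨d, ?_⟩
  have h9 := index_range_eq (A := A) (π ^ e)
  rw [hpe]
  refine h9.trans ((hker e le_rfl).trans ?_)
  rw [hd, ← pow_mul, mul_comm]

end lat3


section grp
open scoped commutatorElement

variable {G : Type} [Group G]

structure Sec (H K : Subgroup G) {L : Type} [AddCommGroup L] (ρ : G → L) : Prop where
  surj : ∀ l, ∃ x ∈ H, ρ x = l
  mul : ∀ x ∈ H, ∀ y ∈ H, ρ (x * y) = ρ x + ρ y
  eq : ∀ x ∈ H, ∀ y ∈ H, (ρ x = ρ y ↔ x⁻¹ * y ∈ K)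

theorem exSec [Finite G] (H K : Subgroup G) [hK : K.Normal] (h : ⁅H, H⁆ ≤ K) :
    ∃ (L : Type) (_ : AddCommGroup L) (_ : Finite L) (ρ : G → L), Sec H K ρ := by
  classical
  let Q := H ⧸ K.subgroupOf H
  let inst : CommGroup Q :=
    { (inferInstance : Group Q) with
      mul_comm := by
        intro a b
        obtain ⟨x, rfl⟩ := QuotientGroup.mk_surjective a
        obtain ⟨y, rfl⟩ := QuotientGroup.mk_surjective b
        change ((x * y : H) : Q) = ((y * x : H) : Q)
        rw [QuotientGroup.eq, Subgroup.mem_subgroupOf]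
        have h1 : ⁅(y : G)⁻¹, (x : G)⁻¹⁆ ∈ K :=
          h (Subgroup.commutator_mem_commutator (H.inv_mem y.2) (H.inv_mem x.2))
        convert h1 using 1
        simp [commutatorElement_def, mul_assoc] }
  have hρ : ∃ ρ : G → Q, ∀ x : H, ρ x = (x : Q) := by
    refine ⟨fun x => if hx : x ∈ H then ((⟨x, hx⟩ : H) : Q) else 1, fun x => ?_⟩
    simp
  obtain ⟨ρ, hρ⟩ := hρ
  refine ⟨Additive Q, inferInstance, inferInstance, fun x => Additive.ofMul (ρ x), ?_, ?_, ?_⟩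
  · intro l
    obtain ⟨x, hx⟩ := QuotientGroup.mk_surjective (Additive.toMul l)
    refine ⟨x, x.2, ?_⟩
    rw [hρ, hx]; rfl
  · intro x hx y hy
    have h1 := hρ ⟨x, hx⟩
    have h2 := hρ ⟨y, hy⟩
    have h3 := hρ ⟨x * y, H.mul_mem hx hy⟩
    simp only at h1 h2 h3
    rw [h1, h2, h3]; rfl
  · intro x hx y hy
    have h1 := hρ ⟨x, hx⟩
    have h2 := hρ ⟨y, hy⟩
    simp only at h1 h2
    rw [h1, h2, EmbeddingLike.apply_eq_iff_eq, QuotientGroup.eq, Subgroup.mem_subgroupOf]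
    rfl

theorem cardX [Finite G] (K : Subgroup G) (φ : MulAut G) :
    Nat.card {x : G // x⁻¹ * φ x ∈ K} ≤ Nat.card ({x : G // φ x = x} × K) := by
  let X := {x : G // x⁻¹ * φ x ∈ K}
  let v : X → K := fun x => ⟨x.1⁻¹ * φ x.1, x.2⟩
  have hb : ∀ x : X, ∃ b : K → G, ∀ y : X, (b (v y))⁻¹ * φ (b (v y)) = y.1⁻¹ * φ y.1 := by
    intro x
    classical
    refine ⟨fun k => if hk : ∃ y : X, v y = k then (Classical.choose hk).1 else 1, fun y => ?_⟩
    have hk : ∃ y' : X, v y' = v y := ⟨y, rfl⟩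
    beta_reduce
    rw [dif_pos hk]
    exact congrArg Subtype.val (Classical.choose_spec hk)
  obtain ⟨b, hb⟩ := hb ⟨1, by simp⟩
  refine Nat.card_le_card_of_injective (fun x => (⟨x.1 * (b (v x))⁻¹, ?_⟩, v x)) ?_
  · have := hb x
    have e : φ (b (v x)) = b (v x) * (x.1⁻¹ * φ x.1) := by rw [← this]; group
    rw [map_mul, map_inv, e]; group
  · intro x y e
    have e1 := congrArg Prod.snd e
    have e2 := congrArg (fun z => (Prod.fst z).1) e
    simp only at e1 e2
    rw [e1] at e2
    exact Subtype.ext (mul_right_cancel e2)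

theorem quot_fix [Finite G] (K : Subgroup G) [K.Normal] (φ : MulAut G) (ψ : MulAut (G ⧸ K))
    (h : ∀ x : G, ψ (x : G ⧸ K) = (φ x : G ⧸ K)) :
    Nat.card {x : G ⧸ K // ψ x = x} ≤ Nat.card {x : G // φ x = x} := by
  let X := {x : G // x⁻¹ * φ x ∈ K}
  have h1 : Nat.card ({x : G ⧸ K // ψ x = x} × K) ≤ Nat.card X := by
    have hr : ∀ l : G ⧸ K, ((Quotient.out l : G) : G ⧸ K) = l := fun l => QuotientGroup.out_eq' l
    have hm : ∀ (l : {x : G ⧸ K // ψ x = x}) (k : K),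
        (Quotient.out l.1 * k : G)⁻¹ * φ (Quotient.out l.1 * k) ∈ K := by
      intro l k
      rw [← QuotientGroup.eq, ← h, QuotientGroup.mk_mul_of_mem _ k.2, hr, l.2]
    refine Nat.card_le_card_of_injective (fun a => (⟨Quotient.out a.1.1 * a.2, hm a.1 a.2⟩ : X)) ?_
    rintro ⟨l, k⟩ ⟨l', k'⟩ e
    have e1 : (Quotient.out l.1 * k : G) = Quotient.out l'.1 * k' := congrArg Subtype.val e
    have e2 : l = l' := by
      apply Subtype.ext
      have := congrArg (fun x : G => (x : G ⧸ K)) e1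
      rwa [QuotientGroup.mk_mul_of_mem _ k.2, QuotientGroup.mk_mul_of_mem _ k'.2, hr, hr] at this
    subst e2
    have e3 : k = k' := Subtype.ext (mul_left_cancel e1)
    rw [e3]
  have h2 : Nat.card X ≤ Nat.card ({x : G // φ x = x} × K) := cardX K φ
  rw [Nat.card_prod] at h1 h2
  exact Nat.le_of_mul_le_mul_right (h1.trans h2) Nat.card_pos

namespace Sec
variable {H K : Subgroup G} {L : Type} [AddCommGroup L] {ρ : G → L}

theorem one (h : Sec H K ρ) : ρ 1 = 0 := by
  have := h.mul 1 H.one_mem 1 H.one_mem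
  rw [mul_one] at this
  exact left_eq_add.1 this

theorem pow (h : Sec H K ρ) {x : G} (hx : x ∈ H) (n : ℕ) : ρ (x ^ n) = n • ρ x := by
  induction n with
  | zero => simp [h.one]
  | succ n ih => rw [pow_succ, h.mul _ (H.pow_mem hx n) _ hx, ih, succ_nsmul]

theorem inv (h : Sec H K ρ) {x : G} (hx : x ∈ H) : ρ x⁻¹ = - ρ x := by
  rw [eq_neg_iff_add_eq_zero, ← h.mul _ (H.inv_mem hx) _ hx, inv_mul_cancel, h.one]

theorem eq0 (h : Sec H K ρ) {x : G} (hx : x ∈ H) : ρ x = 0 ↔ x ∈ K := by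
  rw [← h.one, eq_comm, h.eq _ H.one_mem _ hx]; simp

theorem lift (h : Sec H K ρ) (φ : G →* G) (hH : ∀ x ∈ H, φ x ∈ H) (hK : ∀ x ∈ K, φ x ∈ K) :
    ∃ φL : AddMonoid.End L, ∀ x ∈ H, φL (ρ x) = ρ (φ x) := by
  choose r hr hrl using h.surj
  have key : ∀ x ∈ H, ρ (φ (r (ρ x))) = ρ (φ x) := by
    intro x hx
    rw [h.eq _ (hH _ (hr _)) _ (hH _ hx), ← map_inv, ← map_mul]
    apply hK
    rw [← h.eq _ (hr _) _ hx, hrl]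
  refine ⟨AddMonoidHom.mk' (fun l => ρ (φ (r l))) ?_, key⟩
  intro a b
  rw [← h.mul _ (hH _ (hr _)) _ (hH _ (hr _)), ← map_mul]
  have e : a + b = ρ (r a * r b) := by rw [h.mul _ (hr _) _ (hr _), hrl, hrl]
  rw [e, key _ (H.mul_mem (hr _) (hr _))]

theorem fix [Finite G] [Finite L] (h : Sec H K ρ) (hKH : K ≤ H) (φ : MulAut G) (hH : ∀ x ∈ H, φ x ∈ H) 
    (φL : AddMonoid.End L) (hL : ∀ x ∈ H, φL (ρ x) = ρ (φ x)) :
    Nat.card {l : L // φL l = l} ≤ Nat.card {x : G // φ x = x} := by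
  choose r hr hrl using h.surj
  let X := {x : G // x⁻¹ * φ x ∈ K}
  have h1 : Nat.card ({l : L // φL l = l} × K) ≤ Nat.card X := by
    have hm : ∀ (l : {l : L // φL l = l}) (k : K), (r l.1 * k)⁻¹ * φ (r l.1 * k) ∈ K := by
      intro l k
      have hx : r l.1 * k ∈ H := H.mul_mem (hr _) (hKH k.2)
      rw [← h.eq _ hx _ (hH _ hx), ← hL _ hx, h.mul _ (hr _) _ (hKH k.2), hrl, (h.eq0 (hKH k.2)).2 k.2, add_zero, l.2]
    refine Nat.card_le_card_of_injective (fun a => (⟨r a.1.1 * a.2, hm a.1 a.2⟩ : X)) ?_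
    rintro ⟨l, k⟩ ⟨l', k'⟩ e
    have e1 : r l.1 * k = r l'.1 * k' := congrArg Subtype.val e
    have e2 : l = l' := by
      apply Subtype.ext
      have := congrArg ρ e1
      rwa [h.mul _ (hr _) _ (hKH k.2), h.mul _ (hr _) _ (hKH k'.2), hrl, hrl, (h.eq0 (hKH k.2)).2 k.2,
        (h.eq0 (hKH k'.2)).2 k'.2, add_zero, add_zero] at this
    subst e2
    have e3 : k = k' := Subtype.ext (mul_left_cancel e1)
    rw [e3]
  have h2 : Nat.card X ≤ Nat.card ({x : G // φ x = x} × K) := cardX K φ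
  rw [Nat.card_prod] at h1 h2
  exact Nat.le_of_mul_le_mul_right (h1.trans h2) Nat.card_pos

theorem index (h : Sec H K ρ) (S : AddSubgroup L) (J : Subgroup G) (hJ : ∀ x ∈ H, (ρ x ∈ S ↔ x ∈ J)) :
    S.index = J.relIndex H := by
  let f : H →* Multiplicative L :=
    MonoidHom.mk' (fun x => Multiplicative.ofAdd (ρ x)) (fun x y => by
      change Multiplicative.ofAdd (ρ (x * y)) = _
      rw [h.mul _ x.2 _ y.2]; rfl)
  have hf : Function.Surjective f := by
    intro l
    obtain ⟨x, hx, e⟩ := h.surj l.toAdd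
    exact ⟨⟨x, hx⟩, congrArg Multiplicative.ofAdd e⟩
  have e : (AddSubgroup.toSubgroup S).comap f = J.subgroupOf H := by
    ext x
    rw [Subgroup.mem_subgroupOf]
    exact hJ x x.2
  rw [Subgroup.relIndex, ← e, Subgroup.index_comap_of_surjective _ hf]
  rfl

end Sec
end grp


section grp2
open scoped commutatorElement

variable {G : Type} [Group G] {F : ℕ → Subgroup G} {p : ℕ}

def Cg (p : ℕ) (A : Subgroup G) (n : ℕ) (x y : G) : Prop :=
  (x : G ⧸ pw p A n) = (y : G ⧸ pw p A n)

section
variable {A : Subgroup G} {n : ℕ} {x y z x' y' : G}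

theorem cg_iff : Cg p A n x y ↔ x⁻¹ * y ∈ pw p A n := QuotientGroup.eq

theorem Cg.refl (n : ℕ) (x : G) : Cg p A n x x := rfl
theorem Cg.symm (h : Cg p A n x y) : Cg p A n y x := Eq.symm h
theorem Cg.trans (h : Cg p A n x y) (h' : Cg p A n y z) : Cg p A n x z := Eq.trans h h'
theorem cg_one : Cg p A n x 1 ↔ x ∈ pw p A n := by
  rw [cg_iff, mul_one, inv_mem_iff]

variable [hA : A.Normal]
theorem Cg.mul (h : Cg p A n x y) (h' : Cg p A n x' y') : Cg p A n (x * x') (y * y') := by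
  unfold Cg at *
  rw [QuotientGroup.mk_mul, QuotientGroup.mk_mul, h, h']
theorem Cg.inv (h : Cg p A n x y) : Cg p A n x⁻¹ y⁻¹ := by
  unfold Cg at *
  rw [QuotientGroup.mk_inv, QuotientGroup.mk_inv, h]
theorem Cg.mem (h : Cg p A n x y) (hx : x ∈ pw p A n) : y ∈ pw p A n :=
  cg_one.1 (h.symm.trans (cg_one.2 hx))

theorem pw_anti (hp : p.Prime) (hF : IsFilt F p) (A : Subgroup G) [A.Normal] : Antitone (pw p A) := by
  intro i j h
  obtain ⟨d, rfl⟩ := Nat.exists_eq_add_of_le h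
  rw [← pw_pw hp hF]
  exact pw_le d

theorem pw_comm (hp : p.Prime) (hF : IsFilt F p) (A : Subgroup G) [A.Normal] (i j : ℕ) :
    ⁅pw p A i, pw p A j⁆ ≤ pw p A (i + j) := by
  rw [R hp hF, Subgroup.commutator_comm, R hp hF, pw_pw hp hF, add_comm j i]
  exact pw_mono (Subgroup.commutator_le_right _ _) _

theorem cm_mem (hp : p.Prime) (hF : IsFilt F p) {i j : ℕ} (hx : x ∈ pw p A i) (hy : y ∈ pw p A j) :
    ⁅x, y⁆ ∈ pw p A (i + j) := pw_comm hp hF A i j (Subgroup.commutator_mem_commutator hx hy)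

theorem pow_mem2 (hp : p.Prime) (hF : IsFilt F p) {i : ℕ} (hx : x ∈ pw p A i) (j : ℕ) :
    x ^ (p ^ j) ∈ pw p A (i + j) := by
  rw [← pw_pw hp hF]; exact pow_mem_pw hx j

theorem ex_root (hp : p.Prime) (hF : IsFilt F p) {i j : ℕ} (hx : x ∈ pw p A (i + j)) :
    ∃ y ∈ pw p A i, x = y ^ (p ^ j) := by
  rwa [← pw_pw hp hF, mem_pw hp hF] at hx

theorem Cg.mono (hp : p.Prime) (hF : IsFilt F p) {n n' : ℕ} (h : Cg p A n x y) (hn : n' ≤ n) : Cg p A n' x y :=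
  cg_iff.2 (pw_anti hp hF A hn (cg_iff.1 h))

theorem Cg.pow (hp : p.Prime) (hF : IsFilt F p) (h : Cg p A n x y) (i : ℕ) :
    Cg p A (n + i) (x ^ (p ^ i)) (y ^ (p ^ i)) := by
  rw [cg_iff] at *
  have := mul_pow_mem' hp hF _ i x h
  rwa [mul_inv_cancel_left, pw_pw hp hF] at this

theorem cg_mulpow (hp : p.Prime) (hF : IsFilt F p) {a b : ℕ} (hx : x ∈ pw p A a) (hy : y ∈ pw p A b) (i : ℕ) :
    Cg p A (a + b + i) (x ^ (p ^ i) * y ^ (p ^ i)) ((x * y) ^ (p ^ i)) := by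
  rw [cg_iff, mul_inv_rev, ← pw_pw hp hF]
  exact pw_mono (pw_comm hp hF A a b) i (mul_pow_mem hp hF _ _ i hx hy)

theorem cg_conj (hp : p.Prime) (hF : IsFilt F p) {a b : ℕ} (hx : x ∈ pw p A a) (hy : y ∈ pw p A b) :
    Cg p A (a + b) (x * y * x⁻¹) y := by
  have h := cg_one.2 (cm_mem hp hF hx hy)
  have := h.mul (Cg.refl _ y)
  simpa [commutatorElement_def] using this

theorem Cg.commr (hp : p.Prime) (hF : IsFilt F p) {b : ℕ} (h : Cg p A n x x') (hy : y ∈ pw p A b) :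
    Cg p A (n + b) ⁅x, y⁆ ⁅x', y⁆ := by
  have h1 := cm_mem hp hF (cg_iff.1 h) hy
  have h2 := cg_one.2 ((pw_normal (A := A) (n + b)).conj_mem _ h1 x)
  have h3 := h2.mul (Cg.refl _ ⁅x, y⁆)
  rw [one_mul] at h3
  convert h3.symm using 1
  simp only [commutatorElement_def]; group

theorem Cg.comml (hp : p.Prime) (hF : IsFilt F p) {b : ℕ} (h : Cg p A n x x') (hy : y ∈ pw p A b) :
    Cg p A (n + b) ⁅y, x⁆ ⁅y, x'⁆ := by
  rw [← commutatorElement_inv x, ← commutatorElement_inv x']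
  exact (h.commr hp hF hy).inv

theorem cg_comm (hp : p.Prime) (hF : IsFilt F p) {a b : ℕ} (hx : x ∈ pw p A a) (hy : y ∈ pw p A b) :
    Cg p A (a + b) (x * y) (y * x) := by
  simpa using (cg_conj hp hF hx hy).mul (Cg.refl _ x)

theorem cg_mull (hp : p.Prime) (hF : IsFilt F p) {a a' b : ℕ} (hx : x ∈ pw p A a) (hx' : x' ∈ pw p A a')
    (hy : y ∈ pw p A b) : Cg p A (a + a' + b) ⁅x * x', y⁆ (⁅x, y⁆ * ⁅x', y⁆) := by
  have h1 := cg_conj hp hF hx (cm_mem hp hF hx' hy)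
  have h2 := cg_comm hp hF (cm_mem hp hF hx' hy) (cm_mem hp hF hx hy)
  have h3 := (h1.mul (Cg.refl _ ⁅x, y⁆))
  have h4 := (h3.mono hp hF (n' := a + a' + b) (by omega)).trans (h2.mono hp hF (by omega))
  convert h4 using 1
  simp only [commutatorElement_def]; group

theorem cg_mulr (hp : p.Prime) (hF : IsFilt F p) {a b b' : ℕ} (hx : x ∈ pw p A a) (hy : y ∈ pw p A b)
    (hy' : y' ∈ pw p A b') : Cg p A (a + b + b') ⁅x, y * y'⁆ (⁅x, y⁆ * ⁅x, y'⁆) := by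
  have h1 := (cg_mull hp hF hy hy' hx).inv
  rw [mul_inv_rev] at h1
  simp only [commutatorElement_inv] at h1
  have h2 := cg_comm hp hF (cm_mem hp hF hx hy') (cm_mem hp hF hx hy)
  exact (h1.mono hp hF (by omega)).trans (h2.mono hp hF (by omega))

theorem cg_invl (hp : p.Prime) (hF : IsFilt F p) {a b : ℕ} (hx : x ∈ pw p A a) (hy : y ∈ pw p A b) :
    Cg p A (a + a + b) ⁅x⁻¹, y⁆ ⁅x, y⁆⁻¹ := by
  have h := cg_conj hp hF (Subgroup.inv_mem _ hx) (Subgroup.inv_mem _ (cm_mem hp hF hx hy))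
  convert h.mono hp hF (n' := a + a + b) (by omega) using 1
  simp only [commutatorElement_def]; group

theorem powcomm (hp : p.Prime) (hF : IsFilt F p) {a b : ℕ} (hx : x ∈ pw p A a) (hy : y ∈ pw p A b) (i : ℕ) :
    Cg p A (a + a + b + i) ⁅x ^ (p ^ i), y⁆ (⁅x, y⁆ ^ (p ^ i)) := by
  have h := cg_mulpow hp hF (Subgroup.inv_mem _ hx) (cm_mem hp hF hx hy) i
  have h2 := (Cg.refl _ (x ^ (p ^ i))).mul h.symm
  convert h2.mono hp hF (n' := a + a + b + i) (by omega) using 1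
  · have e : x⁻¹ * ⁅x, y⁆ = y * x⁻¹ * y⁻¹ := by simp only [commutatorElement_def]; group
    rw [e, conj_pow, inv_pow]
    simp only [commutatorElement_def]; group
  · rw [inv_pow]; group

theorem hall_witt (hp : p.Prime) (hF : IsFilt F p) {f : ℕ} (hx : x ∈ pw p A f) (hy : y ∈ pw p A f)
    (hz : z ∈ pw p A f) : Cg p A (4 * f) (⁅⁅y, z⁆, x⁆ * ⁅⁅z, x⁆, y⁆ * ⁅⁅x, y⁆, z⁆) 1 := by
  have key : ∀ x y z : G, x ∈ pw p A f → y ∈ pw p A f → z ∈ pw p A f →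
      Cg p A (4 * f) (y * ⁅x, ⁅y⁻¹, z⁆⁆ * y⁻¹) ⁅⁅y, z⁆, x⁆ := by
    intro x y z hx hy hz
    have h1 := cg_conj hp hF hy (cm_mem hp hF hx (cm_mem hp hF (Subgroup.inv_mem _ hy) hz))
    have h2 := (cg_invl hp hF hy hz).comml hp hF hx
    have h3 := (cg_invl hp hF (cm_mem hp hF hy hz) hx).inv
    rw [inv_inv, commutatorElement_inv] at h3
    exact (h1.mono hp hF (by omega)).trans ((h2.mono hp hF (by omega)).trans (h3.mono hp hF (by omega)))
  have := ((key x y z hx hy hz).mul (key y z x hy hz hx)).mul (key z x y hz hx hy)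
  refine this.symm.trans ?_
  have e : y * ⁅x, ⁅y⁻¹, z⁆⁆ * y⁻¹ * (z * ⁅y, ⁅z⁻¹, x⁆⁆ * z⁻¹) * (x * ⁅z, ⁅x⁻¹, y⁆⁆ * x⁻¹) = 1 := by
    simp only [commutatorElement_def]; group
  rw [e]; exact Cg.refl _ _

/-! uniform -/
theorem powmap (hp : p.Prime) (hF : IsFilt F p) [Finite G] (A : Subgroup G) [A.Normal] (i : ℕ) :
    (pw p A (i + 2)).relIndex (pw p A (i + 1)) ≤ (pw p A (i + 1)).relIndex (pw p A i) ∧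
    ((pw p A (i + 2)).relIndex (pw p A (i + 1)) = (pw p A (i + 1)).relIndex (pw p A i) →
      ∀ v ∈ pw p A i, v ^ p ∈ pw p A (i + 2) → v ∈ pw p A (i + 1)) := by
  let f : (pw p A i ⧸ (pw p A (i + 1)).subgroupOf (pw p A i)) →
      (pw p A (i + 1) ⧸ (pw p A (i + 2)).subgroupOf (pw p A (i + 1))) :=
    Quotient.lift (fun x : pw p A i =>
      ((⟨x.1 ^ p, by simpa using pow_mem2 hp hF x.2 1⟩ : pw p A (i + 1)) :
        (pw p A (i + 1) ⧸ (pw p A (i + 2)).subgroupOf (pw p A (i + 1))))) (by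
      intro x y h
      have h' : Cg p A (i + 1) x.1 y.1 := by
        have h0 : (x : pw p A i ⧸ (pw p A (i + 1)).subgroupOf (pw p A i)) = y := Quotient.sound h
        rw [QuotientGroup.eq, Subgroup.mem_subgroupOf] at h0
        exact cg_iff.2 h0
      rw [QuotientGroup.eq, Subgroup.mem_subgroupOf]
      have := h'.pow hp hF 1
      rw [pow_one] at this
      exact cg_iff.1 this)
  have hf : Function.Surjective f := by
    intro l
    obtain ⟨x, rfl⟩ := QuotientGroup.mk_surjective l
    obtain ⟨y, hy, e⟩ := ex_root hp hF x.2
    refine ⟨((⟨y, hy⟩ : pw p A i) : _ ⧸ _), ?_⟩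
    refine congrArg (QuotientGroup.mk : pw p A (i + 1) → _ ⧸ (pw p A (i + 2)).subgroupOf (pw p A (i + 1))) ?_
    apply Subtype.ext
    rw [e]
    simp
  refine ⟨Nat.card_le_card_of_surjective f hf, fun h v hv hvp => ?_⟩
  have hb : Function.Bijective f := (Nat.bijective_iff_surjective_and_card f).2 ⟨hf, h.symm⟩
  have := @hb.1 ((⟨v, hv⟩ : pw p A i) : _ ⧸ _) ((1 : pw p A i) : _ ⧸ _) (by
    refine QuotientGroup.eq.2 ?_
    rw [Subgroup.mem_subgroupOf]
    simpa using hvp)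
  rw [QuotientGroup.eq, Subgroup.mem_subgroupOf] at this
  simpa using this

def Uni (p : ℕ) (A : Subgroup G) (r Mx : ℕ) : Prop :=
  ∀ i ≤ Mx, (pw p A (i + 1)).relIndex (pw p A i) = r

theorem Uni.root1 (hp : p.Prime) (hF : IsFilt F p) [Finite G] {r Mx : ℕ} (hU : Uni p A r Mx) (s : ℕ) (hs : s ≤ Mx)
    {v : G} (hv : v ∈ A) (h : v ^ p ∈ pw p A (s + 1)) : v ∈ pw p A s := by
  induction s with
  | zero => simpa [pow_zero] using pow_mem_pw (p := p) hv 0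
  | succ s ih =>
    exact (powmap hp hF A s).2 ((hU _ hs).trans (hU s (by omega)).symm) v
      (ih (by omega) (pw_anti hp hF A (by omega) h)) h

theorem Uni.root (hp : p.Prime) (hF : IsFilt F p) [Finite G] {r Mx : ℕ} (hU : Uni p A r Mx) (s : ℕ) (i : ℕ)
    (hs : i + s ≤ Mx + 1) {v : G} (hv : v ∈ A) (h : v ^ (p ^ i) ∈ pw p A (i + s)) : v ∈ pw p A s := by
  induction i with
  | zero => simpa using h
  | succ i ih =>
    apply ih (by omega)
    apply hU.root1 hp hF _ (by omega) (Subgroup.pow_mem _ hv _)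
    rw [← pow_mul, ← pow_succ]
    convert h using 2
    omega

theorem Uni.canc (hp : p.Prime) (hF : IsFilt F p) [Finite G] {r Mx : ℕ} (hU : Uni p A r Mx) {f s i : ℕ}
    (hs : i + s ≤ Mx + 1) (hsf : s ≤ 2 * f) {v w : G} (hv : v ∈ pw p A f) (hw : w ∈ pw p A f)
    (h : Cg p A (i + s) (v ^ (p ^ i)) (w ^ (p ^ i))) : Cg p A s v w := by
  rw [cg_iff]
  have ht := Subgroup.mul_mem _ (Subgroup.inv_mem _ hv) hw
  apply hU.root hp hF s i hs (pw_le _ ht)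
  have h1 := cg_mulpow hp hF hv ht i
  rw [mul_inv_cancel_left] at h1
  have h2 := (h1.mono hp hF (n' := i + s) (by omega)).trans h.symm
  have h3 := (Cg.refl _ (v ^ (p ^ i))⁻¹).mul h2
  rw [inv_mul_cancel_left, inv_mul_cancel] at h3
  exact cg_one.1 h3
end
end grp2


section grp3
open scoped commutatorElement

variable {G : Type} [Group G] {F : ℕ → Subgroup G} {p : ℕ} {A : Subgroup G}

theorem pw_inv (φ : G →* G) (h : ∀ x ∈ A, φ x ∈ A) (i : ℕ) : ∀ x ∈ pw p A i, φ x ∈ pw p A i := by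
  intro x hx
  have h1 : (pw p A i).map φ ≤ pw p A i := by
    rw [pw_map]
    apply pw_mono
    rintro _ ⟨a, ha, rfl⟩
    exact h a ha
  exact h1 ⟨x, hx, rfl⟩

theorem Cg.map (φ : G →* G) (h : ∀ x ∈ A, φ x ∈ A) {n : ℕ} {x y : G} (hc : Cg p A n x y) :
    Cg p A n (φ x) (φ y) := by
  rw [cg_iff] at *
  rw [← map_inv, ← map_mul]
  exact pw_inv φ h n _ hc

variable [hA : A.Normal]

theorem Sec.prod {H K : Subgroup G} {L : Type} [AddCommGroup L] {ρ : G → L} (h : Sec H K ρ) (u : ℕ → G)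
    (hu : ∀ i, u i ∈ H) (n : ℕ) : ((List.range n).map u).prod ∈ H ∧
      ρ ((List.range n).map u).prod = ∑ i ∈ Finset.range n, ρ (u i) := by
  induction n with
  | zero => simp [H.one_mem, h.one]
  | succ n ih =>
    rw [List.range_succ, List.map_append, List.prod_append, Finset.sum_range_succ, ← ih.2]
    simp only [List.map_cons, List.map_nil, List.prod_cons, List.prod_nil, mul_one]
    exact ⟨H.mul_mem ih.1 (hu n), h.mul _ ih.1 _ (hu n)⟩

theorem Sec.lift_pow {H : Subgroup G} {L : Type} [AddCommGroup L] {ρ : G → L} (φ : MulAut G)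
    (hH : ∀ x ∈ H, φ x ∈ H) (φL : AddMonoid.End L) (hL : ∀ x ∈ H, φL (ρ x) = ρ (φ x)) (n : ℕ) :
    ∀ x ∈ H, (φ ^ n) x ∈ H ∧ (φL ^ n) (ρ x) = ρ ((φ ^ n) x) := by
  induction n with
  | zero => intro x hx; exact ⟨hx, rfl⟩
  | succ n ih =>
    intro x hx
    obtain ⟨h1, h2⟩ := ih _ (hH x hx)
    rw [pow_succ, pow_succ]
    refine ⟨h1, ?_⟩
    rw [E_mul, hL x hx, h2]; rfl

/-- the norm of an element -/
theorem norm_mem (hp : p.Prime) (hF : IsFilt F p) [Finite G] {r Mx : ℕ} (hU : Uni p A r Mx) (ψ : MulAut G)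
    (hψA : ∀ x ∈ A, ψ x ∈ A) (hψ : ψ ^ p = 1) {k : ℕ} (hk : Nat.card {x : G // ψ x = x} ≤ p ^ k)
    {f M : ℕ} (hf : f = M + k) (hMx : 2 * f ≤ Mx + 1) {x : G} (hx : x ∈ pw p A f) :
    ((List.range p).map (fun i => (ψ ^ i) x)).prod ∈ pw p A (f + M) := by
  obtain ⟨L, iL, iF, ρ, hS⟩ := exSec (pw p A f) (pw p A (f + f)) (pw_comm hp hF A f f)
  have hinv := fun i => pw_inv (p := p) (ψ : G →* G) hψA i
  obtain ⟨ψL, hL⟩ := hS.lift (ψ : G →* G) (hinv f) (hinv _)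
  have hfix := hS.fix (pw_anti hp hF A (by omega)) ψ (hinv f) ψL hL
  have hu : ∀ i, (ψ ^ i) x ∈ pw p A f := fun i => (Sec.lift_pow ψ (hinv f) ψL hL i x hx).1
  obtain ⟨hy, hy2⟩ := hS.prod _ hu p
  set y := ((List.range p).map (fun i => (ψ ^ i) x)).prod
  have hyf : ψL (ρ y) = ρ y := by
    have e : ∀ n, ρ ((ψ ^ n) x) = (ψL ^ n) (ρ x) := fun n => ((Sec.lift_pow ψ (hinv f) ψL hL n x hx).2).symm
    rw [hy2, map_sum]
    have e2 : ∀ i, ψL (ρ ((ψ ^ i) x)) = ρ ((ψ ^ (i + 1)) x) := by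
      intro i
      rw [e, e, pow_succ' ψL i]; rfl
    rw [Finset.sum_congr rfl (fun i _ => e2 i)]
    have h1 := Finset.sum_range_succ (fun i => ρ ((ψ ^ i) x)) p
    have h2 := Finset.sum_range_succ' (fun i => ρ ((ψ ^ i) x)) p
    rw [h2, hψ, pow_zero] at h1
    exact add_right_cancel h1
  have hexp : ∀ l : L, p ^ f • l = 0 := by
    intro l
    obtain ⟨x, hx, rfl⟩ := hS.surj l
    rw [← hS.pow hx, hS.eq0 (Subgroup.pow_mem _ hx _)]
    exact pow_mem2 hp hF hx f
  let Fx : AddSubgroup L := (ψL - 1 : AddMonoid.End L).ker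
  obtain ⟨e, he⟩ := card_of_exp (A := Fx) (M := f) hp (fun l => Subtype.ext (hexp l.1))
  have he2 : e ≤ k := by
    have h1 : Nat.card Fx ≤ p ^ k := by
      have := card_fix ψL
      exact (le_of_eq this).trans (hfix.trans hk)
    rw [he] at h1
    exact (Nat.pow_le_pow_iff_right hp.one_lt).1 h1
  have hyk : p ^ k • ρ y = 0 := by
    have hm : ρ y ∈ Fx := by
      change (ψL - 1 : AddMonoid.End L) (ρ y) = 0
      rw [E_sub, E_one, hyf, sub_self]
    have h1 : Nat.card Fx • (⟨ρ y, hm⟩ : Fx) = 0 := card_nsmul_eq_zero'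
    have h2 : p ^ e • ρ y = 0 := by
      rw [he] at h1; exact congrArg Subtype.val h1
    obtain ⟨d, rfl⟩ := Nat.exists_eq_add_of_le he2
    rw [pow_add, mul_comm, mul_smul, h2, smul_zero]
  rw [← hS.pow hy, hS.eq0 (Subgroup.pow_mem _ hy _)] at hyk
  apply hU.root hp hF (f + M) k (by omega) (pw_le _ hy)
  convert hyk using 2
  omega

theorem lie_ring (hp : p.Prime) (hF : IsFilt F p) [Finite G] {r Mx : ℕ} (hU : Uni p A r Mx) (φ : MulAut G)
    (hφA : ∀ x ∈ A, φ x ∈ A) {j m k : ℕ} (hφ : φ ^ (p ^ j * p) = 1) 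
    (hm : Nat.card {x : G // φ x = x} ≤ p ^ m) (hk : Nat.card {x : G // (φ ^ (p ^ j)) x = x} ≤ p ^ k)
    {f M : ℕ} (hf : f = M + k) (hMx : 4 * f ≤ Mx + 1) :
    ∃ (L : Type) (_ : AddCommGroup L) (_ : Finite L) (ρ : G → L) (br : L →+ L →+ L) (φL : AddMonoid.End L),
      Sec (pw p A f) (pw p A (f + M)) ρ ∧ Dat p (p ^ j) m M br φL ∧
      ∀ x ∈ pw p A f, ∀ y ∈ pw p A f, ∃ z ∈ pw p A f, br (ρ x) (ρ y) = ρ z ∧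
        Cg p A (2 * f + M) (z ^ (p ^ f)) ⁅x, y⁆ := by
  obtain ⟨L, iL, iF, ρ, hS⟩ := exSec (pw p A f) (pw p A (f + M)) 
    ((pw_comm hp hF A f f).trans (pw_anti hp hF A (by omega)))
  have hinv := fun i => pw_inv (p := p) (φ : G →* G) hφA i
  have hle : pw p A (f + M) ≤ pw p A f := pw_anti hp hF A (by omega)
  obtain ⟨φL, hL⟩ := hS.lift (φ : G →* G) (hinv f) (hinv _)
  have hcg : ∀ x ∈ pw p A f, ∀ y ∈ pw p A f, (ρ x = ρ y ↔ Cg p A (f + M) x y) := by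
    intro x hx y hy
    rw [hS.eq x hx y hy, cg_iff]
  -- replacing representatives
  have hrep : ∀ x ∈ pw p A f, ∀ y ∈ pw p A f, ∀ z ∈ pw p A f, ∀ x' ∈ pw p A f, ∀ y' ∈ pw p A f, ∀ z' ∈ pw p A f,
      ρ x = ρ x' → ρ y = ρ y' → ρ z = ρ z' → Cg p A (2 * f + M) (z ^ (p ^ f)) ⁅x, y⁆ →
      Cg p A (2 * f + M) (z' ^ (p ^ f)) ⁅x', y'⁆ := by
    intro x hx y hy z hz x' hx' y' hy' z' hz' ex ey ez h
    rw [hcg _ hx _ hx'] at ex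
    rw [hcg _ hy _ hy'] at ey
    rw [hcg _ hz _ hz'] at ez
    have h1 := ((ez.pow hp hF f).symm.mono hp hF (n' := 2 * f + M) (by omega)).trans h
    have h2 := ex.commr hp hF hy
    have h3 := ey.comml hp hF hx'
    exact h1.trans ((h2.mono hp hF (by omega)).trans (h3.mono hp hF (by omega)))
  have huniq : ∀ x ∈ pw p A f, ∀ y ∈ pw p A f, ∀ z ∈ pw p A f, ∀ z' ∈ pw p A f,
      Cg p A (2 * f + M) (z ^ (p ^ f)) ⁅x, y⁆ → Cg p A (2 * f + M) (z' ^ (p ^ f)) ⁅x, y⁆ → ρ z = ρ z' := by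
    intro x hx y hy z hz z' hz' h h'
    rw [hcg _ hz _ hz']
    exact hU.canc hp hF (f := f) (i := f) (by omega) (by omega) hz hz' ((h.trans h'.symm).mono hp hF (by omega))
  have hex : ∀ x ∈ pw p A f, ∀ y ∈ pw p A f, ∃ z ∈ pw p A f, Cg p A (2 * f + M) (z ^ (p ^ f)) ⁅x, y⁆ := by
    intro x hx y hy
    obtain ⟨z, hz, e⟩ := ex_root hp hF (cm_mem hp hF hx hy)
    exact ⟨z, hz, e ▸ Cg.refl _ _⟩
  obtain ⟨br, hbr⟩ := mkBr (fun X Y Z : L => ∃ x ∈ pw p A f, ∃ y ∈ pw p A f, ∃ z ∈ pw p A f, ρ x = X ∧ ρ y = Y ∧ ρ z = Z ∧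
      Cg p A (2 * f + M) (z ^ (p ^ f)) ⁅x, y⁆) (by
    intro X Y
    obtain ⟨x, hx, rfl⟩ := hS.surj X
    obtain ⟨y, hy, rfl⟩ := hS.surj Y
    obtain ⟨z, hz, e⟩ := hex x hx y hy
    exact ⟨ρ z, x, hx, y, hy, z, hz, rfl, rfl, rfl, e⟩) (by
    rintro X Y Z Z' ⟨x, hx, y, hy, z, hz, ex, ey, ez, h⟩ ⟨x', hx', y', hy', z', hz', ex', ey', ez', h'⟩
    rw [← ez, ← ez']
    exact huniq x hx y hy z hz z' hz' h 
      (hrep x' hx' y' hy' z' hz' x hx y hy z' hz' (ex'.trans ex.symm) (ey'.trans ey.symm) rfl h')) (by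
    rintro X X' Y Z Z' ⟨x, hx, y, hy, z, hz, ex, ey, ez, h⟩ ⟨x', hx', y', hy', z', hz', ex', ey', ez', h'⟩
    have h2 := hrep x' hx' y' hy' z' hz' x' hx' y hy z' hz' rfl (ey'.trans ey.symm) rfl h'
    refine ⟨x * x', Subgroup.mul_mem _ hx hx', y, hy, z * z', Subgroup.mul_mem _ hz hz', ?_, ey, ?_, ?_⟩
    · rw [hS.mul _ hx _ hx', ex, ex']
    · rw [hS.mul _ hz _ hz', ez, ez']
    · exact ((cg_mulpow hp hF hz hz' f).symm.mono hp hF (by omega)).trans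
        ((h.mul h2).trans ((cg_mull hp hF hx hx' hy).symm.mono hp hF (by omega)))) (by
    rintro X Y Y' Z Z' ⟨x, hx, y, hy, z, hz, ex, ey, ez, h⟩ ⟨x', hx', y', hy', z', hz', ex', ey', ez', h'⟩
    have h2 := hrep x' hx' y' hy' z' hz' x hx y' hy' z' hz' (ex'.trans ex.symm) rfl rfl h'
    refine ⟨x, hx, y * y', Subgroup.mul_mem _ hy hy', z * z', Subgroup.mul_mem _ hz hz', ex, ?_, ?_, ?_⟩
    · rw [hS.mul _ hy _ hy', ey, ey']
    · rw [hS.mul _ hz _ hz', ez, ez']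
    · exact ((cg_mulpow hp hF hz hz' f).symm.mono hp hF (by omega)).trans
        ((h.mul h2).trans ((cg_mulr hp hF hx hy hy').symm.mono hp hF (by omega))))
  have hbr1 : ∀ x ∈ pw p A f, ∀ y ∈ pw p A f, ∀ z ∈ pw p A f, Cg p A (2 * f + M) (z ^ (p ^ f)) ⁅x, y⁆ →
      br (ρ x) (ρ y) = ρ z := by
    intro x hx y hy z hz h
    obtain ⟨x', hx', y', hy', z', hz', ex', ey', ez', h'⟩ := hbr (ρ x) (ρ y)
    rw [← ez']
    exact huniq x hx y hy z' hz' z hz (hrep x' hx' y' hy' z' hz' x hx y hy z' hz' ex' ey' rfl h') h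
  have hbr2 : ∀ x ∈ pw p A f, ∀ y ∈ pw p A f, ∃ z ∈ pw p A f, br (ρ x) (ρ y) = ρ z ∧
        Cg p A (2 * f + M) (z ^ (p ^ f)) ⁅x, y⁆ := by
    intro x hx y hy
    obtain ⟨z, hz, h⟩ := hex x hx y hy
    exact ⟨z, hz, hbr1 x hx y hy z hz h, h⟩
  have halt : ∀ X, br X X = 0 := by
    intro X
    obtain ⟨x, hx, rfl⟩ := hS.surj X
    rw [hbr1 x hx x hx 1 (Subgroup.one_mem _) (by rw [one_pow, commutatorElement_self]; exact Cg.refl _ _), hS.one]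
  have hanti : ∀ X Y, br X Y = - br Y X := by
    intro X Y
    have := halt (X + Y)
    simp only [map_add, AddMonoidHom.add_apply, halt, zero_add, add_zero] at this
    rw [eq_neg_iff_add_eq_zero, add_comm]; exact this
  have hcyc : ∀ X Y Z, br (br X Y) Z + br (br Y Z) X + br (br Z X) Y = 0 := by
    have key : ∀ x ∈ pw p A f, ∀ y ∈ pw p A f, ∀ z ∈ pw p A f, ∃ w ∈ pw p A f, 
        br (br (ρ x) (ρ y)) (ρ z) = ρ w ∧ Cg p A (3 * f + M) (w ^ (p ^ (2 * f))) ⁅⁅x, y⁆, z⁆ := by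
      intro x hx y hy z hz
      obtain ⟨u, hu, e, h⟩ := hbr2 x hx y hy
      obtain ⟨w, hw, e', h'⟩ := hbr2 u hu z hz
      refine ⟨w, hw, by rw [e, e'], ?_⟩
      have h1 := h'.pow hp hF f
      rw [← pow_mul, ← pow_add, ← two_mul] at h1
      have h2 := powcomm hp hF hu hz f
      have h3 := h.commr hp hF hz
      exact (h1.mono hp hF (by omega)).trans ((h2.symm.mono hp hF (by omega)).trans (h3.mono hp hF (by omega)))
    intro X Y Z
    obtain ⟨x, hx, rfl⟩ := hS.surj X
    obtain ⟨y, hy, rfl⟩ := hS.surj Y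
    obtain ⟨z, hz, rfl⟩ := hS.surj Z
    obtain ⟨w1, hw1, e1, h1⟩ := key x hx y hy z hz
    obtain ⟨w2, hw2, e2, h2⟩ := key y hy z hz x hx
    obtain ⟨w3, hw3, e3, h3⟩ := key z hz x hx y hy
    have hw12 := Subgroup.mul_mem _ hw1 hw2
    have hw := Subgroup.mul_mem _ hw12 hw3
    rw [e1, e2, e3, ← hS.mul _ hw1 _ hw2, ← hS.mul _ hw12 _ hw3, hS.eq0 hw, ← cg_one]
    apply hU.canc hp hF (f := f) (i := 2 * f) (by omega) (by omega) hw (Subgroup.one_mem _)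
    rw [one_pow]
    have g1 := (cg_mulpow hp hF hw12 hw3 (2 * f)).symm.mono hp hF (n' := 3 * f + M) (by omega)
    have g2 := (cg_mulpow hp hF hw1 hw2 (2 * f)).symm.mono hp hF (n' := 3 * f + M) (by omega)
    have g3 := g1.trans (g2.mul (Cg.refl _ _))
    have g4 := g3.trans ((h1.mul h2).mul h3)
    have g5 := (hall_witt hp hF hz hx hy).mono hp hF (n' := 3 * f + M) (by omega)
    exact (g4.trans g5).mono hp hF (by omega)
  refine ⟨L, iL, iF, ρ, br, φL, hS, ⟨halt, ?_, ?_, ?_, ?_, ?_, ?_⟩, hbr2⟩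
  · intro a b c
    have h1 := hcyc a b c
    rw [hanti (br b c) a, hanti c a, map_neg, AddMonoidHom.neg_apply] at h1
    rw [← sub_eq_zero, ← h1]; abel
  · intro X Y
    obtain ⟨x, hx, rfl⟩ := hS.surj X
    obtain ⟨y, hy, rfl⟩ := hS.surj Y
    obtain ⟨z, hz, e, h⟩ := hbr2 x hx y hy
    rw [e, hL z hz, hL x hx, hL y hy]
    symm
    apply hbr1 _ (hinv f _ hx) _ (hinv f _ hy) _ (hinv f _ hz)
    have := h.map (φ : G →* G) hφA
    rwa [map_pow, map_commutatorElement] at this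
  · intro X
    obtain ⟨x, hx, rfl⟩ := hS.surj X
    have hlp := fun n => Sec.lift_pow φ (hinv f) φL hL n x hx
    have h1 := norm_mem hp hF hU (φ ^ (p ^ j)) (fun x hx => ?_) (by rw [← pow_mul, hφ]) hk hf (by omega) hx
    · obtain ⟨h2, h3⟩ := hS.prod (fun i => ((φ ^ (p ^ j)) ^ i) x) (fun i => by
        rw [← pow_mul]; exact (hlp _).1) p
      rw [(hS.eq0 h2).2 h1] at h3
      rw [h3]
      refine Finset.sum_congr rfl (fun i _ => ?_)
      rw [(hlp _).2, pow_mul]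
    · have : ∀ n, ∀ x ∈ A, (φ ^ n) x ∈ A := by
        intro n
        induction n with
        | zero => intro x hx; exact hx
        | succ n ih => intro x hx; rw [pow_succ]; exact ih _ (hφA x hx)
      exact this _ _ hx
  · intro X
    obtain ⟨x, hx, rfl⟩ := hS.surj X
    rw [← hS.pow hx, hS.eq0 (Subgroup.pow_mem _ hx _)]
    exact pow_mem2 hp hF hx M
  · intro a ha X hX
    obtain ⟨x, hx, rfl⟩ := hS.surj X
    rw [← hS.pow hx, hS.eq0 (Subgroup.pow_mem _ hx _)] at hX
    have h1 : x ∈ pw p A (f + (M - a)) := by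
      apply hU.root hp hF _ a (by omega) (pw_le _ hx)
      convert hX using 2; omega
    obtain ⟨y, hy, e⟩ := ex_root hp hF h1
    exact ⟨ρ y, by rw [e, hS.pow hy]⟩
  · exact (hS.fix hle φ (hinv f) φL hL).trans hm
end grp3


section grp4
open scoped commutatorElement

variable {G : Type} [Group G] {F : ℕ → Subgroup G} {p : ℕ} {A : Subgroup G}

def nc (x : ℕ → G) : ℕ → G
  | 0 => x 0
  | n + 1 => ⁅nc x n, x (n + 1)⁆

theorem nc_congr (x y : ℕ → G) (n : ℕ) (h : ∀ i ≤ n, x i = y i) : nc x n = nc y n := by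
  induction n with
  | zero => exact h 0 le_rfl
  | succ n ih => rw [nc, nc, ih (fun i hi => h i (by omega)), h (n + 1) le_rfl]

theorem gamma_le_of_nc (H : Subgroup G) [hH : H.Normal] (n : ℕ) : ∀ (K : Subgroup G), K.Normal →
    (∀ x : ℕ → G, (∀ i, x i ∈ H) → nc x n ∈ K) → gammaIn H n ≤ K := by
  induction n with
  | zero => intro K _ h x hx; exact h (fun _ => x) (fun _ => hx)
  | succ n ih =>
    intro K hK h
    let Z : Subgroup G := (Subgroup.centralizer ((H.map (QuotientGroup.mk' K) : Subgroup (G ⧸ K)) : Set (G ⧸ K))).comap (QuotientGroup.mk' K)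
    have hZ : ∀ g, g ∈ Z ↔ ∀ h ∈ H, ⁅g, h⁆ ∈ K := by
      intro g
      rw [Subgroup.mem_comap, Subgroup.mem_centralizer_iff]
      have e : ∀ h : G, (QuotientGroup.mk' K h * QuotientGroup.mk' K g = QuotientGroup.mk' K g * QuotientGroup.mk' K h) ↔ ⁅g, h⁆ ∈ K := by
        intro h
        rw [← QuotientGroup.eq_one_iff (N := K), eq_comm, ← QuotientGroup.mk'_apply, map_commutatorElement, commutatorElement_eq_one_iff_mul_comm]
      constructor
      · intro hh h hh'
        exact (e h).1 (hh _ ⟨h, hh', rfl⟩)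
      · rintro hh _ ⟨h, hh', rfl⟩
        exact (e h).2 (hh h hh')
    have hn : (H.map (QuotientGroup.mk' K)).Normal := hH.map _ (QuotientGroup.mk'_surjective K)
    have hZn : Z.Normal := inferInstance
    have h1 := ih Z hZn (fun x hx => by
      rw [hZ]
      intro g hg
      have := h (Function.update x (n + 1) g) (fun i => by
        by_cases hi : i = n + 1
        · subst hi; simpa using hg
        · rw [Function.update_of_ne hi]; exact hx i)
      rw [nc, nc_congr _ x n (fun i hi => Function.update_of_ne (by omega) _ _), Function.update_self] at this
      exact this)
    rw [gammaIn, Subgroup.commutator_le]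
    intro g hg h hh
    exact (hZ g).1 (h1 hg) h hh

variable [hA : A.Normal]

theorem uni_gamma (hp : p.Prime) (hF : IsFilt F p) [Finite G] {r Mx : ℕ} (hU : Uni p A r Mx) (φ : MulAut G)
    (hφA : ∀ x ∈ A, φ x ∈ A) {j m k : ℕ} (hφ : φ ^ (p ^ j * p) = 1) 
    (hm : Nat.card {x : G // φ x = x} ≤ p ^ m) (hk : Nat.card {x : G // (φ ^ (p ^ j)) x = x} ≤ p ^ k)
    {f M s : ℕ} (hf : f = M + k) (hMx : 4 * f ≤ Mx + 1) (hMs : (2 ^ m + 2) * f + s ≤ Mx + 1)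
    (hs : (3 * 2 ^ m + 2) * s + latB p (p ^ j) m ≤ M) : gammaIn A (2 ^ m + 1) ≤ pw p A s := by
  obtain ⟨L, iL, iF, ρ, br, φL, hS, hD, hbr⟩ := lie_ring hp hF hU φ hφA hφ hm hk hf hMx
  have hsM : s ≤ M := by
    have := Nat.le_mul_of_pos_left s (show 0 < 3 * 2 ^ m + 2 by omega)
    omega
  have h1 : ∀ x : ℕ → G, (∀ i, x i ∈ pw p A f) → nc x (2 ^ m + 1) ∈ pw p A ((2 ^ m + 2) * f + s) := by
    intro x hx
    have key : ∀ n, ∃ w ∈ pw p A f, nbr br (fun i => ρ (x i)) n = ρ w ∧ 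
        Cg p A ((n + 1) * f + M) (w ^ (p ^ (n * f))) (nc x n) := by
      intro n
      induction n with
      | zero => exact ⟨x 0, hx 0, rfl, by simpa [nc] using Cg.refl _ _⟩
      | succ n ih =>
        obtain ⟨w, hw, e, h⟩ := ih
        obtain ⟨w', hw', e', h'⟩ := hbr w hw (x (n + 1)) (hx _)
        refine ⟨w', hw', by rw [nbr, e, e'], ?_⟩
        have h1 := h'.pow hp hF (n * f)
        rw [← pow_mul, ← pow_add] at h1
        have h2 := powcomm hp hF hw (hx (n + 1)) (n * f)
        have h3 := h.commr hp hF (hx (n + 1))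
        have e1 : (n + 1 + 1) * f = n * f + 2 * f := by ring
        have e2 : (n + 1) * f = n * f + f := by ring
        have e3 : (n + 1) * f = f + n * f := by ring
        rw [nc, e1, e3]
        exact (h1.mono hp hF (by omega)).trans ((h2.symm.mono hp hF (by omega)).trans (h3.mono hp hF (by omega)))
    obtain ⟨w, hw, e, h⟩ := key (2 ^ m + 1)
    have h2 := hD.main hp s hs (fun i => ρ (x i))
    rw [e] at h2
    obtain ⟨l, hl⟩ := h2
    obtain ⟨v, hv, rfl⟩ := hS.surj l
    have hl' : p ^ s • ρ v = ρ w := hl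
    rw [← hS.pow hv, hS.eq _ (Subgroup.pow_mem _ hv _) _ hw, ← cg_iff] at hl'
    have h3 : w ∈ pw p A (f + s) := (hl'.mono hp hF (by omega)).mem (pow_mem2 hp hF hv s)
    have h4 := pow_mem2 hp hF h3 ((2 ^ m + 1) * f)
    have e1 : (2 ^ m + 2) * f = f + (2 ^ m + 1) * f := by ring
    have e2 : (2 ^ m + 1 + 1) * f = f + (2 ^ m + 1) * f := by ring
    rw [e1]
    rw [e2] at h
    exact (h.mono hp hF (by omega)).mem (pw_anti hp hF A (by omega) h4)
  have h2 := gamma_le_of_nc (pw p A f) (2 ^ m + 1) _ inferInstance h1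
  rw [gammaIn_pw hp hF] at h2
  intro g hg
  apply hU.root hp hF s ((2 ^ m + 2) * f) hMs (gamma_anti A (Nat.zero_le _) hg)
  exact h2 (pow_mem_pw hg _)

theorem uni_dvd (hp : p.Prime) (hF : IsFilt F p) [Finite G] {r Mx : ℕ} (hU : Uni p A r Mx) (φ : MulAut G)
    (hφA : ∀ x ∈ A, φ x ∈ A) {j m k : ℕ} (hφ : φ ^ (p ^ j * p) = 1) 
    (hm : Nat.card {x : G // φ x = x} ≤ p ^ m) (hk : Nat.card {x : G // (φ ^ (p ^ j)) x = x} ≤ p ^ k)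
    {f M : ℕ} (hf : f = M + k) (hMx : 4 * f ≤ Mx + 1) (hM : 2 ≤ M) : ∃ d, r = p ^ ((p - 1) * p ^ j * d) := by
  obtain ⟨L, iL, iF, ρ, br, φL, hS, hD, hbr⟩ := lie_ring hp hF hU φ hφA hφ hm hk hf hMx
  obtain ⟨d, hd⟩ := hD.e_dvd hp hM
  refine ⟨d, ?_⟩
  rw [← hd, ← hU f (by omega)]
  symm
  apply hS.index
  intro x hx
  constructor
  · rintro ⟨l, hl⟩
    obtain ⟨v, hv, rfl⟩ := hS.surj l
    have hl' : p ^ 1 • ρ v = ρ x := hl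
    rw [← hS.pow hv, hS.eq _ (Subgroup.pow_mem _ hv _) _ hx, ← cg_iff] at hl'
    exact (hl'.mono hp hF (by omega)).mem (pow_mem2 hp hF hv 1)
  · intro h
    obtain ⟨y, hy, e⟩ := ex_root hp hF h
    exact ⟨ρ y, by rw [e, hS.pow hy]; rfl⟩
end grp4


section ind
open scoped commutatorElement

theorem arith_Z (c Z k b : ℕ) (hZ : 2 * ((c + 2) + (c + 3) * (k + b + 3 * c + 3)) ≤ Z) :
    ∃ f M s, f = M + k ∧ (c + 3) * f ≤ Z ∧ (3 * c + 2) * s + b ≤ M ∧ s ≤ f ∧ 2 ≤ M ∧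
      Z ≤ 2 * (c + 3) * (3 * c + 2) * s := by
  have h1 := Nat.div_add_mod Z (c + 3)
  have h2 := Nat.mod_lt Z (show 0 < c + 3 by omega)
  set f := Z / (c + 3)
  have hf : k + b + 3 * c + 3 ≤ f := by
    by_contra hc
    have h3 : f + 1 ≤ k + b + 3 * c + 3 := by omega
    have h4 := Nat.mul_le_mul_left (c + 3) h3
    have : (c + 3) * (f + 1) = (c + 3) * f + (c + 3) := by ring
    omega
  obtain ⟨M, hM⟩ := Nat.exists_eq_add_of_le (show k ≤ f by omega)
  obtain ⟨d, hd⟩ := Nat.exists_eq_add_of_le (show b ≤ M by omega)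
  have h5 := Nat.div_add_mod d (3 * c + 2)
  have h6 := Nat.mod_lt d (show 0 < 3 * c + 2 by omega)
  set s := d / (3 * c + 2)
  have h7 : s ≤ (3 * c + 2) * s := Nat.le_mul_of_pos_left s (by omega)
  refine ⟨f, M, s, by omega, by omega, by omega, by omega, by omega, ?_⟩
  have h8 : f ≤ (3 * c + 2) * s + (k + b + 3 * c + 1) := by omega
  have h9 := Nat.mul_le_mul_left (c + 3) h8
  have e1 : 2 * (c + 3) * (3 * c + 2) * s = 2 * ((c + 3) * ((3 * c + 2) * s)) := by ring
  have e2 : (c + 3) * ((3 * c + 2) * s + (k + b + 3 * c + 1)) = (c + 3) * ((3 * c + 2) * s) + (c + 3) * (k + b + 3 * c + 1) := by ring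
  have e3 : (c + 3) * (k + b + 3 * c + 3) = (c + 3) * (k + b + 3 * c + 1) + 2 * (c + 3) := by ring
  omega

def Cl (p j m k D f N : ℕ) : Prop :=
  ∀ (G : Type) [Group G] [Finite G] (F : ℕ → Subgroup G), IsFilt F p → (∃ e, Nat.card G = p ^ e) →
  ∀ φ : MulAut G, φ ^ (p ^ j * p) = 1 → Nat.card {x : G // φ x = x} ≤ p ^ m →
    Nat.card {x : G // (φ ^ (p ^ j)) x = x} ≤ p ^ k →
  ∀ A : Subgroup G, A.Normal → (∀ x ∈ A, φ x ∈ A) → (pw p A 1).relIndex A ≤ p ^ D →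
    gammaIn (pw p A f) N = ⊥

section
variable {G : Type} [Group G] {F : ℕ → Subgroup G} {p : ℕ} {A : Subgroup G}

theorem pw_big {e : ℕ} (he : Nat.card G = p ^ e) (A : Subgroup G) : pw p A e = ⊥ := by
  rw [eq_bot_iff, pw, Subgroup.closure_le]
  rintro _ ⟨a, _, rfl⟩
  rw [← he]
  simp

theorem pw_zero (A : Subgroup G) : pw p A 0 = A := by
  refine le_antisymm (pw_le 0) (fun x hx => ?_)
  simpa using pow_mem_pw (p := p) hx 0

theorem gamma_add (hp : p.Prime) (hF : IsFilt F p) (A : Subgroup G) [A.Normal] {n u : ℕ}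
    (h : gammaIn A n ≤ pw p A u) (r : ℕ) : gammaIn A (n + r) ≤ pw p (gammaIn A r) u := by
  induction r with
  | zero => exact h
  | succ r ih =>
    rw [← add_assoc, gammaIn, gammaIn, ← R hp hF]
    exact Subgroup.commutator_mono ih le_rfl

theorem gamma_mul (hp : p.Prime) (hF : IsFilt F p) (A : Subgroup G) [A.Normal] {n u : ℕ}
    (h : gammaIn A n ≤ pw p A u) (t : ℕ) : gammaIn A (t * n) ≤ pw p A (t * u) := by
  induction t with
  | zero => simp [pw_zero, gammaIn]
  | succ t ih =>
    have := (gamma_add hp hF A h (t * n)).trans (pw_mono ih u)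
    rw [pw_pw hp hF] at this
    convert this using 2 <;> ring
end

theorem Cl_zero {p : ℕ} (hp : p.Prime) (j m k : ℕ) : Cl p j m k 0 0 0 := by
  intro G _ _ F hF ⟨e, he⟩ φ _ _ _ A hA _ h
  have h1 : (pw p A 1).relIndex A = 1 := by
    have : (pw p A 1).relIndex A ≠ 0 := Subgroup.index_ne_zero_of_finite
    rw [pow_zero] at h
    omega
  have h2 : A ≤ pw p A 1 := Subgroup.relIndex_eq_one.1 h1
  have h3 : ∀ n, A ≤ pw p A n := by
    intro n
    induction n with
    | zero => rw [pw_zero]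
    | succ n ih =>
      rw [← pw_pw hp hF]
      exact h2.trans (pw_mono ih 1)
  rw [gammaIn, eq_bot_iff, pw_zero, ← pw_big he A]
  exact h3 e

def kk (m N : ℕ) : ℕ := 2 * (N + 1) * (2 * (2 ^ m + 3) * (3 * 2 ^ m + 2))

theorem Cl_step {p : ℕ} (hp : p.Prime) (j m k D f1 N N' : ℕ) (hN : N ≤ N')
    (hN' : (p - 1) * p ^ j ∣ D + 1 → kk m N * (2 ^ m + 1) + N ≤ N') (h : Cl p j m k D f1 N) :
    ∃ f2, Cl p j m k (D + 1) f2 N' := by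
  set b := latB p (p ^ j) m
  set M0 := 2 * ((2 ^ m + 2) + (2 ^ m + 3) * (k + b + 3 * 2 ^ m + 3)) + f1 with hM0
  refine ⟨M0 + f1, ?_⟩
  intro G _ _ F hF ⟨e, he⟩ φ hφ hm hk A hA hφA hr
  have hinv := fun i => pw_inv (p := p) (φ : G →* G) hφA i
  have hIH : ∀ i, (pw p A (i + 1)).relIndex (pw p A i) ≤ p ^ D → gammaIn (pw p A (i + f1)) N = ⊥ := by
    intro i hi
    have := h G F hF ⟨e, he⟩ φ hφ hm hk (pw p A i) inferInstance (hinv i) (by rwa [pw_pw hp hF])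
    rwa [pw_pw hp hF] at this
  by_cases hc : (pw p A (M0 + 1)).relIndex (pw p A M0) ≤ p ^ D
  · rw [eq_bot_iff, ← hIH _ hc]
    exact gamma_anti _ hN
  · have hanti : Antitone (fun i => (pw p A (i + 1)).relIndex (pw p A i)) :=
      antitone_nat_of_succ_le (fun i => (powmap hp hF A i).1)
    have hex : ∃ i, (pw p A (i + 1)).relIndex (pw p A i) ≤ p ^ D := by
      refine ⟨e, ?_⟩
      rw [pw_big he A, Subgroup.relIndex_bot_right]
      exact Nat.one_le_pow _ _ hp.pos
    classical
    set Z := Nat.find hex with hZ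
    have hZ1 := Nat.find_spec hex
    have hZ2 : ∀ i < Z, ¬ (pw p A (i + 1)).relIndex (pw p A i) ≤ p ^ D := fun i hi => Nat.find_min hex hi
    rw [← hZ] at hZ1
    have hZM : M0 < Z := by
      by_contra hcc
      exact hc ((hanti (show Z ≤ M0 by omega)).trans hZ1)
    obtain ⟨Mx, hMx⟩ : ∃ Mx, Z = Mx + 1 := ⟨Z - 1, by omega⟩
    have hU : Uni p A (p ^ (D + 1)) Mx := by
      intro i hi
      have h1 := hZ2 i (by omega)
      have h2 : (pw p A (i + 1)).relIndex (pw p A i) ≤ p ^ (D + 1) := by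
        refine (hanti (Nat.zero_le i)).trans ?_
        simpa [pw_zero] using hr
      have h3 : (pw p A (i + 1)).relIndex (pw p A i) ∣ p ^ e := by
        rw [← he]
        exact (Subgroup.relIndex_dvd_card _ _).trans (Subgroup.card_subgroup_dvd_card _)
      obtain ⟨a, _, ha⟩ := (Nat.dvd_prime_pow hp).1 h3
      rw [ha] at h1 h2 ⊢
      rw [Nat.pow_le_pow_iff_right hp.one_lt] at h1 h2
      congr 1; omega
    obtain ⟨f, M, s, hf, hfZ, hsM, hsf, hM2, hZs⟩ := arith_Z (2 ^ m) Z k b (by omega)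
    have h4f : 4 * f ≤ Mx + 1 := by
      have : 4 * f ≤ (2 ^ m + 3) * f := Nat.mul_le_mul_right f (by have := Nat.one_le_two_pow (n := m); omega)
      omega
    have hMs : (2 ^ m + 2) * f + s ≤ Mx + 1 := by
      have : (2 ^ m + 3) * f = (2 ^ m + 2) * f + f := by ring
      omega
    obtain ⟨d, hd⟩ := uni_dvd hp hF hU φ hφA hφ hm hk hf h4f hM2
    have hN2 := hN' ⟨d, Nat.pow_right_injective hp.two_le hd⟩
    have hg := uni_gamma hp hF hU φ hφA hφ hm hk hf h4f hMs hsM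
    have hg2 := gamma_add hp hF A (gamma_mul hp hF A hg (kk m N)) N
    have hI := hIH Z hZ1
    rw [gammaIn_pw hp hF] at hI
    have hle : (N + 1) * (Z + f1) ≤ kk m N * s := by
      have h1 : (N + 1) * (Z + f1) ≤ (N + 1) * (2 * Z) := Nat.mul_le_mul_left _ (by omega)
      have h2 := Nat.mul_le_mul_left (2 * (N + 1)) hZs
      calc _ ≤ _ := h1
        _ = 2 * (N + 1) * Z := by ring
        _ ≤ _ := h2
        _ = _ := by rw [kk]; ring
    have hA0 : gammaIn A N' = ⊥ := by
      rw [eq_bot_iff, ← hI]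
      exact (gamma_anti A hN2).trans (hg2.trans (pw_anti hp hF _ hle))
    rw [eq_bot_iff, ← hA0]
    exact gamma_mono (pw_le _) _

def NN (m : ℕ) : ℕ → ℕ
  | 0 => 0
  | d + 1 => kk m (NN m d) * (2 ^ m + 1) + NN m d

theorem NN_mono (m : ℕ) : Monotone (NN m) :=
  monotone_nat_of_le_succ (fun n => by rw [NN]; exact Nat.le_add_left _ _)

theorem Cl_all {p : ℕ} (hp : p.Prime) (j m k D : ℕ) : ∃ f, Cl p j m k D f (NN m (D / ((p - 1) * p ^ j))) := by
  induction D with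
  | zero => exact ⟨0, by simpa [NN] using Cl_zero hp j m k⟩
  | succ D ih =>
    obtain ⟨f, hf⟩ := ih
    refine Cl_step hp j m k D f _ _ (NN_mono m (Nat.div_le_div_right (by omega))) (fun h => ?_) hf
    rw [Nat.succ_div_of_dvd h, NN]
end ind


section fin
open scoped commutatorElement

theorem card_map_bound {L : Type} [AddCommGroup L] [Finite L] (f : L →+ L) (S : AddSubgroup L) :
    Nat.card S ≤ Nat.card f.ker * Nat.card (S.map f) := by
  let g : S →+ L := f.comp S.subtype
  have h1 : Nat.card g.ker * Nat.card g.range = Nat.card S := by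
    rw [← AddSubgroup.index_ker]; exact AddSubgroup.card_mul_index _
  have h2 : g.range = S.map f := by
    rw [AddMonoidHom.range_comp, AddSubgroup.range_subtype]
  have h3 : Nat.card g.ker ≤ Nat.card f.ker := by
    refine Nat.card_le_card_of_injective (fun x => (⟨x.1.1, x.2⟩ : f.ker)) ?_
    intro x y e
    have e1 : (x.1.1 : L) = y.1.1 := congrArg (fun z : f.ker => (z : L)) e
    exact Subtype.ext (Subtype.ext e1)
  rw [← h1, h2]
  exact Nat.mul_le_mul_right _ h3

theorem card_nilp {L : Type} [AddCommGroup L] [Finite L] (f : AddMonoid.End L) (n : ℕ) (hn : f ^ n = 0) :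
    Nat.card L ≤ (Nat.card (AddMonoidHom.ker (G := L) f)) ^ n := by
  have key : ∀ i, ∃ S : AddSubgroup L, (∀ x ∈ S, ∃ y, x = (f ^ i) y) ∧ 
      Nat.card L ≤ (Nat.card (AddMonoidHom.ker (G := L) f)) ^ i * Nat.card S := by
    intro i
    induction i with
    | zero => exact ⟨⊤, fun x _ => ⟨x, rfl⟩, by simp⟩
    | succ i ih =>
      obtain ⟨S, h1, h2⟩ := ih
      refine ⟨S.map f, ?_, ?_⟩
      · rintro _ ⟨x, hx, rfl⟩
        obtain ⟨y, rfl⟩ := h1 x hx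
        exact ⟨y, by rw [pow_succ', E_mul]; rfl⟩
      · refine h2.trans ?_
        rw [pow_succ, mul_assoc]
        exact Nat.mul_le_mul_left _ (card_map_bound f S)
  obtain ⟨S, h1, h2⟩ := key n
  have hS : S = ⊥ := by
    rw [eq_bot_iff]
    intro x hx
    obtain ⟨y, rfl⟩ := h1 x hx
    rw [hn, E_zero]; exact AddSubgroup.zero_mem _
  subst hS
  simpa using h2

variable {G : Type} [Group G]

theorem rel_bound {p : ℕ} {F : ℕ → Subgroup G} (hp : p.Prime) (hF : IsFilt F p) [Finite G] (φ : MulAut G)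
    {j m : ℕ} (hφ : φ ^ (p ^ j * p) = 1) (hm : Nat.card {x : G // φ x = x} ≤ p ^ m) :
    (pw p (pw p (⊤ : Subgroup G) 1) 1).relIndex (pw p (⊤ : Subgroup G) 1) ≤ p ^ (m * (p ^ j * p)) := by
  rw [pw_pw hp hF]
  set A : Subgroup G := ⊤
  obtain ⟨L, iL, iF, ρ, hS⟩ := exSec (pw p A 1) (pw p A (1 + 1)) (pw_comm hp hF A 1 1)
  have hinv := fun i => pw_inv (p := p) (A := A) (φ : G →* G) (fun _ _ => Subgroup.mem_top _) i
  obtain ⟨φL, hL⟩ := hS.lift (φ : G →* G) (hinv 1) (hinv _)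
  have hfix := (hS.fix (pw_anti hp hF A (by omega)) φ (hinv 1) φL hL).trans hm
  rw [← hS.index ⊥ (pw p A (1 + 1)) (fun x hx => by rw [AddSubgroup.mem_bot, hS.eq0 hx]), AddSubgroup.index_bot]
  have hexp : ∀ l : L, p • l = 0 := by
    intro l
    obtain ⟨x, hx, rfl⟩ := hS.surj l
    rw [← hS.pow hx, hS.eq0 (Subgroup.pow_mem _ hx _)]
    simpa using pow_mem2 hp hF hx 1
  have hφL : φL ^ (p ^ (j + 1)) = 1 := by
    ext l
    obtain ⟨x, hx, rfl⟩ := hS.surj l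
    rw [(Sec.lift_pow φ (hinv 1) φL hL _ x hx).2, pow_succ, hφ]; rfl
  have hnil : (φL - 1) ^ (p ^ (j + 1)) = 0 := by
    obtain ⟨r, hr⟩ := Commute.exists_add_pow_prime_pow_eq hp (Commute.one_right (φL - 1)) (j + 1)
    rw [sub_add_cancel, hφL, one_pow] at hr
    ext l
    have := congrArg (fun g : AddMonoid.End L => g l) hr
    simp only [E_add, E_mul, E_one, mul_assoc, E_nat, hexp, add_zero] at this
    rw [E_zero]
    exact right_eq_add.1 this
  have := card_nilp (φL - 1) _ hnil
  refine this.trans ?_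
  have h2 : Nat.card (AddMonoidHom.ker (G := L) (φL - 1)) ≤ p ^ m := (le_of_eq (card_fix φL)).trans hfix
  rw [pow_mul, ← pow_succ]
  exact Nat.pow_le_pow_left h2 _

theorem gammaIn_map {H : Type*} [Group H] (f : G →* H) (A : Subgroup G) (n : ℕ) :
    (gammaIn A n).map f = gammaIn (A.map f) n := by
  induction n with
  | zero => rfl
  | succ n ih => rw [gammaIn, gammaIn, Subgroup.map_commutator, ih]

theorem final_aux {p : ℕ} (hp : p.Prime) {n m k f N : ℕ} 
    (hC : Cl p (n - 1) m k (m * (p ^ (n - 1) * p)) f N) [Finite G] (hG : ∃ e : ℕ, Nat.card G = p ^ e)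
    (φ : MulAut G) (ho : orderOf φ = p ^ n) (hm : Nat.card {x : G // φ x = x} = p ^ m)
    (hk : Nat.card {x : G // (φ ^ (p ^ (n - 1))) x = x} = p ^ k) :
    gammaIn (pw p (⊤ : Subgroup G) (1 + f)) N ≤ gammaIn (⊤ : Subgroup G) (p - 1) := by
  have hφ : φ ^ (p ^ (n - 1) * p) = 1 := by
    rw [← orderOf_dvd_iff_pow_eq_one, ho, ← pow_succ]
    exact pow_dvd_pow p (by omega)
  set K : Subgroup G := gammaIn (⊤ : Subgroup G) (p - 1) with hK
  have hKφ : K.map (φ : G →* G) = K := by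
    rw [hK, gammaIn_map, Subgroup.map_top_of_surjective _ φ.surjective]
  let ψ : MulAut (G ⧸ K) := QuotientGroup.congr K K φ hKφ
  have hψ : ∀ n : ℕ, ∀ x : G, (ψ ^ n) (x : G ⧸ K) = ((φ ^ n) x : G) := by
    intro n
    induction n with
    | zero => intro x; rfl
    | succ n ih =>
      intro x
      rw [pow_succ, pow_succ]
      exact ih (φ x)
  have htop : (⊤ : Subgroup G).map (QuotientGroup.mk' K) = ⊤ :=
    Subgroup.map_top_of_surjective _ (QuotientGroup.mk'_surjective K)
  have hcl : gammaIn (⊤ : Subgroup (G ⧸ K)) (p - 1) = ⊥ := by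
    rw [← htop, ← gammaIn_map, ← hK, QuotientGroup.map_mk'_self]
  have hF := isFilt_of_class hp hcl
  have hψ1 : ψ ^ (p ^ (n - 1) * p) = 1 := by
    ext x
    obtain ⟨x, rfl⟩ := QuotientGroup.mk_surjective x
    rw [hψ, hφ]; rfl
  have hm' := (quot_fix K φ ψ (fun x => by simpa using hψ 1 x)).trans hm.le
  have hk' := (quot_fix K (φ ^ (p ^ (n - 1))) (ψ ^ (p ^ (n - 1))) (hψ _)).trans hk.le
  have hcard : ∃ e, Nat.card (G ⧸ K) = p ^ e := by
    obtain ⟨e, he⟩ := hG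
    have h1 : Nat.card (G ⧸ K) ∣ p ^ e := he ▸ Subgroup.card_quotient_dvd_card K
    obtain ⟨a, _, ha⟩ := (Nat.dvd_prime_pow hp).1 h1
    exact ⟨a, ha⟩
  have := hC (G ⧸ K) _ hF hcard ψ hψ1 hm' hk' (pw p ⊤ 1) inferInstance
    (pw_inv (ψ : G ⧸ K →* G ⧸ K) (fun _ _ => Subgroup.mem_top _) 1) (rel_bound hp hF ψ hψ1 hm')
  rw [pw_pw hp hF, ← htop, ← pw_map, ← gammaIn_map, Subgroup.map_eq_bot_iff, QuotientGroup.ker_mk'] at this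
  exact this
end fin

/-- There are functions `f₁(p,n,m,k)` and `g(m) ≥ 1` such that for every
finite `p`-group `G` admitting an automorphism `φ` of order `p^n` with exactly `p^m` fixed
points such that `φ^{p^{n-1}}` has exactly `p^k` fixed points, one has
`γ_{g(m)}(G^{p^{f₁}}) ⊆ γ_p(G)`. -/
theorem stmt13 : ∃ (f₁ : ℕ → ℕ → ℕ → ℕ → ℕ) (g : ℕ → ℕ), (∀ m, 1 ≤ g m) ∧
    ∀ (p n m k : ℕ), p.Prime →
    ∀ (G : Type) [Group G] [Finite G], (∃ e : ℕ, Nat.card G = p ^ e) →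
    ∀ φ : MulAut G, orderOf φ = p ^ n →
      Nat.card {x : G // φ x = x} = p ^ m →
      Nat.card {x : G // (φ ^ (p ^ (n - 1))) x = x} = p ^ k →
      gammaIn (Subgroup.closure {x : G | ∃ y : G, x = y ^ (p ^ (f₁ p n m k))}) (g m - 1)
        ≤ gammaIn (⊤ : Subgroup G) (p - 1) := by
  have hex : ∀ p n m k : ℕ, ∃ f, p.Prime → Cl p (n - 1) m k (m * (p ^ (n - 1) * p)) f
      (NN m ((m * (p ^ (n - 1) * p)) / ((p - 1) * p ^ (n - 1)))) := by
    intro p n m k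
    by_cases hp : p.Prime
    · obtain ⟨f, hf⟩ := Cl_all hp (n - 1) m k (m * (p ^ (n - 1) * p))
      exact ⟨f, fun _ => hf⟩
    · exact ⟨0, fun h => absurd h hp⟩
  choose f hf using hex
  refine ⟨fun p n m k => 1 + f p n m k, fun m => NN m (2 * m) + 1, fun m => Nat.le_add_left _ _, ?_⟩
  intro p n m k hp G _ _ hG φ ho hm hk
  have h1 := final_aux hp (hf p n m k hp) hG φ ho hm hk
  have e : Subgroup.closure {x : G | ∃ y : G, x = y ^ (p ^ (1 + f p n m k))} = pw p ⊤ (1 + f p n m k) := by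
    simp [pw]
  rw [e, Nat.add_sub_cancel]
  refine le_trans (gamma_anti _ (NN_mono m ?_)) h1
  apply Nat.div_le_of_le_mul
  have h2 : p ≤ 2 * (p - 1) := by have := hp.two_le; omega
  calc m * (p ^ (n - 1) * p) ≤ m * (p ^ (n - 1) * (2 * (p - 1))) := by gcongr
    _ = _ := by ring
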